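/- arXiv:2603.16956 — 3 statements merged into one kernel-verified Lean document; each statement's English description precedes it below -/
import Mathlib

section
/- Let G be a multigraph that may admit self-loops, let k be a positive integer, and let S, R ⊆ V(G) with S ∩ R = ∅, |S| ≥ 2, S being 36k-edge-connected in G, and every vertex in R incident to at least 34k edges. Then there exist k pairwise edge-disjoint S-subgraphs of G that balance S ∪ R. -/
/-!
Multigraphs are modelled by a vertex type `V`, an edge type `E`, and an
incidence map `ends : E → Sym2 V` giving the (unordered) pair of endpoints
of each edge.  Subgraphs are identified with their edge sets (`Set E`).
-/

namespace SteinerPacking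

variable {V E : Type}

/-- The set of edges incident to a vertex `u` (denoted `E(u)` in the paper). -/
def incEdges (ends : E → Sym2 V) (u : V) : Set E := {e | u ∈ ends e}

/-- The degree `d(u) = |E(u)|` of a vertex. -/
noncomputable def deg (ends : E → Sym2 V) (u : V) : ℕ := (incEdges ends u).ncard

/-- One step along an edge of the edge set `F`. -/
def Step (ends : E → Sym2 V) (F : Set E) (a b : V) : Prop := ∃ e ∈ F, ends e = s(a, b)

/-- `a` and `b` are joined by a walk using only edges in `F`. -/
def Reaches (ends : E → Sym2 V) (F : Set E) (a b : V) : Prop :=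
  Relation.ReflTransGen (Step ends F) a b

/-- The vertex set `S` is connected in the subgraph with edge set `F`. -/
def ConnectsSet (ends : E → Sym2 V) (F : Set E) (S : Set V) : Prop :=
  ∀ a ∈ S, ∀ b ∈ S, Reaches ends F a b

/-- A walk from `u` to `w` given by a list of edges. -/
inductive IsWalk (ends : E → Sym2 V) : V → V → List E → Prop
  | nil (v : V) : IsWalk ends v v []
  | cons {u v w : V} {e : E} {l : List E} :
      ends e = s(u, v) → IsWalk ends v w l → IsWalk ends u w (e :: l)

/-- A path from `u` to `v` using edges of `F` (a walk with no repeated edges). -/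
def IsPathIn (ends : E → Sym2 V) (F : Set E) (u v : V) (l : List E) : Prop :=
  IsWalk ends u v l ∧ l.Nodup ∧ ∀ e ∈ l, e ∈ F

/-- There are `n` pairwise edge-disjoint paths from `u` to `v` inside `F`. -/
def EdgeDisjointPathsIn (ends : E → Sym2 V) (F : Set E) (n : ℕ) (u v : V) : Prop :=
  ∃ P : Fin n → List E, (∀ i, IsPathIn ends F u v (P i)) ∧
    ∀ i j, i ≠ j → ∀ e ∈ P i, e ∉ P j

/-- `S` is `n`-edge-connected in the (sub)graph with edge set `F`:
any two distinct vertices of `S` are joined by `n` edge-disjoint paths. -/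
def EdgeConnectedIn (ends : E → Sym2 V) (F : Set E) (S : Set V) (n : ℕ) : Prop :=
  ∀ a ∈ S, ∀ b ∈ S, a ≠ b → EdgeDisjointPathsIn ends F n a b

/-- A family of subgraphs (edge sets) is pairwise edge-disjoint. -/
def PairwiseEdgeDisjoint {k : ℕ} (H : Fin k → Set E) : Prop :=
  ∀ i j, i ≠ j → Disjoint (H i) (H j)

/-- `v` is a cut vertex of the subgraph with edge set `H`: some two vertices
distinct from `v` are connected in `H` but not after removing `v`. -/
def IsCutVertexOf (ends : E → Sym2 V) (H : Set E) (v : V) : Prop :=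
  ∃ a b : V, a ≠ v ∧ b ≠ v ∧ Reaches ends H a b ∧
    ¬ Reaches ends {e ∈ H | v ∉ ends e} a b

/-- A subpartition of `E(v)` into `k` (possibly empty) parts. -/
def IsSubpartitionAt {k : ℕ} (ends : E → Sym2 V) (v : V) (P : Fin k → Set E) : Prop :=
  (∀ i, P i ⊆ incEdges ends v) ∧ ∀ i j, i ≠ j → Disjoint (P i) (P j)

/-- A balanced partition of `E(v)` into `k` parts: each part has ≥ 2 edges. -/
def IsBalancedPartitionAt {k : ℕ} (ends : E → Sym2 V) (v : V) (P : Fin k → Set E) : Prop :=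
  IsSubpartitionAt ends v P ∧ (⋃ i, P i) = incEdges ends v ∧ ∀ i, 2 ≤ (P i).ncard

/-- A balanced subpartition of `E(v)`: one extendable to a balanced partition. -/
def IsBalancedSubpartitionAt {k : ℕ} (ends : E → Sym2 V) (v : V) (P : Fin k → Set E) : Prop :=
  IsSubpartitionAt ends v P ∧
    ∃ P' : Fin k → Set E, IsBalancedPartitionAt ends v P' ∧ ∀ i, P i ⊆ P' i

/-- The subgraphs `H 1, …, H k` extend the subpartition `P` at `v`:
`P i ⊆ H i` and `v` is not a cut vertex of any `H i`. -/
def Extend {k : ℕ} (ends : E → Sym2 V) (v : V) (P H : Fin k → Set E) : Prop :=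
  ∀ i, P i ⊆ H i ∧ ¬ IsCutVertexOf ends (H i) v

/-- The subgraphs `H 1, …, H k` balance the vertex `u`. -/
def BalanceVertex {k : ℕ} (ends : E → Sym2 V) (H : Fin k → Set E) (u : V) : Prop :=
  IsBalancedSubpartitionAt ends u (fun i => incEdges ends u ∩ H i)

/-- The subgraphs `H 1, …, H k` balance every vertex of `T`. -/
def BalanceSet {k : ℕ} (ends : E → Sym2 V) (H : Fin k → Set E) (T : Set V) : Prop :=
  ∀ u ∈ T, BalanceVertex ends H u

/-- A loopless multigraph. -/
def Loopless (ends : E → Sym2 V) : Prop := ∀ e : E, ¬ (ends e).IsDiag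

/-- The set of neighbors of a vertex. -/
def neighbors (ends : E → Sym2 V) (u : V) : Set V := {w | ∃ e, ends e = s(u, w)}

section Directed

variable [DecidableEq V]

/-- The arcs of `A` that enter `X`, for arcs directed from `x e` to `y e`. -/
def entering (x y : E → V) (A : Finset E) (X : Finset V) : Finset E :=
  A.filter fun e => x e ∉ X ∧ y e ∈ X

lemma entering_inter_union (x y : E → V) (A : Finset E) (X Y : Finset V) :
    (entering x y A (X ∩ Y)).card + (entering x y A (X ∪ Y)).card
      + (A.filter fun e => x e ∈ Y ∧ x e ∉ X ∧ y e ∈ X ∧ y e ∉ Y).card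
      ≤ (entering x y A X).card + (entering x y A Y).card := by
  simp only [entering, Finset.card_filter, ← Finset.sum_add_distrib]
  refine Finset.sum_le_sum fun e _ => ?_
  by_cases h1 : x e ∈ X <;> by_cases h2 : x e ∈ Y <;> by_cases h3 : y e ∈ X <;>
    by_cases h4 : y e ∈ Y <;> simp [h1, h2, h3, h4]

lemma leaving_le_entering (x y : E → V) (A : Finset E) (Z : Finset V)
    (h : ∀ u ∈ Z, (A.filter fun e => x e = u).card ≤ (A.filter fun e => y e = u).card) :
    (A.filter fun e => x e ∈ Z ∧ y e ∉ Z).card ≤ (entering x y A Z).card := by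
  have h1 : (A.filter fun e => x e ∈ Z).card = ∑ u ∈ Z, (A.filter fun e => x e = u).card := by
    rw [Finset.card_eq_sum_card_fiberwise (f := x) (t := Z) (by intro e; simp)]
    refine Finset.sum_congr rfl fun u hu => ?_
    congr 1; ext e; simp only [Finset.mem_filter]
    constructor
    · tauto
    · rintro ⟨h1, rfl⟩; exact ⟨⟨h1, hu⟩, rfl⟩
  have h2 : (A.filter fun e => y e ∈ Z).card = ∑ u ∈ Z, (A.filter fun e => y e = u).card := by
    rw [Finset.card_eq_sum_card_fiberwise (f := y) (t := Z) (by intro e; simp)]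
    refine Finset.sum_congr rfl fun u hu => ?_
    congr 1; ext e; simp only [Finset.mem_filter]
    constructor
    · tauto
    · rintro ⟨h1, rfl⟩; exact ⟨⟨h1, hu⟩, rfl⟩
  have h3 := Finset.sum_le_sum h
  rw [← h1, ← h2] at h3
  have h4 : (A.filter fun e => x e ∈ Z ∧ y e ∉ Z).card + (A.filter fun e => y e ∈ Z).card
      = (entering x y A Z).card + (A.filter fun e => x e ∈ Z).card := by
    simp only [entering, Finset.card_filter, ← Finset.sum_add_distrib]
    refine Finset.sum_congr rfl fun e _ => ?_
    by_cases h1 : x e ∈ Z <;> by_cases h3 : y e ∈ Z <;> simp [h1, h3]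
  omega

lemma entering_sdiff_sdiff (x y : E → V) (A : Finset E) (X Y : Finset V)
    (h : ∀ u ∈ X ∩ Y, (A.filter fun e => x e = u).card ≤ (A.filter fun e => y e = u).card) :
    (entering x y A (X \ Y)).card + (entering x y A (Y \ X)).card
      + (A.filter fun e => (x e ∈ X ∩ Y ∧ y e ∉ X ∪ Y) ∨ (x e ∉ X ∪ Y ∧ y e ∈ X ∩ Y)).card
      ≤ (entering x y A X).card + (entering x y A Y).card := by
  have h0 := leaving_le_entering x y A (X ∩ Y) h
  have h1 : (entering x y A (X \ Y)).card + (entering x y A (Y \ X)).card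
      + (A.filter fun e => (x e ∈ X ∩ Y ∧ y e ∉ X ∪ Y) ∨ (x e ∉ X ∪ Y ∧ y e ∈ X ∩ Y)).card
      + (entering x y A (X ∩ Y)).card
      ≤ (entering x y A X).card + (entering x y A Y).card
        + (A.filter fun e => x e ∈ X ∩ Y ∧ y e ∉ X ∩ Y).card := by
    simp only [entering, Finset.card_filter, ← Finset.sum_add_distrib]
    refine Finset.sum_le_sum fun e _ => ?_
    by_cases h1 : x e ∈ X <;> by_cases h2 : x e ∈ Y <;> by_cases h3 : y e ∈ X <;>
      by_cases h4 : y e ∈ Y <;> simp [h1, h2, h3, h4]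
  omega

variable [Fintype V] [DecidableEq E]

/-- Directed splitting-off: an arc `f` leaving a non-terminal `u` can be paired with some arc `g`
entering `u` so that replacing both by a single arc keeps the rooted connectivity. -/
lemma exists_splitting (x y : E → V) (A : Finset E) (S : Finset V) (r : V) (hr : r ∈ S) (k : ℕ)
    (hcut : ∀ X : Finset V, r ∉ X → (X ∩ S).Nonempty → k ≤ (entering x y A X).card)
    (hbal : ∀ u ∉ S, (A.filter fun e => x e = u).card ≤ (A.filter fun e => y e = u).card)
    (f : E) (hf : f ∈ A) (u : V) (hu : u ∉ S) (hfu : x f = u) (hfy : y f ≠ u) :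
    ∃ g ∈ A, y g = u ∧ ∀ X : Finset V, r ∉ X → (X ∩ S).Nonempty →
      k ≤ (entering (Function.update x f (x g)) y (A.erase g) X).card := by
  by_contra hcon
  push Not at hcon
  set z := y f with hz
  have hur : u ≠ r := fun h => hu (h ▸ hr)
  let T : Finset V → Prop := fun X => r ∉ X ∧ (X ∩ S).Nonempty ∧ (entering x y A X).card = k
  let T1 : Finset V → Prop := fun X => T X ∧ u ∉ X ∧ z ∈ X
  let T2 : Finset V → Prop := fun X => T X ∧ u ∈ X ∧ z ∉ X
  have hbad : ∀ g ∈ A, y g = u → (∃ X, T1 X ∧ x g ∈ X) ∨ (∃ X, T2 X ∧ x g ∉ X) := by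
    intro g hg hgu
    obtain ⟨X, hX1, hX2, hX3⟩ := hcon g hg hgu
    have hk := hcut X hX1 hX2
    have hgf : f ≠ g := by rintro rfl; exact hfy hgu
    have hfA : f ∈ A.erase g := Finset.mem_erase.2 ⟨hgf, hf⟩
    have key : (entering x y A X).card + (if x g ∉ X ∧ z ∈ X then 1 else 0)
        = (entering (Function.update x f (x g)) y (A.erase g) X).card
          + (if x g ∉ X ∧ u ∈ X then 1 else 0) + (if u ∉ X ∧ z ∈ X then 1 else 0) := by
      simp only [entering, Finset.card_filter]
      rw [← Finset.add_sum_erase A _ hg, ← Finset.add_sum_erase (A.erase g) _ hfA,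
        ← Finset.add_sum_erase (A.erase g) _ hfA]
      have : ∑ e ∈ (A.erase g).erase f, (if Function.update x f (x g) e ∉ X ∧ y e ∈ X then 1 else 0)
          = ∑ e ∈ (A.erase g).erase f, (if x e ∉ X ∧ y e ∈ X then 1 else 0) := by
        refine Finset.sum_congr rfl fun e he => ?_
        rw [Function.update_of_ne (Finset.ne_of_mem_erase he)]
      rw [this]
      simp only [Function.update_self, hgu, hfu, ← hz]
      omega
    by_cases a1 : x g ∈ X <;> by_cases a2 : u ∈ X <;> by_cases a3 : z ∈ X <;>
      simp [a1, a2, a3] at key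
    all_goals first
      | (exfalso; omega)
      | (left; exact ⟨X, ⟨⟨hX1, hX2, by omega⟩, a2, a3⟩, a1⟩)
      | (right; exact ⟨X, ⟨⟨hX1, hX2, by omega⟩, a2, a3⟩, a1⟩)
  have hfilter : ∀ (p : E → Prop) [DecidablePred p], p f → 1 ≤ (A.filter p).card := by
    intro p _ hp
    exact Finset.card_pos.2 ⟨f, Finset.mem_filter.2 ⟨hf, hp⟩⟩
  have hinterS : ∀ X Y : Finset V, T X → T Y → (X ∩ Y ∩ S).Nonempty →
      T (X ∩ Y) ∧ T (X ∪ Y) ∧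
        (A.filter fun e => x e ∈ Y ∧ x e ∉ X ∧ y e ∈ X ∧ y e ∉ Y).card = 0 := by
    intro X Y ⟨a1, a2, a3⟩ ⟨b1, b2, b3⟩ h
    have c1 : r ∉ X ∩ Y := by simp [a1]
    have c2 : r ∉ X ∪ Y := by simp [a1, b1]
    have c3 : ((X ∪ Y) ∩ S).Nonempty := a2.mono (by gcongr; exact Finset.subset_union_left)
    have d1 := hcut _ c1 h
    have d2 := hcut _ c2 c3
    have := entering_inter_union x y A X Y
    exact ⟨⟨c1, h, by omega⟩, ⟨c2, c3, by omega⟩, by omega⟩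
  have hdisjS : ∀ X Y : Finset V, T X → T Y → ¬ (X ∩ Y ∩ S).Nonempty →
      T (X \ Y) ∧ T (Y \ X) ∧
        (A.filter fun e => (x e ∈ X ∩ Y ∧ y e ∉ X ∪ Y) ∨ (x e ∉ X ∪ Y ∧ y e ∈ X ∩ Y)).card = 0 := by
    intro X Y ⟨a1, a2, a3⟩ ⟨b1, b2, b3⟩ h
    have hn : ∀ w ∈ X, w ∈ Y → w ∉ S := fun w h1 h2 h3 => h ⟨w, by simp [h1, h2, h3]⟩
    have c1 : r ∉ X \ Y := by simp [a1]
    have c2 : r ∉ Y \ X := by simp [b1]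
    have c3 : ((X \ Y) ∩ S).Nonempty := by
      obtain ⟨w, hw⟩ := a2
      simp only [Finset.mem_inter] at hw
      exact ⟨w, by simp only [Finset.mem_inter, Finset.mem_sdiff]
                   exact ⟨⟨hw.1, fun h => hn w hw.1 h hw.2⟩, hw.2⟩⟩
    have c4 : ((Y \ X) ∩ S).Nonempty := by
      obtain ⟨w, hw⟩ := b2
      simp only [Finset.mem_inter] at hw
      exact ⟨w, by simp only [Finset.mem_inter, Finset.mem_sdiff]
                   exact ⟨⟨hw.1, fun h => hn w h hw.1 hw.2⟩, hw.2⟩⟩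
    have d1 := hcut _ c1 c3
    have d2 := hcut _ c2 c4
    have := entering_sdiff_sdiff x y A X Y (fun w hw => hbal w (by
      simp only [Finset.mem_inter] at hw; exact hn w hw.1 hw.2))
    exact ⟨⟨c1, c3, by omega⟩, ⟨c2, c4, by omega⟩, by omega⟩
  have hT1 : ∀ X Y, T1 X → T1 Y → T1 (X ∪ Y) := by
    intro X Y ⟨a, a1, a2⟩ ⟨b, b1, b2⟩
    refine ⟨?_, by simp [a1, b1], by simp [a2]⟩
    by_cases h : (X ∩ Y ∩ S).Nonempty
    · exact (hinterS X Y a b h).2.1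
    · have h3 := (hdisjS X Y a b h).2.2
      have := hfilter (fun e => (x e ∈ X ∩ Y ∧ y e ∉ X ∪ Y) ∨ (x e ∉ X ∪ Y ∧ y e ∈ X ∩ Y))
        (by right; simp [hfu, a1, b1, ← hz, a2, b2])
      omega
  have hT2 : ∀ X Y, T2 X → T2 Y → T2 (X ∩ Y) := by
    intro X Y ⟨a, a1, a2⟩ ⟨b, b1, b2⟩
    refine ⟨?_, by simp [a1, b1], by simp [a2]⟩
    by_cases h : (X ∩ Y ∩ S).Nonempty
    · exact (hinterS X Y a b h).1
    · have h3 := (hdisjS X Y a b h).2.2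
      have := hfilter (fun e => (x e ∈ X ∩ Y ∧ y e ∉ X ∪ Y) ∨ (x e ∉ X ∪ Y ∧ y e ∈ X ∩ Y))
        (by left; simp [hfu, a1, b1, ← hz, a2, b2])
      omega
  have hmax : ∀ X0, T1 X0 → ∃ M, T1 M ∧ ∀ X, T1 X → X ⊆ M := by
    intro X0 hX0
    obtain ⟨M, hM, hM'⟩ := Set.Finite.exists_maximalFor Finset.card {X | T1 X}
      (Set.toFinite _) ⟨X0, hX0⟩
    refine ⟨M, hM, fun X hX => ?_⟩
    have h1 := hM' (hT1 M X hM hX) (Finset.card_le_card Finset.subset_union_left)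
    have h2 := Finset.eq_of_subset_of_card_le (Finset.subset_union_left : M ⊆ M ∪ X) h1
    rw [h2]; exact Finset.subset_union_right
  have hmin : ∀ X0, T2 X0 → ∃ M, T2 M ∧ ∀ X, T2 X → M ⊆ X := by
    intro X0 hX0
    obtain ⟨M, hM, hM'⟩ := Set.Finite.exists_minimalFor Finset.card {X | T2 X}
      (Set.toFinite _) ⟨X0, hX0⟩
    refine ⟨M, hM, fun X hX => ?_⟩
    have h1 := hM' (hT2 M X hM hX) (Finset.card_le_card Finset.inter_subset_left)
    have h2 := Finset.eq_of_subset_of_card_le (Finset.inter_subset_left : M ∩ X ⊆ M) h1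
    rw [← h2]; exact Finset.inter_subset_right
  have caseB : ∀ M, T2 M → (∀ g ∈ A, y g = u → x g ∉ M) → False := by
    intro M ⟨⟨a1, a2, a3⟩, b1, b2⟩ hM
    have h1 := hcut (M.erase u) (by simp [a1]) (by
      obtain ⟨w, hw⟩ := a2
      simp only [Finset.mem_inter] at hw
      exact ⟨w, by simp only [Finset.mem_inter, Finset.mem_erase]
                   exact ⟨⟨fun h => hu (h ▸ hw.2), hw.1⟩, hw.2⟩⟩)
    have h2 := hbal u hu
    have h3 : (entering x y A (M.erase u)).card + (A.filter fun e => y e = u).card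
        + (A.filter fun e => e = f).card
        ≤ (entering x y A M).card + (A.filter fun e => x e = u).card := by
      simp only [entering, Finset.card_filter, ← Finset.sum_add_distrib]
      refine Finset.sum_le_sum fun e he => ?_
      have hM' := hM e he
      by_cases c0 : e = f
      · subst c0; simp [hfu, b1, ← hz, b2]; exact fun h => absurd h hfy
      · by_cases c1 : y e = u
        · have c2 := hM' c1
          have : x e ≠ u := fun h => c2 (h ▸ b1)
          simp [c0, c1, c2, b1]
        · by_cases c2 : x e = u
          · simp [c0, c1, c2]; split_ifs <;> simp
          · simp [c0, c1, c2]
    have h4 := hfilter (fun e => e = f) rfl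
    omega
  have caseA : ∀ M, T1 M → (∀ g ∈ A, y g = u → x g ∈ M) → False := by
    intro M ⟨⟨a1, a2, a3⟩, b1, b2⟩ hM
    have h1 := hcut (insert u M) (by simp [a1, hur.symm]) (a2.mono (by
      gcongr; exact Finset.subset_insert _ _))
    have h3 : (entering x y A (insert u M)).card + (A.filter fun e => e = f).card
        ≤ (entering x y A M).card := by
      simp only [entering, Finset.card_filter, ← Finset.sum_add_distrib]
      refine Finset.sum_le_sum fun e he => ?_
      have hM' := hM e he
      by_cases c0 : e = f
      · subst c0; simp [hfu, b1, ← hz, b2]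
      · by_cases c1 : y e = u
        · have c2 := hM' c1
          simp [c0, c2]
        · by_cases c2 : x e = u
          · simp [c0, c1, c2]
          · simp [c0, c1, c2]
    have h4 := hfilter (fun e => e = f) rfl
    omega
  by_cases e2 : ∃ X, T2 X
  · obtain ⟨X2, hX2⟩ := e2
    obtain ⟨M2, hM2, hM2'⟩ := hmin X2 hX2
    by_cases e1 : ∃ X, T1 X
    · obtain ⟨X1, hX1⟩ := e1
      obtain ⟨M1, hM1, hM1'⟩ := hmax X1 hX1
      by_cases h : (M1 ∩ M2 ∩ S).Nonempty
      · have h3 := (hinterS M1 M2 hM1.1 hM2.1 h).2.2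
        have := hfilter (fun e => x e ∈ M2 ∧ x e ∉ M1 ∧ y e ∈ M1 ∧ y e ∉ M2)
          (by simp [hfu, ← hz, hM1.2.1, hM1.2.2, hM2.2.1, hM2.2.2])
        omega
      · have h3 := (hdisjS M1 M2 hM1.1 hM2.1 h).2.1
        refine caseB (M2 \ M1) ⟨h3, by simp [hM1.2.1, hM2.2.1], by simp [hM2.2.2]⟩ ?_
        intro g hg hgu
        rcases hbad g hg hgu with ⟨X, hX, hX'⟩ | ⟨X, hX, hX'⟩
        · simp [hM1' X hX hX']
        · exact fun hh => hX' (hM2' X hX (Finset.mem_sdiff.1 hh).1)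
    · refine caseB M2 hM2 fun g hg hgu => ?_
      rcases hbad g hg hgu with ⟨X, hX, hX'⟩ | ⟨X, hX, hX'⟩
      · exact absurd ⟨X, hX⟩ e1
      · exact fun hh => hX' (hM2' X hX hh)
  · have hin : 1 ≤ (A.filter fun e => y e = u).card :=
      le_trans (hfilter (fun e => x e = u) hfu) (hbal u hu)
    obtain ⟨g0, hg0⟩ := Finset.card_pos.1 hin
    rw [Finset.mem_filter] at hg0
    have hall : ∀ g ∈ A, y g = u → ∃ X, T1 X ∧ x g ∈ X := by
      intro g hg hgu
      rcases hbad g hg hgu with h | ⟨X, hX, hX'⟩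
      · exact h
      · exact absurd ⟨X, hX⟩ e2
    obtain ⟨X1, hX1, _⟩ := hall g0 hg0.1 hg0.2
    obtain ⟨M1, hM1, hM1'⟩ := hmax X1 hX1
    refine caseA M1 hM1 fun g hg hgu => ?_
    obtain ⟨X, hX, hX'⟩ := hall g hg hgu
    exact hM1' X hX hX'

end Directed

section Arborescences

/-- `a` and `b` are joined by a walk whose edges, read with endpoints `x e` and `y e` in either
direction, satisfy `B`. -/
def Linked (x y : E → V) (B : E → Prop) : V → V → Prop :=
  Relation.ReflTransGen fun a b => ∃ e, B e ∧ ((x e = a ∧ y e = b) ∨ (x e = b ∧ y e = a))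

lemma Linked.mono {x y : E → V} {B B' : E → Prop} (h : ∀ e, B e → B' e) {a b : V}
    (hab : Linked x y B a b) : Linked x y B' a b :=
  Relation.ReflTransGen.mono (fun _ _ ⟨e, he, h'⟩ => ⟨e, h e he, h'⟩) _ _ hab

lemma Linked.symm {x y : E → V} {B : E → Prop} {a b : V}
    (hab : Linked x y B a b) : Linked x y B b a := by
  induction hab with
  | refl => exact Relation.ReflTransGen.refl
  | tail _ h ih =>
    obtain ⟨e, he, h⟩ := h
    exact Relation.ReflTransGen.head ⟨e, he, h.symm⟩ ih

lemma Linked.trans {x y : E → V} {B : E → Prop} {a b c : V}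
    (hab : Linked x y B a b) (hbc : Linked x y B b c) : Linked x y B a c :=
  Relation.ReflTransGen.trans hab hbc

lemma Linked.of_edge {x y : E → V} {B : E → Prop} {e : E} (he : B e) :
    Linked x y B (x e) (y e) :=
  Relation.ReflTransGen.single ⟨e, he, Or.inl ⟨rfl, rfl⟩⟩

/-- Links can be transported along a map of graphs, edge by edge. -/
lemma Linked.lift {V' : Type} {x y : E → V} {x' y' : E → V'} {B B' : E → Prop} (φ : V → V')
    (h : ∀ e, B e → Linked x' y' B' (φ (x e)) (φ (y e))) {a b : V}
    (hab : Linked x y B a b) : Linked x' y' B' (φ a) (φ b) := by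
  induction hab with
  | refl => exact Relation.ReflTransGen.refl
  | tail _ h2 ih =>
    obtain ⟨e, he, ⟨rfl, rfl⟩ | ⟨rfl, rfl⟩⟩ := h2
    · exact ih.trans (h e he)
    · exact ih.trans (h e he).symm

variable [DecidableEq V] [DecidableEq E] [Fintype V]

lemma exists_spanning_arborescence (x y : E → V) (A : Finset E) (S : Finset V) (r : V) (k : ℕ)
    (hA : ∀ e ∈ A, y e ∈ S)
    (hcut : ∀ X : Finset V, r ∉ X → (X ∩ S).Nonempty → k + 1 ≤ (entering x y A X).card) :
    ∃ F ⊆ A, (∀ e ∈ F, y e ≠ r) ∧ (∀ w, (F.filter fun e => y e = w).card ≤ 1) ∧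
      (∀ s ∈ S, Linked x y (fun e => e ∈ F) r s) ∧
      ∀ X : Finset V, r ∉ X → (X ∩ S).Nonempty → k ≤ (entering x y (A \ F) X).card := by
  let P : Finset V → Prop := fun T => r ∈ T ∧ ∃ F ⊆ A, (∀ e ∈ F, x e ∈ T ∧ y e ∈ T) ∧
      (∀ e ∈ F, y e ≠ r) ∧ (∀ w, (F.filter fun e => y e = w).card ≤ 1) ∧
      (∀ s ∈ T, Linked x y (fun e => e ∈ F) r s) ∧
      ∀ X : Finset V, r ∉ X → (X ∩ S).Nonempty → k ≤ (entering x y (A \ F) X).card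
  have hP0 : P {r} := by
    refine ⟨by simp, ∅, by simp, by simp, by simp, by simp, ?_, ?_⟩
    · intro s hs
      rw [Finset.mem_singleton] at hs
      subst hs; exact Relation.ReflTransGen.refl
    · intro X h1 h2
      have := hcut X h1 h2
      simp only [Finset.sdiff_empty]; omega
  obtain ⟨T, ⟨hrT, F, hFA, hFT, hFr, hF1, hFc, hFk⟩, hmax⟩ :=
    Set.Finite.exists_maximalFor Finset.card {X | P X} (Set.toFinite _) ⟨_, hP0⟩
  by_cases hST : S ⊆ T
  · exact ⟨F, hFA, hFr, hF1, fun s hs => hFc s (hST hs), hFk⟩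
  exfalso
  suffices h : ∃ e ∈ A \ F, x e ∈ T ∧ y e ∉ T ∧ ∀ X : Finset V, r ∉ X → x e ∉ X → y e ∈ X →
      k + 1 ≤ (entering x y (A \ F) X).card by
    obtain ⟨e, he, hxe, hye, hX⟩ := h
    rw [Finset.mem_sdiff] at he
    have hPn : P (insert (y e) T) := by
      refine ⟨by simp [hrT], insert e F, ?_, ?_, ?_, ?_, ?_, ?_⟩
      · exact Finset.insert_subset he.1 hFA
      · intro f hf
        rcases Finset.mem_insert.1 hf with rfl | hf
        · simp [hxe]
        · simp [hFT f hf]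
      · intro f hf
        rcases Finset.mem_insert.1 hf with rfl | hf
        · rintro h; rw [h] at hye; exact hye hrT
        · exact hFr f hf
      · intro w
        rw [Finset.filter_insert]
        split_ifs with hw
        · have : F.filter (fun e => y e = w) = ∅ := by
            rw [Finset.filter_eq_empty_iff]
            intro f hf hfw
            exact hye (by rw [hw, ← hfw]; exact (hFT f hf).2)
          simp [this]
        · exact hF1 w
      · have hm : ∀ s ∈ T, Linked x y (fun f => f ∈ insert e F) r s :=
          fun s hs => (hFc s hs).mono fun f hf => Finset.mem_insert_of_mem hf
        intro s hs
        rcases Finset.mem_insert.1 hs with rfl | hs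
        · exact (hm _ hxe).trans
            (Linked.of_edge (B := fun f => f ∈ insert e F) (Finset.mem_insert_self e F))
        · exact hm s hs
      · intro X h1 h2
        have hE : entering x y (A \ insert e F) X = (entering x y (A \ F) X).erase e := by
          ext f; simp only [entering, Finset.mem_filter, Finset.mem_sdiff, Finset.mem_insert,
            Finset.mem_erase]; tauto
        rw [hE]
        by_cases hX' : x e ∉ X ∧ y e ∈ X
        · have := hX X h1 hX'.1 hX'.2
          have := Finset.pred_card_le_card_erase (s := entering x y (A \ F) X) (a := e)
          omega
        · rw [Finset.erase_eq_of_notMem]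
          · exact hFk X h1 h2
          · simp only [entering, Finset.mem_filter]; tauto
    have := hmax hPn (Finset.card_le_card (Finset.subset_insert _ _))
    have h2 : (insert (y e) T).card = T.card + 1 := Finset.card_insert_of_notMem hye
    omega
  by_cases ht : ∃ X : Finset V, r ∉ X ∧ ((X ∩ S) \ T).Nonempty ∧ (entering x y (A \ F) X).card = k
  · obtain ⟨X, ⟨hX1, hX2, hX3⟩, hmin⟩ := Set.Finite.exists_minimalFor Finset.card
      {X : Finset V | r ∉ X ∧ ((X ∩ S) \ T).Nonempty ∧ (entering x y (A \ F) X).card = k}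
      (Set.toFinite _) ht
    have hXT : entering x y (A \ F) (X \ T) = entering x y A (X \ T) := by
      ext f; simp only [entering, Finset.mem_filter, Finset.mem_sdiff]
      have := hFT f
      tauto
    have h1 : k + 1 ≤ (entering x y A (X \ T)).card := by
      refine hcut _ (by simp [hX1]) ?_
      obtain ⟨w, hw⟩ := hX2
      refine ⟨w, ?_⟩
      simp only [Finset.mem_inter, Finset.mem_sdiff] at hw ⊢
      tauto
    rw [← hXT] at h1
    obtain ⟨e, he, he'⟩ : ∃ e ∈ entering x y (A \ F) (X \ T), e ∉ entering x y (A \ F) X := by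
      apply Finset.exists_mem_notMem_of_card_lt_card
      omega
    simp only [entering, Finset.mem_filter, Finset.mem_sdiff] at he he'
    have hxX : x e ∈ X := by tauto
    have hxT : x e ∈ T := by tauto
    refine ⟨e, Finset.mem_sdiff.2 he.1, hxT, he.2.2.2, ?_⟩
    intro Y hY1 hxY hyY
    have hyS := hA e he.1.1
    by_contra hlt
    have hYk := hFk Y hY1 ⟨y e, by simp [hyY, hyS]⟩
    have hi := hFk (X ∩ Y) (by simp [hX1]) ⟨y e, by simp [hyY, hyS, he.2.2.1]⟩
    have hu := hFk (X ∪ Y) (by simp [hX1, hY1]) ⟨y e, by simp [hyY, hyS]⟩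
    have hsub := entering_inter_union x y (A \ F) X Y
    have := hmin (j := X ∩ Y) ⟨by simp [hX1], ⟨y e, by simp [hyY, hyS, he.2.2]⟩, by omega⟩
      (Finset.card_le_card Finset.inter_subset_left)
    have h2 := Finset.eq_of_subset_of_card_le Finset.inter_subset_left this
    exact hxY (Finset.inter_eq_left.1 h2 hxX)
  · push Not at ht
    obtain ⟨s, hs, hsT⟩ := Finset.not_subset.1 hST
    have h1 := hcut Tᶜ (by simp [hrT]) ⟨s, by simp [hs, hsT]⟩
    obtain ⟨e, he⟩ := Finset.card_pos.1 (lt_of_lt_of_le (Nat.succ_pos k) h1)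
    simp only [entering, Finset.mem_filter, Finset.mem_compl, not_not] at he
    refine ⟨e, Finset.mem_sdiff.2 ⟨he.1, fun h => he.2.2 (hFT e h).2⟩, he.2.1, he.2.2, ?_⟩
    intro X hX1 hX2 hX3
    have h2 := hFk X hX1 ⟨y e, by simp [hX3, hA e he.1]⟩
    have h3 := ht X hX1 ⟨y e, by simp [hX3, hA e he.1, he.2.2]⟩
    omega

/-- Edmonds' arborescence packing, for arcs whose heads all lie in `S`. -/
lemma exists_arborescences (x y : E → V) (S : Finset V) (r : V) (k : ℕ) : ∀ A : Finset E,
    (∀ e ∈ A, y e ∈ S) →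
    (∀ X : Finset V, r ∉ X → (X ∩ S).Nonempty → k ≤ (entering x y A X).card) →
    ∃ h : E → ℕ, (∀ e, h e < k → e ∈ A) ∧ (∀ e, h e < k → y e ≠ r) ∧
      (∀ w, (A.filter fun e => h e < k ∧ y e = w).card ≤ k) ∧
      ∀ i < k, ∀ s ∈ S, Linked x y (fun e => h e = i) r s := by
  induction k with
  | zero => intro A _ _; exact ⟨fun _ => 0, by simp, by simp, by simp, by simp⟩
  | succ k ih =>
    intro A hA hcut
    obtain ⟨F, hFA, hFr, hF1, hFc, hFk⟩ := exists_spanning_arborescence x y A S r k hA hcut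
    obtain ⟨h, h1, h2, h3, h4⟩ := ih (A \ F) (fun e he => hA e (Finset.mem_sdiff.1 he).1) hFk
    have hlt : ∀ e, (if e ∈ F then k else if h e < k then h e else k + 1) < k + 1 ↔
        e ∈ F ∨ h e < k := by
      intro e; split_ifs with a b <;> simp [a]
      · omega
      · omega
    refine ⟨fun e => if e ∈ F then k else if h e < k then h e else k + 1, ?_, ?_, ?_, ?_⟩
    · intro e he
      rcases (hlt e).1 he with he | he
      · exact hFA he
      · exact (Finset.mem_sdiff.1 (h1 e he)).1
    · intro e he
      rcases (hlt e).1 he with he | he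
      · exact hFr e he
      · exact h2 e he
    · intro w
      beta_reduce
      have : (A.filter fun e => (if e ∈ F then k else if h e < k then h e else k + 1) < k + 1 ∧
          y e = w) ⊆ (F.filter fun e => y e = w) ∪
            ((A \ F).filter fun e => h e < k ∧ y e = w) := by
        intro e
        simp only [Finset.mem_filter, hlt, Finset.mem_union, Finset.mem_sdiff]
        tauto
      have h5 := Finset.card_le_card this
      have h6 := Finset.card_union_le (F.filter fun e => y e = w)
            ((A \ F).filter fun e => h e < k ∧ y e = w)
      have := hF1 w
      have := h3 w
      omega
    · intro i hi s hs
      rcases Nat.lt_succ_iff_lt_or_eq.1 hi with hi | rfl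
      · refine (h4 i hi s hs).mono fun e he => ?_
        have h5 : h e < k := by omega
        have h6 := (Finset.mem_sdiff.1 (h1 e h5)).2
        simp [h6, he, hi]
      · refine (hFc s hs).mono fun e he => by simp [he]

end Arborescences

section Branching

variable [DecidableEq V] [DecidableEq E] [Fintype V]

/-- Packing of rooted `S`-subgraphs in a digraph in which no non-terminal has more outgoing than
incoming arcs. -/
lemma exists_rooted_packing (y : E → V) (S : Finset V) (r : V) (hr : r ∈ S) (k : ℕ) :
    ∀ (n : ℕ) (x : E → V) (A : Finset E), A.card = n →
    (∀ X : Finset V, r ∉ X → (X ∩ S).Nonempty → k ≤ (entering x y A X).card) →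
    (∀ u ∉ S, (A.filter fun e => x e = u).card ≤ (A.filter fun e => y e = u).card) →
    ∃ h : E → ℕ, (∀ e, h e < k → e ∈ A) ∧ (∀ e, h e < k → y e ≠ r) ∧
      (∀ i < k, ∀ s ∈ S, Linked x y (fun e => h e = i) r s) ∧
      (∀ w ∈ S, (A.filter fun e => h e < k ∧ y e = w).card ≤ k) ∧
      ∀ u ∉ S, (A.filter fun e => h e < k ∧ y e = u).card ≤ (A.filter fun e => x e = u).card := by
  intro n
  induction n with
  | zero =>
    intro x A hn hcut hbal
    rw [Finset.card_eq_zero] at hn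
    subst hn
    rcases Nat.eq_zero_or_pos k with rfl | hk
    · exact ⟨fun _ => 0, by simp, by simp, by simp, by simp, by simp⟩
    · refine ⟨fun _ => k, by simp, by simp, ?_, by simp, by simp⟩
      intro i hi s hs
      by_cases hsr : s = r
      · subst hsr; exact Relation.ReflTransGen.refl
      · have := hcut {s} (by simpa using Ne.symm hsr) ⟨s, by simp [hs]⟩
        simp [entering] at this
        omega
  | succ n ih =>
    intro x A hn hcut hbal
    by_cases hloop : ∃ f ∈ A, x f ∉ S ∧ x f = y f
    · obtain ⟨f, hf, hfS, hxy⟩ := hloop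
      obtain ⟨h, h1, h2, h3, h4, h5⟩ := ih x (A.erase f) (by rw [Finset.card_erase_of_mem hf]; omega)
        (by
          intro X a b
          convert hcut X a b using 2
          ext e; simp only [entering, Finset.mem_filter, Finset.mem_erase]
          constructor
          · tauto
          · rintro ⟨a, b, c⟩
            exact ⟨⟨by rintro rfl; rw [hxy] at b; exact b c, a⟩, b, c⟩)
        (by
          intro u hu
          have := hbal u hu
          simp only [Finset.card_filter] at this ⊢
          rw [← Finset.add_sum_erase A _ hf, ← Finset.add_sum_erase A _ hf, hxy] at this
          omega)
      have hfk : ¬ h f < k := fun hh => by simpa using h1 f hh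
      have hE : ∀ w, (A.filter fun e => h e < k ∧ y e = w)
          = ((A.erase f).filter fun e => h e < k ∧ y e = w) := by
        intro w; ext e; simp only [Finset.mem_filter, Finset.mem_erase]
        constructor
        · rintro ⟨a, b, c⟩
          exact ⟨⟨by rintro rfl; exact hfk b, a⟩, b, c⟩
        · tauto
      refine ⟨h, fun e he => Finset.mem_of_mem_erase (h1 e he), h2, h3, ?_, ?_⟩
      · intro w hw; rw [hE]; exact h4 w hw
      · intro w hw; rw [hE]; refine (h5 w hw).trans (Finset.card_le_card ?_)
        exact Finset.filter_subset_filter _ (Finset.erase_subset _ _)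
    by_cases hsp : ∃ f ∈ A, x f ∉ S
    · obtain ⟨f, hf, hfS⟩ := hsp
      have hfy : y f ≠ x f := fun h => hloop ⟨f, hf, hfS, h.symm⟩
      obtain ⟨g, hg, hgu, hg'⟩ := exists_splitting x y A S r hr k hcut hbal f hf (x f) hfS rfl hfy
      have hfg : f ≠ g := by rintro rfl; exact hfy hgu
      have hfA : f ∈ A.erase g := Finset.mem_erase.2 ⟨hfg, hf⟩
      have hout : ∀ w, (A.filter fun e => x e = w).card =
          ((A.erase g).filter fun e => Function.update x f (x g) e = w).card
            + (if x f = w then 1 else 0) := by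
        intro w
        simp only [Finset.card_filter]
        rw [← Finset.add_sum_erase A _ hg, ← Finset.add_sum_erase (A.erase g) _ hfA,
          ← Finset.add_sum_erase (A.erase g) _ hfA]
        have : ∑ e ∈ (A.erase g).erase f, (if Function.update x f (x g) e = w then 1 else 0)
            = ∑ e ∈ (A.erase g).erase f, (if x e = w then 1 else 0) := by
          refine Finset.sum_congr rfl fun e he => ?_
          rw [Function.update_of_ne (Finset.ne_of_mem_erase he)]
        rw [this]
        simp only [Function.update_self]
        omega
      obtain ⟨h, h1, h2, h3, h4, h5⟩ := ih (Function.update x f (x g)) (A.erase g)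
        (by rw [Finset.card_erase_of_mem hg]; omega) hg' (by
          intro u hu
          have := hbal u hu
          rw [hout] at this
          simp only [Finset.card_filter] at this ⊢
          rw [← Finset.add_sum_erase A (fun i => if y i = u then 1 else 0) hg, hgu] at this
          omega)
      have hgk : ¬ h g < k := fun hh => by simpa using h1 g hh
      have hne : ∀ e, e ≠ g → Function.update h g (h f) e = h e :=
        fun e he => Function.update_of_ne he _ _
      have hcount : ∀ w, (A.filter fun e => Function.update h g (h f) e < k ∧ y e = w).card
          ≤ ((A.erase g).filter fun e => h e < k ∧ y e = w).card
            + (if x f = w then 1 else 0) := by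
        intro w
        simp only [Finset.card_filter]
        rw [← Finset.add_sum_erase A _ hg]
        have : ∑ e ∈ A.erase g, (if Function.update h g (h f) e < k ∧ y e = w then 1 else 0)
            = ∑ e ∈ A.erase g, (if h e < k ∧ y e = w then 1 else 0) := by
          refine Finset.sum_congr rfl fun e he => ?_
          rw [hne e (Finset.ne_of_mem_erase he)]
        rw [this, hgu]
        have : (if Function.update h g (h f) g < k ∧ x f = w then 1 else 0)
          ≤ (if x f = w then 1 else 0) := by split_ifs <;> simp_all
        omega
      refine ⟨Function.update h g (h f), ?_, ?_, ?_, ?_, ?_⟩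
      · intro e he
        by_cases heg : e = g
        · exact heg ▸ hg
        · rw [hne e heg] at he
          exact Finset.mem_of_mem_erase (h1 e he)
      · intro e he
        by_cases heg : e = g
        · subst heg; rw [hgu]; rintro hh; exact hfS (hh ▸ hr)
        · rw [hne e heg] at he
          exact h2 e he
      · intro i hi s hs
        refine Linked.lift (fun v => v) ?_ (h3 i hi s hs)
        intro e he
        have heg : e ≠ g := by rintro rfl; omega
        have e1 : Linked x y (fun e => Function.update h g (h f) e = i) (x e) (y e) :=
          Linked.of_edge (by rw [hne e heg]; exact he)
        by_cases hef : e = f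
        · subst hef
          rw [Function.update_self]
          have e2 : Linked x y (fun e' => Function.update h g (h e) e' = i) (x g) (y g) :=
            Linked.of_edge (by rw [Function.update_self]; exact he)
          rw [hgu] at e2
          exact e2.trans e1
        · rwa [Function.update_of_ne hef]
      · intro w hw
        have := hcount w
        have h6 := h4 w hw
        rw [if_neg (by rintro rfl; exact hfS hw)] at this
        omega
      · intro w hw
        have := hcount w
        have h6 := h5 w hw
        have := hout w
        omega
    · push Not at hsp
      obtain ⟨h, h1, h2, h3, h4⟩ := exists_arborescences x y S r k (A.filter fun e => y e ∈ S)
        (by simp) (by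
          intro X a b
          refine (hcut (X ∩ S) (by simp [a]) (by simpa using b)).trans (Finset.card_le_card ?_)
          intro e
          have := hsp e
          simp only [entering, Finset.mem_filter, Finset.mem_inter]
          tauto)
      refine ⟨h, fun e he => (Finset.mem_filter.1 (h1 e he)).1, h2, h4, ?_, ?_⟩
      · intro w hw
        refine le_trans (Finset.card_le_card ?_) (h3 w)
        intro e
        have := h1 e
        simp only [Finset.mem_filter] at *
        tauto
      · intro w hw
        rw [Finset.filter_eq_empty_iff.2]
        · simp
        · rintro e he ⟨a, rfl⟩
          exact hw (Finset.mem_filter.1 (h1 e a)).2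

end Branching

section Orientation

variable [DecidableEq V]

/-- The edges of `A` with both ends in `X`. -/
def inside (x y : E → V) (A : Finset E) (X : Finset V) : Finset E :=
  A.filter fun e => x e ∈ X ∧ y e ∈ X

/-- The edges of `A` with exactly one end in `X`. -/
def crossing (x y : E → V) (A : Finset E) (X : Finset V) : Finset E :=
  A.filter fun e => ¬ (x e ∈ X ↔ y e ∈ X)

/-- The edges of `A` having `u` as an end. -/
def incident (x y : E → V) (A : Finset E) (u : V) : Finset E :=
  A.filter fun e => x e = u ∨ y e = u

lemma sum_card_filter_eq (z : E → V) (A : Finset E) (X : Finset V) :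
    ∑ u ∈ X, (A.filter fun e => z e = u).card = (A.filter fun e => z e ∈ X).card := by
  rw [Finset.card_eq_sum_card_fiberwise (f := z) (s := A.filter fun e => z e ∈ X) (t := X)
    (by intro e; simp)]
  refine Finset.sum_congr rfl fun u hu => ?_
  congr 1; ext e; simp only [Finset.mem_filter]
  constructor
  · rintro ⟨h1, rfl⟩; exact ⟨⟨h1, hu⟩, rfl⟩
  · tauto

lemma card_incident (x y : E → V) (A : Finset E) (hl : ∀ e ∈ A, x e ≠ y e) (u : V) :
    (incident x y A u).card
      = (A.filter fun e => x e = u).card + (A.filter fun e => y e = u).card := by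
  simp only [incident, Finset.card_filter, ← Finset.sum_add_distrib]
  refine Finset.sum_congr rfl fun e he => ?_
  have := hl e he
  by_cases h1 : x e = u <;> by_cases h2 : y e = u <;> simp [h1, h2]
  exact this (h1.trans h2.symm)

lemma sum_card_incident (x y : E → V) (A : Finset E) (hl : ∀ e ∈ A, x e ≠ y e) (X : Finset V) :
    ∑ u ∈ X, (incident x y A u).card
      = (A.filter fun e => x e ∈ X).card + (A.filter fun e => y e ∈ X).card := by
  simp only [card_incident x y A hl, Finset.sum_add_distrib, sum_card_filter_eq]

lemma handshake (x y : E → V) (A : Finset E) (hl : ∀ e ∈ A, x e ≠ y e) (X : Finset V) :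
    ∑ u ∈ X, (incident x y A u).card
      = 2 * (inside x y A X).card + (crossing x y A X).card := by
  rw [sum_card_incident x y A hl, two_mul]
  simp only [inside, crossing, Finset.card_filter, ← Finset.sum_add_distrib]
  refine Finset.sum_congr rfl fun e he => ?_
  by_cases h1 : x e ∈ X <;> by_cases h2 : y e ∈ X <;> simp [h1, h2]

variable [DecidableEq E] [Fintype V]

omit [Fintype V] in
/-- A consequence of Hall's theorem: edges can be assigned to their ends respecting capacities as
soon as every vertex set has enough capacity for the edges inside it. -/
lemma exists_orientation (x y : E → V) (A : Finset E) (m : V → ℕ)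
    (hm : ∀ X : Finset V, (inside x y A X).card ≤ ∑ v ∈ X, m v) :
    ∃ hd : E → V, (∀ e, hd e = x e ∨ hd e = y e) ∧
      ∀ w, (A.filter fun e => hd e = w).card ≤ m w := by
  let t : A → Finset (Σ _ : V, ℕ) := fun e =>
    ({x e, y e} : Finset V).sigma fun w => Finset.range (m w)
  have hall : ∀ s : Finset A, s.card ≤ (s.biUnion t).card := by
    intro s
    let X : Finset V := s.biUnion fun e => {x e, y e}
    have h1 : s.biUnion t = X.sigma fun w => Finset.range (m w) := by
      ext ⟨w, j⟩
      simp only [t, X, Finset.mem_biUnion, Finset.mem_sigma, Finset.mem_range]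
      constructor
      · rintro ⟨e, he, h1, h2⟩; exact ⟨⟨e, he, h1⟩, h2⟩
      · rintro ⟨⟨e, he, h1⟩, h2⟩; exact ⟨e, he, h1, h2⟩
    rw [h1, Finset.card_sigma]
    simp only [Finset.card_range]
    refine le_trans ?_ (hm X)
    rw [← Finset.card_map (Function.Embedding.subtype _)]
    refine Finset.card_le_card ?_
    intro e he
    simp only [Finset.mem_map, Function.Embedding.subtype_apply] at he
    obtain ⟨e, he, rfl⟩ := he
    simp only [inside, Finset.mem_filter, X, Finset.mem_biUnion]
    exact ⟨e.2, ⟨e, he, by simp⟩, ⟨e, he, by simp⟩⟩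
  obtain ⟨f, hf, hft⟩ := (Finset.all_card_le_biUnion_card_iff_exists_injective t).1 hall
  refine ⟨fun e => if he : e ∈ A then (f ⟨e, he⟩).1 else x e, ?_, ?_⟩
  · intro e
    by_cases he : e ∈ A
    · have := hft ⟨e, he⟩
      simp only [t, Finset.mem_sigma, Finset.mem_insert, Finset.mem_singleton] at this
      simpa [he] using this.1
    · simp [he]
  · intro w
    rw [← Finset.card_range (m w)]
    refine Finset.card_le_card_of_injOn
      (fun e => if he : e ∈ A then (f ⟨e, he⟩).2 else 0) ?_ ?_
    · intro e he
      simp only [Finset.coe_filter, Set.mem_ofPred_eq] at he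
      obtain ⟨he, h2⟩ := he
      have := hft ⟨e, he⟩
      simp only [t, Finset.mem_sigma] at this
      simp only [he, dite_true] at h2
      simp only [he, dite_true, ← h2]
      exact this.2
    · intro e he e' he' h
      simp only [Finset.coe_filter, Set.mem_ofPred_eq] at he he'
      obtain ⟨he, h2⟩ := he
      obtain ⟨he', h2'⟩ := he'
      simp only [he, he', dite_true] at h h2 h2'
      have := hf (Sigma.ext (h2.trans h2'.symm) (heq_of_eq h))
      simpa using this

end Orientation

section Capacities

variable [DecidableEq V]

/-- The number of head slots that a vertex set `X` must have beyond those used by its inner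
edges. -/
def demand (S : Finset V) (r : V) (k : ℕ) (ext : V → ℕ) (X : Finset V) : ℕ :=
  (if (X ∩ S).Nonempty ∧ r ∉ X then k else 0) +
    (if (X ∩ S).card = 1 then ∑ s ∈ X ∩ S, ext s else 0)

lemma demand_congr {S : Finset V} {r : V} (hr : r ∈ S) (k : ℕ) (ext : V → ℕ) {X Y : Finset V}
    (h : X ∩ S = Y ∩ S) : demand S r k ext X = demand S r k ext Y := by
  have : r ∈ X ↔ r ∈ Y := by
    have := Finset.ext_iff.1 h r
    simpa [hr] using this
  simp only [demand, h, this]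

lemma demand_inter_union {S : Finset V} {r : V} (k : ℕ) (ext : V → ℕ) {X Y : Finset V}
    (h : (X ∩ Y ∩ S).Nonempty) :
    demand S r k ext X + demand S r k ext Y
      ≤ demand S r k ext (X ∪ Y) + demand S r k ext (X ∩ Y) := by
  have hX : (X ∩ S).Nonempty :=
    h.mono (Finset.inter_subset_inter_right Finset.inter_subset_left)
  have hY : (Y ∩ S).Nonempty :=
    h.mono (Finset.inter_subset_inter_right Finset.inter_subset_right)
  have hU : ((X ∪ Y) ∩ S).Nonempty :=
    hX.mono (Finset.inter_subset_inter_right Finset.subset_union_left)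
  have hone : ∀ Z : Finset V, X ∩ Y ⊆ Z → (Z ∩ S).card = 1 → Z ∩ S = X ∩ Y ∩ S := by
    intro Z hZ h1
    refine (Finset.eq_of_subset_of_card_le (Finset.inter_subset_inter_right hZ) ?_).symm
    rw [h1]; exact Finset.card_pos.2 h
  have h1 := hone X Finset.inter_subset_left
  have h2 := hone Y Finset.inter_subset_right
  have h3 : X ∩ S = X ∩ Y ∩ S → Y ∩ S = X ∩ Y ∩ S → (X ∪ Y) ∩ S = X ∩ Y ∩ S := by
    intro a b; rw [Finset.union_inter_distrib_right, a, b, Finset.union_self]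
  have e1 : (if (X ∩ S).Nonempty ∧ r ∉ X then k else 0)
        + (if (Y ∩ S).Nonempty ∧ r ∉ Y then k else 0)
      ≤ (if ((X ∪ Y) ∩ S).Nonempty ∧ r ∉ X ∪ Y then k else 0)
        + (if (X ∩ Y ∩ S).Nonempty ∧ r ∉ X ∩ Y then k else 0) := by
    simp only [hX, hY, hU, h, true_and]
    by_cases a : r ∈ X <;> by_cases b : r ∈ Y <;> simp [a, b]
  have e2 : (if (X ∩ S).card = 1 then ∑ s ∈ X ∩ S, ext s else 0)
        + (if (Y ∩ S).card = 1 then ∑ s ∈ Y ∩ S, ext s else 0)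
      ≤ (if ((X ∪ Y) ∩ S).card = 1 then ∑ s ∈ (X ∪ Y) ∩ S, ext s else 0)
        + (if (X ∩ Y ∩ S).card = 1 then ∑ s ∈ X ∩ Y ∩ S, ext s else 0) := by
    by_cases a : (X ∩ S).card = 1
    · by_cases b : (Y ∩ S).card = 1
      · have c := h3 (h1 a) (h2 b)
        rw [c]
        simp only [h1 a, h2 b, le_refl]
      · have : (X ∩ Y ∩ S).card = 1 := by rw [← h1 a]; exact a
        simp only [b, h1 a, this]; simp
    · by_cases b : (Y ∩ S).card = 1
      · have : (X ∩ Y ∩ S).card = 1 := by rw [← h2 b]; exact b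
        simp only [a, h2 b, this]; simp
      · simp [a, b]
  simp only [demand]
  omega

lemma inside_inter_union (x y : E → V) (A : Finset E) (X Y : Finset V) :
    (inside x y A X).card + (inside x y A Y).card
      ≤ (inside x y A (X ∪ Y)).card + (inside x y A (X ∩ Y)).card := by
  simp only [inside, Finset.card_filter, ← Finset.sum_add_distrib]
  refine Finset.sum_le_sum fun e _ => ?_
  by_cases h1 : x e ∈ X <;> by_cases h2 : x e ∈ Y <;> by_cases h3 : y e ∈ X <;>
    by_cases h4 : y e ∈ Y <;> simp [h1, h2, h3, h4]

lemma inside_sdiff_sdiff (x y : E → V) (A : Finset E) (hl : ∀ e ∈ A, x e ≠ y e)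
    (X Y : Finset V) :
    (inside x y A X).card + (inside x y A Y).card
      ≤ (inside x y A (X \ Y)).card + (inside x y A (Y \ X)).card
        + ∑ u ∈ X ∩ Y, (incident x y A u).card := by
  rw [sum_card_incident x y A hl]
  simp only [inside, Finset.card_filter, ← Finset.sum_add_distrib]
  refine Finset.sum_le_sum fun e _ => ?_
  by_cases h1 : x e ∈ X <;> by_cases h2 : x e ∈ Y <;> by_cases h3 : y e ∈ X <;>
    by_cases h4 : y e ∈ Y <;> simp [h1, h2, h3, h4]

variable [DecidableEq E] [Fintype V]

omit [DecidableEq E] in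
lemma exists_minimal_capacity (x y : E → V) (A : Finset E)
    (S : Finset V) (hind : ∀ e ∈ A, x e ∈ S ∨ y e ∈ S) (r : V) (k : ℕ) (ext m0 : V → ℕ) :
    ∃ m : V → ℕ, (∀ u ∉ S, m u = m0 u) ∧
      (∀ X, (inside x y A X).card + demand S r k ext X ≤ ∑ v ∈ X, m v) ∧
      ∀ s ∈ S, ∃ X, s ∈ X ∧ (inside x y A X).card + demand S r k ext X = ∑ v ∈ X, m v := by
  let P : (V → ℕ) → Prop := fun m => (∀ u ∉ S, m u = m0 u) ∧
    ∀ X, (inside x y A X).card + demand S r k ext X ≤ ∑ v ∈ X, m v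
  have hex : ∃ n, ∃ m, P m ∧ ∑ v, m v = n := by
    refine ⟨_, fun v => if v ∈ S then A.card + k + ext v else m0 v, ⟨fun u hu => by simp [hu], ?_⟩,
      rfl⟩
    intro X
    by_cases hX : (X ∩ S).Nonempty
    · obtain ⟨s, hs⟩ := hX
      have h1 : (inside x y A X).card ≤ A.card := Finset.card_filter_le _ _
      have h2 : ∑ v ∈ X ∩ S, (A.card + k + ext v)
          ≤ ∑ v ∈ X, (if v ∈ S then A.card + k + ext v else m0 v) := by
        rw [← Finset.sum_filter_add_sum_filter_not X (· ∈ S), ← Finset.filter_mem_eq_inter]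
        refine le_trans (Finset.sum_le_sum fun v hv => ?_) (Nat.le_add_right _ _)
        simp [(Finset.mem_filter.1 hv).2]
      have h3 : A.card + k + ∑ v ∈ X ∩ S, ext v ≤ ∑ v ∈ X ∩ S, (A.card + k + ext v) := by
        rw [Finset.sum_add_distrib]
        have : A.card + k ≤ ∑ v ∈ X ∩ S, (A.card + k) :=
          Finset.single_le_sum (f := fun _ => A.card + k) (fun _ _ => Nat.zero_le _) hs
        omega
      have h4 : demand S r k ext X ≤ k + ∑ v ∈ X ∩ S, ext v := by
        simp only [demand]; split_ifs <;> omega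
      beta_reduce
      omega
    · have h1 : inside x y A X = ∅ := by
        rw [inside, Finset.filter_eq_empty_iff]
        rintro e he ⟨h1, h2⟩
        rcases hind e he with h | h
        · exact hX ⟨_, Finset.mem_inter.2 ⟨h1, h⟩⟩
        · exact hX ⟨_, Finset.mem_inter.2 ⟨h2, h⟩⟩
      have h2 := Finset.not_nonempty_iff_eq_empty.1 hX
      simp [h1, demand, h2]
  classical
  obtain ⟨m, hm, hsum⟩ := Nat.find_spec hex
  have hmin : ∀ m', P m' → ∑ v, m v ≤ ∑ v, m' v := fun m' h' => by
    rw [hsum]; exact Nat.find_min' hex ⟨m', h', rfl⟩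
  refine ⟨m, hm.1, hm.2, fun s hs => ?_⟩
  by_contra hcon
  push Not at hcon
  have hpos : m s ≠ 0 := by
    intro h0
    refine hcon {s} (by simp) (le_antisymm (hm.2 _) ?_)
    simp [h0]
  have hupd : ∀ X, ∑ v ∈ X, Function.update m s (m s - 1) v + (if s ∈ X then 1 else 0)
      = ∑ v ∈ X, m v := by
    intro X
    by_cases hX : s ∈ X
    · rw [← Finset.add_sum_erase X _ hX, ← Finset.add_sum_erase X _ hX]
      have : ∑ v ∈ X.erase s, Function.update m s (m s - 1) v = ∑ v ∈ X.erase s, m v :=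
        Finset.sum_congr rfl fun v hv => Function.update_of_ne (Finset.ne_of_mem_erase hv) _ _
      rw [this, Function.update_self]
      simp only [hX, if_true]
      omega
    · simp only [hX, if_false, add_zero]
      exact Finset.sum_congr rfl fun v hv =>
        Function.update_of_ne (by rintro rfl; exact hX hv) _ _
  have := hmin (Function.update m s (m s - 1)) ⟨?_, ?_⟩
  · have h2 := hupd Finset.univ
    simp only [Finset.mem_univ, if_true] at h2
    omega
  · intro u hu
    rw [Function.update_of_ne (by rintro rfl; exact hu hs)]
    exact hm.1 u hu
  · intro X
    have h1 := hupd X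
    have h2 := hm.2 X
    split_ifs at h1 with hX
    · have h3 := hcon X hX
      omega
    · omega

omit [DecidableEq E] in
/-- Head capacities exist as soon as the demands can be met for every partition of the
terminals. -/
lemma exists_capacity (x y : E → V) (A : Finset E) (hl : ∀ e ∈ A, x e ≠ y e)
    (S : Finset V) (hind : ∀ e ∈ A, x e ∈ S ∨ y e ∈ S) (r : V) (hr : r ∈ S) (k : ℕ)
    (ext ex : V → ℕ) (hex : ∀ u ∉ S, Even ((incident x y A u).card + ex u))
    (hcond : ∀ P : Finset (Finset V), (∀ X ∈ P, ∀ Y ∈ P, X ≠ Y → Disjoint X Y) →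
      (∀ X ∈ P, (X ∩ S).Nonempty) → S ⊆ P.biUnion id →
      2 * (k * P.card + ∑ X ∈ P, if (X ∩ S).card = 1 then ∑ s ∈ X ∩ S, ext s else 0)
        + ∑ u ∈ (P.biUnion id)ᶜ, ex u ≤ ∑ X ∈ P, (crossing x y A X).card + 2 * k) :
    ∃ m : V → ℕ, (∀ u ∉ S, 2 * m u = (incident x y A u).card + ex u) ∧
      (∀ X, (inside x y A X).card + demand S r k ext X ≤ ∑ v ∈ X, m v) ∧
      ∑ v, m v = A.card := by
  set b : V → ℕ := fun u => (incident x y A u).card with hb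
  obtain ⟨m, hm1, hm2, hm3⟩ := exists_minimal_capacity x y A S hind r k ext
    (fun u => (b u + ex u) / 2)
  have hU : ∀ u ∉ S, 2 * m u = b u + ex u := fun u hu => by
    rw [hm1 u hu]; exact Nat.two_mul_div_two_of_even (hex u hu)
  refine ⟨m, hU, hm2, le_antisymm ?_ ?_⟩
  swap
  · have := hm2 Finset.univ
    have h2 : inside x y A Finset.univ = A := by simp [inside]
    rw [h2] at this
    omega
  let T : Finset V → Prop := fun X => (inside x y A X).card + demand S r k ext X = ∑ v ∈ X, m v
  have hT1 : ∀ X Y, T X → T Y → (X ∩ Y ∩ S).Nonempty → T (X ∪ Y) ∧ T (X ∩ Y) := by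
    intro X Y hX hY h
    have h1 := demand_inter_union (r := r) k ext h
    have h2 := inside_inter_union x y A X Y
    have h3 := hm2 (X ∪ Y)
    have h4 := hm2 (X ∩ Y)
    have h5 := Finset.sum_union_inter (s₁ := X) (s₂ := Y) (f := m)
    simp only [T] at hX hY ⊢
    constructor <;> omega
  have hT2 : ∀ X Y, T X → T Y → ¬ (X ∩ Y ∩ S).Nonempty → T (X \ Y) := by
    intro X Y hX hY h
    have hn : ∀ w ∈ X ∩ Y, w ∉ S := fun w h1 h2 => h ⟨w, Finset.mem_inter.2 ⟨h1, h2⟩⟩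
    have e1 : (X \ Y) ∩ S = X ∩ S := by
      ext w; have := hn w; simp only [Finset.mem_inter, Finset.mem_sdiff] at *; tauto
    have e2 : (Y \ X) ∩ S = Y ∩ S := by
      ext w; have := hn w; simp only [Finset.mem_inter, Finset.mem_sdiff] at *; tauto
    have h1 := demand_congr hr k ext e1
    have h1' := demand_congr hr k ext e2
    have h2 := inside_sdiff_sdiff x y A hl X Y
    have h3 := hm2 (X \ Y)
    have h4 := hm2 (Y \ X)
    have h5 := Finset.sum_inter_add_sum_sdiff X Y m
    have h6 := Finset.sum_inter_add_sum_sdiff Y X m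
    rw [Finset.inter_comm Y X] at h6
    have h7 : ∑ u ∈ X ∩ Y, b u ≤ 2 * ∑ u ∈ X ∩ Y, m u := by
      rw [Finset.mul_sum]
      refine Finset.sum_le_sum fun u hu => ?_
      rw [hU u (hn u hu)]; omega
    simp only [T, hb] at hX hY h7 ⊢
    omega
  let wt : Finset V → ℕ := fun X => (X ∩ S).card * (Fintype.card V + 1) + Xᶜ.card
  have hM : ∀ s : V, ∃ X, s ∈ S → s ∈ X ∧ T X ∧ ∀ Y, s ∈ Y → T Y → wt Y ≤ wt X := by
    intro s
    by_cases hs : s ∈ S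
    · obtain ⟨X, hX, hX'⟩ := Set.Finite.exists_maximalFor wt {X | s ∈ X ∧ T X}
        (Set.toFinite _) (hm3 s hs)
      refine ⟨X, fun _ => ⟨hX.1, hX.2, fun Y h1 h2 => ?_⟩⟩
      by_contra hlt
      exact hlt (hX' (j := Y) ⟨h1, h2⟩ (by omega))
    · exact ⟨∅, fun h => absurd h hs⟩
  choose M hM using hM
  have hcompl : ∀ X : Finset V, Xᶜ.card ≤ Fintype.card V := fun X => Finset.card_le_univ _
  have hmaxtr : ∀ s ∈ S, ∀ Y, T Y → s ∈ Y → M s ∩ S ⊆ Y ∩ S → Y ∩ S = M s ∩ S := by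
    intro s hs Y hY hsY hsub
    obtain ⟨h1, h2, h3⟩ := hM s hs
    have := h3 Y hsY hY
    refine (Finset.eq_of_subset_of_card_le hsub ?_).symm
    by_contra hlt
    have h4 : (M s ∩ S).card + 1 ≤ (Y ∩ S).card := by omega
    have h5 := Nat.mul_le_mul_right (Fintype.card V + 1) h4
    have h6 := hcompl (M s)
    simp only [wt] at this
    rw [Nat.add_mul] at h5
    omega
  have hminsz : ∀ s ∈ S, ∀ Y, T Y → s ∈ Y → Y ⊆ M s → Y ∩ S = M s ∩ S → Y = M s := by
    intro s hs Y hY hsY hsub htr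
    obtain ⟨h1, h2, h3⟩ := hM s hs
    have := h3 Y hsY hY
    simp only [wt, htr, Finset.card_compl] at this
    refine Finset.eq_of_subset_of_card_le hsub ?_
    have h4 := Finset.card_le_univ (M s)
    have h5 := Finset.card_le_univ Y
    omega
  have hdis : ∀ s ∈ S, ∀ s' ∈ S, M s ≠ M s' → Disjoint (M s) (M s') := by
    intro s hs s' hs' hne
    obtain ⟨h1, h2, h3⟩ := hM s hs
    obtain ⟨h1', h2', h3'⟩ := hM s' hs'
    by_cases h : (M s ∩ M s' ∩ S).Nonempty
    · exfalso
      obtain ⟨hu, hi⟩ := hT1 _ _ h2 h2' h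
      have e1 := hmaxtr s hs _ hu (by simp [h1]) (by gcongr; exact Finset.subset_union_left)
      have e2 := hmaxtr s' hs' _ hu (by simp [h1']) (by gcongr; exact Finset.subset_union_right)
      have e3 : M s ∩ S = M s' ∩ S := e1.symm.trans e2
      have e4 : M s ∩ M s' ∩ S = M s ∩ S := by
        ext w
        have := Finset.ext_iff.1 e3 w
        simp only [Finset.mem_inter] at *
        tauto
      have i1 : s ∈ M s ∩ M s' := by
        have : s ∈ M s ∩ S := by simp [h1, hs]
        rw [← e4] at this; exact (Finset.mem_inter.1 this).1
      have i2 : s' ∈ M s ∩ M s' := by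
        have : s' ∈ M s' ∩ S := by simp [h1', hs']
        rw [← e3, ← e4] at this; exact (Finset.mem_inter.1 this).1
      exact hne ((hminsz s hs _ hi i1 Finset.inter_subset_left e4).symm.trans
        (hminsz s' hs' _ hi i2 Finset.inter_subset_right (e4.trans e3)))
    · have hd := hT2 _ _ h2 h2' h
      have i1 : s ∉ M s' := fun hh => h ⟨s, by simp [h1, hh, hs]⟩
      have e1 : (M s \ M s') ∩ S = M s ∩ S := by
        ext w
        have : w ∈ M s → w ∈ M s' → w ∉ S := fun a b c => h ⟨w, by simp [a, b, c]⟩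
        simp only [Finset.mem_inter, Finset.mem_sdiff]; tauto
      have := hminsz s hs _ hd (by simp [h1, i1]) Finset.sdiff_subset e1
      exact Finset.sdiff_eq_self_iff_disjoint.1 this
  let P : Finset (Finset V) := S.image M
  have hPd : ∀ X ∈ P, ∀ Y ∈ P, X ≠ Y → Disjoint X Y := by
    intro X hX Y hY hne
    obtain ⟨s, hs, rfl⟩ := Finset.mem_image.1 hX
    obtain ⟨s', hs', rfl⟩ := Finset.mem_image.1 hY
    exact hdis s hs s' hs' hne
  have hPS : ∀ X ∈ P, (X ∩ S).Nonempty := by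
    intro X hX
    obtain ⟨s, hs, rfl⟩ := Finset.mem_image.1 hX
    exact ⟨s, by simp [hs, (hM s hs).1]⟩
  have hPT : ∀ X ∈ P, T X := by
    intro X hX
    obtain ⟨s, hs, rfl⟩ := Finset.mem_image.1 hX
    exact (hM s hs).2.1
  have hPc : S ⊆ P.biUnion id := by
    intro s hs
    exact Finset.mem_biUnion.2 ⟨M s, Finset.mem_image_of_mem M hs, (hM s hs).1⟩
  have hC := hcond P hPd hPS hPc
  have hbu : ∀ f : V → ℕ, ∑ v ∈ P.biUnion id, f v = ∑ X ∈ P, ∑ v ∈ X, f v :=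
    fun f => Finset.sum_biUnion fun X hX Y hY hne => hPd X hX Y hY hne
  have hsplit : ∀ f : V → ℕ, ∑ X ∈ P, ∑ v ∈ X, f v + ∑ v ∈ (P.biUnion id)ᶜ, f v = ∑ v, f v :=
    fun f => by rw [← hbu, Finset.sum_add_sum_compl]
  have h1 : ∑ X ∈ P, ((inside x y A X).card + demand S r k ext X) = ∑ X ∈ P, ∑ v ∈ X, m v :=
    Finset.sum_congr rfl fun X hX => hPT X hX
  have h2 : ∑ v ∈ (P.biUnion id)ᶜ, 2 * m v
      = ∑ v ∈ (P.biUnion id)ᶜ, b v + ∑ v ∈ (P.biUnion id)ᶜ, ex v := by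
    rw [← Finset.sum_add_distrib]
    refine Finset.sum_congr rfl fun v hv => hU v fun hvS => ?_
    exact (Finset.mem_compl.1 hv) (hPc hvS)
  have h3 : ∑ X ∈ P, ∑ v ∈ X, b v
      = 2 * ∑ X ∈ P, (inside x y A X).card + ∑ X ∈ P, (crossing x y A X).card := by
    rw [Finset.mul_sum, ← Finset.sum_add_distrib]
    exact Finset.sum_congr rfl fun X _ => handshake x y A hl X
  have h4 : ∑ v, b v = 2 * A.card := by
    have := handshake x y A hl Finset.univ
    simpa [inside, crossing] using this
  have h5 : ∑ X ∈ P, demand S r k ext X + k = k * P.card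
      + ∑ X ∈ P, if (X ∩ S).card = 1 then ∑ s ∈ X ∩ S, ext s else 0 := by
    simp only [demand, Finset.sum_add_distrib]
    have h6 : ∑ X ∈ P, (if (X ∩ S).Nonempty ∧ r ∉ X then k else 0)
        = ∑ X ∈ P, (if X = M r then 0 else k) := by
      refine Finset.sum_congr rfl fun X hX => ?_
      by_cases hXr : X = M r
      · simp [hXr, (hM r hr).1]
      · have : r ∉ X := fun hh => by
          have := hPd X hX (M r) (Finset.mem_image_of_mem M hr) hXr
          exact Finset.disjoint_left.1 this hh (hM r hr).1
        simp [hPS X hX, hXr, this]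
    have h7 : ∑ X ∈ P, (if X = M r then 0 else k) + k = k * P.card := by
      have : ∑ X ∈ P, (if X = M r then 0 else k) + ∑ X ∈ P, (if X = M r then k else 0)
          = ∑ X ∈ P, k := by
        rw [← Finset.sum_add_distrib]
        exact Finset.sum_congr rfl fun X _ => by split_ifs <;> simp
      rw [Finset.sum_ite_eq' P (M r) (fun _ => k), if_pos (Finset.mem_image_of_mem M hr),
        Finset.sum_const, smul_eq_mul, mul_comm] at this
      exact this
    rw [h6]; omega
  have h8 := hsplit m
  have h9 := hsplit b
  rw [Finset.sum_add_distrib] at h1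
  rw [← Finset.mul_sum] at h2
  omega

/-- Packing `S`-subgraphs while leaving prescribed numbers of unused edges, assigned to their
heads. -/
lemma exists_packing_with_reserve (x y : E → V) (A : Finset E) (hl : ∀ e ∈ A, x e ≠ y e)
    (S : Finset V) (hind : ∀ e ∈ A, x e ∈ S ∨ y e ∈ S) (r : V) (hr : r ∈ S) (k : ℕ)
    (ext ex : V → ℕ) (hex : ∀ u ∉ S, Even ((incident x y A u).card + ex u))
    (hcond : ∀ P : Finset (Finset V), (∀ X ∈ P, ∀ Y ∈ P, X ≠ Y → Disjoint X Y) →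
      (∀ X ∈ P, (X ∩ S).Nonempty) → S ⊆ P.biUnion id →
      2 * (k * P.card + ∑ X ∈ P, if (X ∩ S).card = 1 then ∑ s ∈ X ∩ S, ext s else 0)
        + ∑ u ∈ (P.biUnion id)ᶜ, ex u ≤ ∑ X ∈ P, (crossing x y A X).card + 2 * k) :
    ∃ (hd : E → V) (h : E → ℕ), (∀ e, hd e = x e ∨ hd e = y e) ∧ (∀ e, h e < k → e ∈ A) ∧
      (∀ i < k, ∀ s ∈ S, Linked x y (fun e => h e = i) r s) ∧
      (∀ s ∈ S, ext s ≤ (A.filter fun e => hd e = s ∧ k ≤ h e).card) ∧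
      ∀ u ∉ S, ex u ≤ (A.filter fun e => hd e = u ∧ k ≤ h e).card := by
  obtain ⟨m, hm1, hm2, hm3⟩ := exists_capacity x y A hl S hind r hr k ext ex hex hcond
  obtain ⟨hd, hd1, hd2⟩ := exists_orientation x y A m fun X => le_trans (by omega) (hm2 X)
  have hin : ∀ w, (A.filter fun e => hd e = w).card = m w := by
    have h1 : ∑ w, (A.filter fun e => hd e = w).card = ∑ w, m w := by
      rw [hm3, sum_card_filter_eq]; simp
    intro w
    exact (Finset.sum_eq_sum_iff_of_le fun i _ => hd2 i).1 h1 w (Finset.mem_univ w)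
  let tl : E → V := fun e => if hd e = x e then y e else x e
  have htl : ∀ e, (tl e = x e ∧ hd e = y e) ∨ (tl e = y e ∧ hd e = x e) := by
    intro e
    simp only [tl]
    rcases hd1 e with h | h
    · simp [h]
    · by_cases h' : y e = x e
      · simp [h', h]
      · simp [h', h]
  have hent : ∀ X, (entering tl hd A X).card + (inside x y A X).card = ∑ v ∈ X, m v := by
    intro X
    simp only [← hin, sum_card_filter_eq]
    simp only [entering, inside, Finset.card_filter, ← Finset.sum_add_distrib]
    refine Finset.sum_congr rfl fun e _ => ?_
    rcases htl e with ⟨h1, h2⟩ | ⟨h1, h2⟩ <;> rw [h1, h2] <;>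
    by_cases a : x e ∈ X <;> by_cases b : y e ∈ X <;> simp [a, b]
  have hout : ∀ w, (A.filter fun e => tl e = w).card + m w = (incident x y A w).card := by
    intro w
    rw [← hin, card_incident x y A hl]
    simp only [Finset.card_filter, ← Finset.sum_add_distrib]
    refine Finset.sum_congr rfl fun e _ => ?_
    rcases htl e with ⟨h1, h2⟩ | ⟨h1, h2⟩ <;> rw [h1, h2]
    exact add_comm _ _
  obtain ⟨h, h1, h2, h3, h4, h5⟩ := exists_rooted_packing hd S r hr k _ tl A rfl (by
      intro X hX hXS
      have e1 := hent X
      have e2 := hm2 X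
      have e3 : k ≤ demand S r k ext X := by simp [demand, hX, hXS]
      omega) (by
      intro u hu
      have e1 := hout u
      have e2 := hm1 u hu
      rw [hin]
      omega)
  have hsplit : ∀ w, (A.filter fun e => h e < k ∧ hd e = w).card
      + (A.filter fun e => hd e = w ∧ k ≤ h e).card = m w := by
    intro w
    rw [← hin w]
    simp only [Finset.card_filter, ← Finset.sum_add_distrib]
    refine Finset.sum_congr rfl fun e _ => ?_
    by_cases a : h e < k <;> by_cases b : hd e = w <;> simp [a, b]
  refine ⟨hd, h, hd1, h1, ?_, ?_, ?_⟩
  · intro i hi s hs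
    refine Linked.lift (fun v => v) ?_ (h3 i hi s hs)
    intro e he
    have hxy : Linked x y (fun e => h e = i) (x e) (y e) := Linked.of_edge he
    rcases htl e with ⟨a, b⟩ | ⟨a, b⟩ <;> rw [a, b]
    · exact hxy
    · exact hxy.symm
  · intro s hs
    have e1 := hsplit s
    have e2 := h4 s hs
    have e3 := hm2 {s}
    have hsS : ({s} : Finset V) ∩ S = {s} := by simp [hs]
    simp only [demand, hsS, Finset.sum_singleton, Finset.card_singleton, if_true,
      Finset.singleton_nonempty, true_and, Finset.mem_singleton] at e3
    by_cases hsr : r = s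
    · have : A.filter (fun e => h e < k ∧ hd e = s) = ∅ := by
        rw [Finset.filter_eq_empty_iff]
        rintro e _ ⟨a, b⟩
        exact h2 e a (b.trans hsr.symm)
      rw [this, Finset.card_empty] at e1
      omega
    · rw [if_pos hsr] at e3
      omega
  · intro u hu
    have e1 := hsplit u
    have e2 := h5 u hu
    have e3 := hout u
    have e4 := hm1 u hu
    omega

end Capacities

section Reserve

variable [DecidableEq V]

lemma mem_incident {x y : E → V} {A : Finset E} {u : V} {e : E} :
    e ∈ incident x y A u ↔ e ∈ A ∧ (x e = u ∨ y e = u) := by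
  simp [incident]

/-- For every vertex of `N` one incident edge can be reserved so that each terminal `s` is an end
of about half of the reserved edges that could possibly have been chosen at `s`. -/
lemma exists_reserved_edges [DecidableEq E] [Nonempty E] (x y : E → V) (A : Finset E) (S : Finset V)
    (hind : ∀ e ∈ A, x e ∈ S ∨ y e ∈ S) (N : Finset V) (hNS : ∀ u ∈ N, u ∉ S)
    (hN : ∀ u ∈ N, 2 ≤ (incident x y A u).card) :
    ∃ c : V → E, (∀ u ∈ N, c u ∈ incident x y A u) ∧ ∀ s : V, ∃ T ⊆ N,
      T.card ≤ 2 * (N.filter fun u => c u ∈ incident x y A s).card + 1 ∧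
      ∀ u ∈ N, s ∈ S → (∃ e ∈ incident x y A u, e ∈ incident x y A s) →
        u ∈ T ∨ (3 ≤ S.card ∧ 3 ≤ (incident x y A u).card) := by
  let oth : V → E → V := fun u e => if x e = u then y e else x e
  have hothS : ∀ u ∈ N, ∀ e ∈ incident x y A u, oth u e ∈ S ∧ e ∈ incident x y A (oth u e) := by
    intro u hu e he
    obtain ⟨h1, h2⟩ := mem_incident.1 he
    have h3 := hNS u hu
    have h4 := hind e h1
    simp only [oth, mem_incident]
    split_ifs with h
    · rw [h] at h4; tauto
    · have h5 : y e = u := by tauto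
      rw [h5] at h4; tauto
  have hoth : ∀ u ∈ N, ∀ e ∈ incident x y A u, ∀ s ∈ S, e ∈ incident x y A s → oth u e = s := by
    intro u hu e he s hs hes
    obtain ⟨h1, h2⟩ := mem_incident.1 he
    obtain ⟨_, h2'⟩ := mem_incident.1 hes
    have h3 := hNS u hu
    simp only [oth]
    split_ifs with h
    · rcases h2' with h' | h'
      · exact absurd hs (by rw [← h', h]; exact h3)
      · exact h'
    · rcases h2' with h' | h'
      · exact h'
      · have h5 : y e = u := by tauto
        exact absurd hs (by rw [← h', h5]; exact h3)
  have hpair : ∀ u, ∃ e1 e2 : E, u ∈ N → e1 ∈ incident x y A u ∧ e2 ∈ incident x y A u ∧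
      e1 ≠ e2 ∧ ((∀ e ∈ incident x y A u, oth u e = oth u e1) ∨ oth u e1 ≠ oth u e2) := by
    intro u
    by_cases hu : u ∈ N
    · obtain ⟨e1, h1, e2, h2, hne⟩ := Finset.one_lt_card.1 (hN u hu)
      by_cases hall : ∀ e ∈ incident x y A u, oth u e = oth u e1
      · exact ⟨e1, e2, fun _ => ⟨h1, h2, hne, Or.inl hall⟩⟩
      · push Not at hall
        obtain ⟨e, he, hee⟩ := hall
        exact ⟨e1, e, fun _ => ⟨h1, he, by rintro rfl; exact hee rfl, Or.inr hee.symm⟩⟩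
    · obtain ⟨e⟩ := ‹Nonempty E›
      exact ⟨e, e, fun h => absurd h hu⟩
  choose e1 e2 hp using hpair
  let p : V → V := fun u => oth u (e1 u)
  let q : V → V := fun u => oth u (e2 u)
  let d : V → ℕ := fun s => (N.filter fun u => p u = s).card + (N.filter fun u => q u = s).card
  obtain ⟨hd, hd1, hd2⟩ := exists_orientation p q N (fun s => (d s + 1) / 2) (by
    intro X
    have h1 : ∑ s ∈ X, d s = (N.filter fun u => p u ∈ X).card + (N.filter fun u => q u ∈ X).card := by
      simp only [d, Finset.sum_add_distrib, sum_card_filter_eq]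
    have h2 : ∑ s ∈ X, d s ≤ 2 * ∑ s ∈ X, (d s + 1) / 2 := by
      rw [Finset.mul_sum]
      exact Finset.sum_le_sum fun s _ => by omega
    have h3 : (inside p q N X).card ≤ (N.filter fun u => p u ∈ X).card :=
      Finset.card_le_card fun u => by simp only [inside, Finset.mem_filter]; tauto
    have h4 : (inside p q N X).card ≤ (N.filter fun u => q u ∈ X).card :=
      Finset.card_le_card fun u => by simp only [inside, Finset.mem_filter]; tauto
    omega)
  refine ⟨fun u => if hd u = p u then e2 u else e1 u, ?_, ?_⟩
  · intro u hu
    obtain ⟨h1, h2, -⟩ := hp u hu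
    beta_reduce
    split_ifs <;> assumption
  intro s
  refine ⟨N.filter fun u => p u = s ∨ q u = s, Finset.filter_subset _ _, ?_, ?_⟩
  · have h1 : (N.filter fun u => p u = s ∨ q u = s).card ≤ d s := by
      simp only [d]; rw [Finset.filter_or]; exact Finset.card_union_le _ _
    have h2 : d s ≤ (N.filter fun u => hd u = s).card + (N.filter fun u =>
        (if hd u = p u then e2 u else e1 u) ∈ incident x y A s).card := by
      simp only [d, Finset.card_filter, ← Finset.sum_add_distrib]
      refine Finset.sum_le_sum fun u hu => ?_
      obtain ⟨i1, i2, -⟩ := hp u hu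
      have j1 := (hothS u hu _ i1).2
      have j2 := (hothS u hu _ i2).2
      change e1 u ∈ incident x y A (p u) at j1
      change e2 u ∈ incident x y A (q u) at j2
      by_cases hh : hd u = p u
      · rw [if_pos hh, hh]
        by_cases hq : q u = s
        · rw [hq] at j2; simp only [j2, if_true]; split_ifs <;> simp
        · simp [hq]
      · rw [if_neg hh]
        have hh' : hd u = q u := (hd1 u).resolve_left hh
        rw [hh', add_comm]
        by_cases hq : p u = s
        · rw [hq] at j1; simp only [j1, if_true]; split_ifs <;> simp
        · simp [hq]
    have h3 := hd2 s
    beta_reduce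
    omega
  · intro u hu hs ⟨e, he, hes⟩
    by_cases hT : p u = s ∨ q u = s
    · exact Or.inl (Finset.mem_filter.2 ⟨hu, hT⟩)
    push Not at hT
    obtain ⟨i1, i2, i3, i4⟩ := hp u hu
    have h1 := hoth u hu e he s hs hes
    have hne : p u ≠ q u := by
      rcases i4 with i4 | i4
      · exact absurd ((i4 e he).symm.trans h1) hT.1
      · exact i4
    right
    constructor
    · have : ({p u, q u, s} : Finset V) ⊆ S := by
        intro w hw
        simp only [Finset.mem_insert, Finset.mem_singleton] at hw
        rcases hw with rfl | rfl | rfl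
        · exact (hothS u hu _ i1).1
        · exact (hothS u hu _ i2).1
        · exact hs
      refine le_trans (le_of_eq ?_) (Finset.card_le_card this)
      exact (Finset.card_eq_three.2 ⟨_, _, _, hne, hT.1, hT.2, rfl⟩).symm
    · have : ({e1 u, e2 u, e} : Finset E) ⊆ incident x y A u := by
        intro w hw
        simp only [Finset.mem_insert, Finset.mem_singleton] at hw
        rcases hw with rfl | rfl | rfl <;> assumption
      refine le_trans (le_of_eq ?_) (Finset.card_le_card this)
      refine (Finset.card_eq_three.2 ⟨_, _, _, i3, ?_, ?_, rfl⟩).symm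
      · rintro hh; exact hT.1 ((congrArg (oth u) hh).trans h1)
      · rintro hh; exact hT.2 ((congrArg (oth u) hh).trans h1)

end Reserve

section Condition

variable [DecidableEq V]

/-- `P` consists of disjoint vertex sets, each meeting `S`, which together cover `S`. -/
structure IsFamily (S : Finset V) (P : Finset (Finset V)) : Prop where
  disjoint : ∀ X ∈ P, ∀ Y ∈ P, X ≠ Y → Disjoint X Y
  meets : ∀ X ∈ P, (X ∩ S).Nonempty
  covers : S ⊆ P.biUnion id

variable [Fintype V]

lemma sum_incident_compl_le (x y : E → V) (A : Finset E) (hl : ∀ e ∈ A, x e ≠ y e)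
    (S : Finset V) (hind : ∀ e ∈ A, x e ∈ S ∨ y e ∈ S) (P : Finset (Finset V))
    (hP : IsFamily S P) :
    ∑ u ∈ (P.biUnion id)ᶜ, (incident x y A u).card ≤ ∑ X ∈ P, (crossing x y A X).card := by
  rw [sum_card_incident x y A hl]
  simp only [crossing, Finset.card_filter, ← Finset.sum_add_distrib]
  rw [Finset.sum_comm]
  refine Finset.sum_le_sum fun e he => ?_
  have key : ∀ a b : V, a ∉ P.biUnion id → b ∈ S →
      1 ≤ ∑ X ∈ P, if ¬ (a ∈ X ↔ b ∈ X) then 1 else 0 := by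
    intro a b ha hb
    obtain ⟨X, hX, hbX⟩ := Finset.mem_biUnion.1 (hP.covers hb)
    have haX : a ∉ X := fun h => ha (Finset.mem_biUnion.2 ⟨X, hX, h⟩)
    refine le_trans ?_ (Finset.single_le_sum (f := fun X => if ¬ (a ∈ X ↔ b ∈ X) then 1 else 0)
      (fun _ _ => Nat.zero_le _) hX)
    simp only [id] at hbX
    simp [haX, hbX]
  by_cases h1 : x e ∈ P.biUnion id
  · by_cases h2 : y e ∈ P.biUnion id
    · simp only [Finset.mem_compl, h1, h2]; simp
    · have hx : x e ∈ S := (hind e he).resolve_right fun h => h2 (hP.covers h)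
      have := key (y e) (x e) h2 hx
      simp only [Finset.mem_compl, h1, h2]
      simp only [iff_comm] at this ⊢
      simpa using this
  · have hy : y e ∈ S := (hind e he).resolve_left fun h => h1 (hP.covers h)
    have := key (x e) (y e) h1 hy
    have h2 := hP.covers hy
    simp only [Finset.mem_compl, h1, h2]
    simpa using this

omit [Fintype V] in
lemma crossing_union_add_le (x y : E → V) (A : Finset E) (hl : ∀ e ∈ A, x e ≠ y e)
    (X N : Finset V) (hXN : ∀ u ∈ N, u ∉ X)
    (hx : ∀ e ∈ A, x e ∈ N → y e ∈ X) (hy : ∀ e ∈ A, y e ∈ N → x e ∈ X) :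
    (crossing x y A (X ∪ N)).card + ∑ u ∈ N, (incident x y A u).card
      ≤ (crossing x y A X).card := by
  rw [sum_card_incident x y A hl]
  simp only [crossing, Finset.card_filter, ← Finset.sum_add_distrib]
  refine Finset.sum_le_sum fun e he => ?_
  by_cases h1 : x e ∈ N
  · have h2 := hx e he h1
    have h3 : y e ∉ N := fun h => hXN _ h h2
    simp [h1, h2, h3, hXN _ h1]
  · by_cases h2 : y e ∈ N
    · simp [h1, h2, hy e he h2, hXN _ h2]
    · simp [h1, h2]

set_option maxHeartbeats 1000000 in
/-- The partition inequality needed for packing, from degree and connectivity information. -/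
lemma partition_condition (x y : E → V) (A : Finset E) (hl : ∀ e ∈ A, x e ≠ y e)
    (S : Finset V) (hind : ∀ e ∈ A, x e ∈ S ∨ y e ∈ S) (hS2 : 2 ≤ S.card) (k : ℕ)
    (a a' ex : V → ℕ) (N : Finset V)
    (hex : ∀ u ∉ S, ex u ≤ (incident x y A u).card)
    (hex3 : ∀ u ∉ S, 3 * ex u ≤ 2 * a u + (incident x y A u).card + 2 * (if u ∈ N then 1 else 0))
    (hNS : ∀ u ∈ N, u ∉ S) (hNex : ∀ u ∈ N, ex u = (incident x y A u).card)
    (hNb : ∀ u ∈ N, (incident x y A u).card = a' u + 1) (hNa : ∀ u ∈ N, 1 ≤ a' u)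
    (hNsum : ∑ u ∈ N, a' u ≤ 33 * k)
    (hstar : ∀ P, IsFamily S P → 36 * k * P.card + ∑ u ∈ (P.biUnion id)ᶜ, a u
      ≤ ∑ X ∈ P, (crossing x y A X).card + 36 * k)
    (D : Finset V)
    (hD : ∀ s ∈ D, ∃ T ⊆ N, T.card + 1 ≤ 6 * k ∧
      ∀ u ∈ N, s ∈ S → (∃ e ∈ incident x y A u, e ∈ incident x y A s) →
        u ∈ T ∨ (3 ≤ S.card ∧ 3 ≤ (incident x y A u).card))
    (P : Finset (Finset V)) (hP : IsFamily S P) :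
    2 * (k * P.card + ∑ X ∈ P, if (X ∩ S).card = 1 then
        ∑ s ∈ X ∩ S, (if s ∈ D then 3 * k else 0) else 0)
      + ∑ u ∈ (P.biUnion id)ᶜ, ex u ≤ ∑ X ∈ P, (crossing x y A X).card + 2 * k := by
  have hout : ∀ P, IsFamily S P → ∀ u ∈ (P.biUnion id)ᶜ, u ∉ S :=
    fun P hP u hu hS => Finset.mem_compl.1 hu (hP.covers hS)
  have hbound : ∀ P, IsFamily S P → 72 * (k * P.card) + 3 * ∑ u ∈ (P.biUnion id)ᶜ, ex u
      ≤ 3 * ∑ X ∈ P, (crossing x y A X).card + 72 * k + 2 * ((P.biUnion id)ᶜ ∩ N).card := by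
    intro P hP
    have h1 := hstar P hP
    have h2 := sum_incident_compl_le x y A hl S hind P hP
    have h3 : ∑ u ∈ (P.biUnion id)ᶜ, 3 * ex u ≤ ∑ u ∈ (P.biUnion id)ᶜ,
        (2 * a u + (incident x y A u).card + 2 * (if u ∈ N then 1 else 0)) :=
      Finset.sum_le_sum fun u hu => hex3 u (hout P hP u hu)
    simp only [Finset.sum_add_distrib, ← Finset.mul_sum, Finset.sum_boole,
      Finset.filter_mem_eq_inter, Nat.cast_id] at h3
    have h4 : 36 * k * P.card = 36 * (k * P.card) := by ring
    omega
  have hn33 : ∀ W : Finset V, (W ∩ N).card ≤ 33 * k := by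
    intro W
    refine le_trans ?_ hNsum
    refine le_trans (Finset.card_le_card Finset.inter_subset_right) ?_
    rw [Finset.card_eq_sum_ones]
    exact Finset.sum_le_sum hNa
  have hD0 : ∑ u ∈ (P.biUnion id)ᶜ, ex u ≤ ∑ X ∈ P, (crossing x y A X).card :=
    (Finset.sum_le_sum fun u hu => hex u (hout P hP u hu)).trans
      (sum_incident_compl_le x y A hl S hind P hP)
  obtain ⟨ext, hext⟩ : ∃ ext : Finset V → ℕ, ∀ X, ext X = if (X ∩ S).card = 1 then
        ∑ s ∈ X ∩ S, (if s ∈ D then 3 * k else 0) else 0 := ⟨_, fun _ => rfl⟩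
  simp only [← hext]
  have hext1 : ∀ X, ext X ≤ 3 * k ∧
      (ext X ≠ 0 → ∃ s ∈ D, X ∩ S = {s}) := by
    intro X
    rw [hext]
    split_ifs with h
    · obtain ⟨s, hs⟩ := Finset.card_eq_one.1 h
      rw [hs, Finset.sum_singleton]
      split_ifs with h'
      · exact ⟨le_rfl, fun _ => ⟨s, h', rfl⟩⟩
      · simp
    · simp
  have hmain := hbound P hP
  have h33 := hn33 (P.biUnion id)ᶜ
  have hcard : P.card = 0 ∨ P.card = 1 ∨ P.card = 2 ∨ 3 ≤ P.card := by omega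
  rcases hcard with hc | hc | hc | hc
  · exfalso
    rw [Finset.card_eq_zero] at hc
    obtain ⟨s, hs⟩ := Finset.card_pos.1 (by omega : 0 < S.card)
    have := hP.covers hs
    simp [hc] at this
  · obtain ⟨X, rfl⟩ := Finset.card_eq_one.1 hc
    have hSX : S ⊆ X := by simpa using hP.covers
    have : ext X = 0 := by
      rw [hext, if_neg]
      rw [Finset.inter_eq_right.2 hSX]; omega
    rw [Finset.sum_singleton, this, hc]
    omega
  · by_cases h0 : ∃ X1 ∈ P, ext X1 ≠ 0
    · obtain ⟨X1, hX1, hne⟩ := h0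
      obtain ⟨s, hsD, hs⟩ := (hext1 X1).2 hne
      obtain ⟨X0, hX0, h01⟩ : ∃ X0, X0 ≠ X1 ∧ P = {X0, X1} := by
        obtain ⟨Y, Z, hYZ, rfl⟩ := Finset.card_eq_two.1 hc
        rcases Finset.mem_insert.1 hX1 with h | h
        · subst h; exact ⟨Z, hYZ.symm, Finset.pair_comm _ _⟩
        · rw [Finset.mem_singleton] at h; subst h; exact ⟨Y, hYZ, rfl⟩
      subst h01
      rw [Finset.card_pair hX0] at hmain ⊢
      have hsS : s ∈ S := by
        have : s ∈ X1 ∩ S := by rw [hs]; simp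
        exact (Finset.mem_inter.1 this).2
      have hdisj : Disjoint X0 X1 := hP.disjoint X0 (by simp) X1 (by simp) hX0
      have hcov : ∀ t ∈ S, t ∈ X0 ∨ t ∈ X1 := by
        intro t ht; simpa using hP.covers ht
      have hS0 : ∀ t ∈ S, t ≠ s → t ∈ X0 := by
        intro t ht hts
        refine (hcov t ht).resolve_right fun h => hts ?_
        have : t ∈ X1 ∩ S := Finset.mem_inter.2 ⟨h, ht⟩
        rwa [hs, Finset.mem_singleton] at this
      obtain ⟨T, hTN, hTc, hT⟩ := hD s hsD
      classical
      set W : Finset V := (({X0, X1} : Finset (Finset V)).biUnion id)ᶜ with hW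
      have hWm : ∀ u, u ∈ W ↔ u ∉ X0 ∧ u ∉ X1 := by
        intro u; simp [hW]
      set N0 : Finset V := (W ∩ N).filter
        fun u => ¬ ∃ e ∈ incident x y A u, e ∈ incident x y A s with hN0
      have hN0W : ∀ u ∈ N0, u ∉ X0 ∧ u ∉ X1 ∧ u ∈ N := by
        intro u hu
        have := (Finset.mem_inter.1 (Finset.mem_filter.1 hu).1)
        exact ⟨((hWm u).1 this.1).1, ((hWm u).1 this.1).2, this.2⟩
      have hN0s : ∀ u ∈ N0, ∀ e ∈ A, x e = u ∨ y e = u → x e ≠ s ∧ y e ≠ s := by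
        intro u hu e he heu
        have := (Finset.mem_filter.1 hu).2
        push Not at this
        have := this e (mem_incident.2 ⟨he, heu⟩)
        rw [mem_incident] at this
        tauto
      have hne' : X0 ∪ N0 ≠ X1 := by
        intro h
        obtain ⟨t, ht⟩ := hP.meets X0 (by simp)
        have h1 : t ∈ X0 := (Finset.mem_inter.1 ht).1
        exact Finset.disjoint_left.1 hdisj h1 (by rw [← h]; simp [h1])
      have hdisj' : Disjoint (X0 ∪ N0) X1 := by
        rw [Finset.disjoint_union_left]
        exact ⟨hdisj, Finset.disjoint_left.2 fun u hu => (hN0W u hu).2.1⟩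
      have hP' : IsFamily S {X0 ∪ N0, X1} := by
        refine ⟨?_, ?_, ?_⟩
        · intro X hX Y hY hXY
          simp only [Finset.mem_insert, Finset.mem_singleton] at hX hY
          rcases hX with rfl | rfl <;> rcases hY with rfl | rfl
          · exact absurd rfl hXY
          · exact hdisj'
          · exact hdisj'.symm
          · exact absurd rfl hXY
        · intro X hX
          simp only [Finset.mem_insert, Finset.mem_singleton] at hX
          rcases hX with rfl | rfl
          · exact (hP.meets X0 (by simp)).mono
              (Finset.inter_subset_inter_right Finset.subset_union_left)
          · exact hP.meets _ (by simp)
        · intro t ht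
          rcases hcov t ht with h | h <;> simp [h]
      have hmain' := hbound _ hP'
      rw [Finset.card_pair hne', Finset.sum_pair hne'] at hmain'
      have hWe : (({X0 ∪ N0, X1} : Finset (Finset V)).biUnion id)ᶜ = W \ N0 := by
        ext u
        rw [Finset.mem_sdiff, hWm]
        simp only [Finset.mem_compl, Finset.mem_biUnion, Finset.mem_insert,
          Finset.mem_singleton, exists_eq_or_imp, exists_eq_left, id, Finset.mem_union]
        tauto
      rw [hWe] at hmain'
      have hN0sub : N0 ⊆ W := fun u hu => (Finset.mem_inter.1 (Finset.mem_filter.1 hu).1).1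
      have hexs : ∑ u ∈ W \ N0, ex u + ∑ u ∈ N0, ex u = ∑ u ∈ W, ex u :=
        Finset.sum_sdiff hN0sub
      have hcr : (crossing x y A (X0 ∪ N0)).card + ∑ u ∈ N0, ex u
          ≤ (crossing x y A X0).card := by
        rw [Finset.sum_congr rfl fun u hu => hNex u (hN0W u hu).2.2]
        refine crossing_union_add_le x y A hl X0 N0 (fun u hu => (hN0W u hu).1)
          (fun e he hx => ?_) (fun e he hy => ?_)
        · exact hS0 _ ((hind e he).resolve_left (hNS _ (hN0W _ hx).2.2))
            (hN0s _ hx e he (Or.inl rfl)).2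
        · exact hS0 _ ((hind e he).resolve_right (hNS _ (hN0W _ hy).2.2))
            (hN0s _ hy e he (Or.inr rfl)).1
      rw [Finset.sum_pair hX0, Finset.sum_pair hX0]
      have hadj : ∀ u ∈ (W \ N0) ∩ N, u ∈ T ∨ (3 ≤ S.card ∧ 3 ≤ (incident x y A u).card) := by
        intro u hu
        simp only [Finset.mem_inter, Finset.mem_sdiff] at hu
        refine hT u hu.2 hsS ?_
        by_contra hcon
        exact hu.1.2 (Finset.mem_filter.2 ⟨Finset.mem_inter.2 ⟨hu.1.1, hu.2⟩, hcon⟩)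
      have e1 := (hext1 X1).1
      have e0 := (hext1 X0).1
      by_cases hS3 : 3 ≤ S.card
      · have hz : ext X0 = 0 := by
          by_contra hz
          obtain ⟨s', -, hs'⟩ := (hext1 X0).2 hz
          have : S ⊆ {s', s} := by
            intro t ht
            rcases hcov t ht with h | h
            · have : t ∈ X0 ∩ S := Finset.mem_inter.2 ⟨h, ht⟩
              rw [hs'] at this; simp_all
            · have : t ∈ X1 ∩ S := Finset.mem_inter.2 ⟨h, ht⟩
              rw [hs] at this; simp_all
          have h1 := Finset.card_le_card this
          have h2 := Finset.card_le_two (a := s') (b := s)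
          omega
        have hcount : 2 * ((W \ N0) ∩ N).card ≤ T.card + 33 * k := by
          have h1 : ∑ u ∈ (W \ N0) ∩ N, a' u ≤ 33 * k :=
            (Finset.sum_le_sum_of_subset Finset.inter_subset_right).trans hNsum
          have h2 : ∑ u ∈ (W \ N0) ∩ N, 2
              ≤ ∑ u ∈ (W \ N0) ∩ N, (a' u + if u ∈ T then 1 else 0) := by
            refine Finset.sum_le_sum fun u hu => ?_
            have huN := (Finset.mem_inter.1 hu).2
            have h3 := hNa u huN
            have h4 := hNb u huN
            rcases hadj u hu with h | h
            · simp only [h, if_true]; omega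
            · omega
          rw [Finset.sum_const, smul_eq_mul, Finset.sum_add_distrib, Finset.sum_boole,
            Finset.filter_mem_eq_inter, Nat.cast_id] at h2
          have h5 : ((W \ N0) ∩ N ∩ T).card ≤ T.card := Finset.card_le_card Finset.inter_subset_right
          omega
        omega
      · have hcount : ((W \ N0) ∩ N).card ≤ T.card := by
          refine Finset.card_le_card fun u hu => ?_
          exact (hadj u hu).resolve_right fun h => hS3 h.1
        omega
    · push Not at h0
      rw [Finset.sum_eq_zero h0, hc]
      rw [hc] at hmain
      omega
  · have hsum : ∑ X ∈ P, ext X ≤ 3 * (k * P.card) := by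
      have := Finset.sum_le_card_nsmul P ext (3 * k) fun X _ => (hext1 X).1
      rw [smul_eq_mul] at this
      calc _ ≤ _ := this
        _ = _ := by ring
    have h3k : k * 3 ≤ k * P.card := Nat.mul_le_mul_left k hc
    omega

end Condition

section Rooted

variable [DecidableEq V]

/-- The edges of `A` joining `u` and `v`. -/
def between (x y : E → V) (A : Finset E) (u v : V) : Finset E :=
  A.filter fun e => (x e = u ∧ y e = v) ∨ (x e = v ∧ y e = u)

/-- The edges of `A` that are not incident to `v`. -/
def away (x y : E → V) (A : Finset E) (v : V) : Finset E :=
  A.filter fun e => x e ≠ v ∧ y e ≠ v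

/-- The colors below `k` that appear on the edges joining `u` and `v`. -/
def rootColors (x y : E → V) (A : Finset E) (col : E → ℕ) (k : ℕ) (u v : V) : Finset ℕ :=
  ((between x y A u v).filter fun e => col e < k).image col

/-- A terminal set `S` that is well connected around a root vertex `v`, whose edges carry a
prescribed coloring `col`; the vertices of `R` have large degree, where `p` counts edges that were
already put aside. -/
structure IsRootedInstance (x y : E → V) (A : Finset E) (v : V) (S R : Finset V) (p : V → ℕ)
    (col : E → ℕ) (k : ℕ) : Prop where
  loopless : ∀ e ∈ A, x e ≠ y e
  root_notMem : v ∉ S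
  nonempty : S.Nonempty
  pos : 0 < k
  root_degree : (incident x y A v).card = 36 * k ∨ ((incident x y A v).card = 0 ∧ 2 ≤ S.card)
  cut : ∀ X : Finset V, v ∉ X → (X ∩ S).Nonempty →
    (¬ S ⊆ X ∨ (incident x y A v).card = 36 * k) → 36 * k ≤ (crossing x y A X).card
  colored : ((incident x y A v).filter fun e => col e < k).card ≤ 33 * k
  reserve : ∀ r ∈ R, r ∉ S ∧ r ≠ v ∧ 34 * k ≤ (incident x y A r).card + p r

/-- A coloring `h` of the edges (where colors at least `k` mean unused) extending the coloring at
the root and connecting the terminals in every color, with many unused edges at `S` and `R`. -/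
structure IsExtension (x y : E → V) (A : Finset E) (v : V) (S R : Finset V) (p : V → ℕ)
    (col : E → ℕ) (k : ℕ) (h : E → ℕ) : Prop where
  mem : ∀ e, h e < k → e ∈ A
  root : ∀ e ∈ incident x y A v, h e = col e
  linked : ∀ i < k, ∀ s ∈ S, ∀ s' ∈ S, Linked x y (fun e => h e = i ∧ x e ≠ v ∧ y e ≠ v) s s'
  attached : ∀ e ∈ A, h e < k → ∀ u, (x e = v ∧ y e = u) ∨ (x e = u ∧ y e = v) →
    ∃ s ∈ S, Linked x y (fun f => h f = h e ∧ x f ≠ v ∧ y f ≠ v) u s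
  unused : ∀ s ∈ S, 3 * k ≤ ((incident x y A s).filter fun e => k ≤ h e).card
  reserved : ∀ r ∈ R, 2 * k ≤ ((incident x y A r).filter fun e => k ≤ h e).card + p r

lemma card_incident_eq_add (x y : E → V) (A : Finset E) {u v : V} (huv : u ≠ v) :
    (incident x y A u).card = (incident x y (away x y A v) u).card + (between x y A u v).card := by
  simp only [incident, between, away, Finset.filter_filter, Finset.card_filter,
    ← Finset.sum_add_distrib]
  refine Finset.sum_congr rfl fun e _ => ?_
  by_cases h1 : x e = v <;> by_cases h2 : y e = v <;> by_cases h3 : x e = u <;>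
    by_cases h4 : y e = u <;> simp_all

lemma card_rootColors_le (x y : E → V) (A : Finset E) (col : E → ℕ) (k : ℕ) (u v : V) :
    (rootColors x y A col k u v).card ≤ (between x y A u v).card :=
  Finset.card_image_le.trans (Finset.card_filter_le _ _)

lemma card_rootColors_le' (x y : E → V) (A : Finset E) (col : E → ℕ) (k : ℕ) (u v : V) :
    (rootColors x y A col k u v).card ≤ k := by
  conv_rhs => rw [← Finset.card_range k]
  refine Finset.card_le_card fun i hi => ?_
  obtain ⟨e, he, rfl⟩ := Finset.mem_image.1 hi
  exact Finset.mem_range.2 (Finset.mem_filter.1 he).2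

lemma sum_card_between_filter_le (x y : E → V) (A : Finset E) (col : E → ℕ) (k : ℕ) (v : V)
    (N : Finset V) :
    ∑ u ∈ N, ((between x y A u v).filter fun e => col e < k).card
      ≤ ((incident x y A v).filter fun e => col e < k).card := by
  simp only [between, incident, Finset.filter_filter, Finset.card_filter]
  rw [Finset.sum_comm]
  refine Finset.sum_le_sum fun e _ => ?_
  by_cases hc : col e < k
  · by_cases h1 : x e = v
    · simp only [h1, hc, and_true, true_or, if_true]
      rw [← Finset.card_filter, Finset.card_le_one]
      intro a ha b hb
      simp only [Finset.mem_filter] at ha hb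
      have ha := ha.2
      have hb := hb.2
      grind
    · by_cases h2 : y e = v
      · simp only [h1, h2, hc, and_true, or_true, if_true, false_and, or_false]
        rw [← Finset.card_filter, Finset.card_le_one]
        intro a ha b hb
        simp only [Finset.mem_filter] at ha hb
        exact ha.2.symm.trans hb.2
      · simp [h1, h2]
  · simp [hc]

lemma sum_card_rootColors_le (x y : E → V) (A : Finset E) (col : E → ℕ) (k : ℕ) (v : V)
    (N : Finset V) :
    ∑ u ∈ N, (rootColors x y A col k u v).card
      ≤ ((incident x y A v).filter fun e => col e < k).card :=
  (Finset.sum_le_sum fun _ _ => Finset.card_image_le).trans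
    (sum_card_between_filter_le x y A col k v N)

variable [Fintype V]

lemma sum_crossing_erase_le (x y : E → V) (A : Finset E) (hl : ∀ e ∈ A, x e ≠ y e) (v : V)
    (P : Finset (Finset V)) (hP : ∀ X ∈ P, ∀ Y ∈ P, X ≠ Y → Disjoint X Y) :
    ∑ X ∈ P, (crossing x y A (X.erase v)).card + ∑ u ∈ (P.biUnion id)ᶜ, (between x y A u v).card
      ≤ ∑ X ∈ P, (crossing x y (away x y A v) X).card + (incident x y A v).card := by
  have key : ∀ w : V, (∑ X ∈ P, if w ∈ X then 1 else 0)
      + (∑ u ∈ (P.biUnion id)ᶜ, if w = u then 1 else 0) ≤ 1 := by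
    intro w
    rw [← Finset.card_filter, Finset.sum_ite_eq]
    have h1 : (P.filter fun X => w ∈ X).card ≤ 1 := by
      rw [Finset.card_le_one]
      intro X hX Y hY
      simp only [Finset.mem_filter] at hX hY
      by_contra hXY
      exact Finset.disjoint_left.1 (hP X hX.1 Y hY.1 hXY) hX.2 hY.2
    split_ifs with h
    · have : (P.filter fun X => w ∈ X) = ∅ := by
        rw [Finset.filter_eq_empty_iff]
        intro X hX hw
        exact Finset.mem_compl.1 h (Finset.mem_biUnion.2 ⟨X, hX, hw⟩)
      rw [this]; simp
    · omega
  simp only [crossing, between, away, incident, Finset.card_filter, Finset.filter_filter]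
  rw [Finset.sum_comm, Finset.sum_comm (s := (P.biUnion id)ᶜ), Finset.sum_comm (s := P)]
  simp only [← Finset.sum_add_distrib]
  refine Finset.sum_le_sum fun e he => ?_
  have hne := hl e he
  by_cases h1 : x e = v
  · have h2 : y e ≠ v := fun h => hne (h1.trans h.symm)
    have := key (y e)
    simpa [h1, h2] using this
  · by_cases h2 : y e = v
    · have := key (x e)
      simpa [h1, h2] using this
    · simp [h1, h2]

lemma IsRootedInstance.between_le {x y : E → V} {A : Finset E} {v : V} {S R : Finset V}
    {p : V → ℕ} {col : E → ℕ} {k : ℕ} (hI : IsRootedInstance x y A v S R p col k) {u : V}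
    (hu : u ∉ S) : (between x y A u v).card ≤ (incident x y (away x y A v) u).card := by
  by_cases huv : u = v
  · subst huv
    have : between x y A u u = ∅ := by
      refine Finset.filter_eq_empty_iff.2 fun e he h => ?_
      refine hI.loopless e he ?_
      rcases h with h | h <;> exact h.1.trans h.2.symm
    rw [this]; simp
  rcases hI.root_degree with hd | hd
  · have h1 := hI.cut ({v, u} : Finset V)ᶜ (by simp) (by
      obtain ⟨s, hs⟩ := hI.nonempty
      refine ⟨s, Finset.mem_inter.2 ⟨?_, hs⟩⟩
      simp only [Finset.mem_compl, Finset.mem_insert, Finset.mem_singleton, not_or]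
      exact ⟨fun h => hI.root_notMem (h ▸ hs), fun h => hu (h ▸ hs)⟩) (Or.inr hd)
    have h2 : (crossing x y A ({v, u} : Finset V)ᶜ).card + (between x y A u v).card
        ≤ (incident x y (away x y A v) u).card + (incident x y A v).card := by
      simp only [incident, between, away, crossing, Finset.filter_filter, Finset.card_filter,
        ← Finset.sum_add_distrib]
      refine Finset.sum_le_sum fun e _ => ?_
      by_cases h1 : x e = v <;> by_cases h2 : y e = v <;> by_cases h3 : x e = u <;>
        by_cases h4 : y e = u <;> simp_all
    omega
  · refine le_trans (le_trans (Finset.card_le_card fun e he => ?_) hd.1.le) (Nat.zero_le _)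
    simp only [between, incident, Finset.mem_filter] at he ⊢
    tauto

lemma IsRootedInstance.family_condition {x y : E → V} {A : Finset E} {v : V} {S R : Finset V}
    {p : V → ℕ} {col : E → ℕ} {k : ℕ} (hI : IsRootedInstance x y A v S R p col k)
    {P : Finset (Finset V)} (hP : IsFamily S P) :
    36 * k * P.card + ∑ u ∈ (P.biUnion id)ᶜ, (between x y A u v).card
      ≤ ∑ X ∈ P, (crossing x y (away x y A v) X).card + 36 * k := by
  have h1 := sum_crossing_erase_le x y A hI.loopless v P hP.disjoint
  have hle : (incident x y A v).card ≤ 36 * k := by rcases hI.root_degree with h | h <;> omega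
  by_cases hc : P.card ≤ 1
  · have : 36 * k * P.card ≤ 36 * k * 1 := Nat.mul_le_mul_left _ hc
    rcases hI.root_degree with hd | hd
    · have h2 : P.card • (36 * k) ≤ ∑ X ∈ P, (crossing x y A (X.erase v)).card := by
        refine Finset.card_nsmul_le_sum _ _ _ fun X hX => ?_
        refine hI.cut _ (Finset.notMem_erase _ _) ?_ (Or.inr hd)
        obtain ⟨s, hs⟩ := hP.meets X hX
        rw [Finset.mem_inter] at hs
        exact ⟨s, Finset.mem_inter.2
          ⟨Finset.mem_erase.2 ⟨fun h => hI.root_notMem (h ▸ hs.2), hs.1⟩, hs.2⟩⟩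
      rw [smul_eq_mul, mul_comm] at h2
      omega
    · omega
  · have h2 : P.card • (36 * k) ≤ ∑ X ∈ P, (crossing x y A (X.erase v)).card := by
      refine Finset.card_nsmul_le_sum _ _ _ fun X hX => ?_
      obtain ⟨s, hs⟩ := hP.meets X hX
      rw [Finset.mem_inter] at hs
      refine hI.cut _ (Finset.notMem_erase _ _) ⟨s, Finset.mem_inter.2
        ⟨Finset.mem_erase.2 ⟨fun h => hI.root_notMem (h ▸ hs.2), hs.1⟩, hs.2⟩⟩ (Or.inl ?_)
      intro hSX
      obtain ⟨Y, hY, hYX⟩ := Finset.exists_mem_ne (by omega : 1 < P.card) X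
      obtain ⟨t, ht⟩ := hP.meets Y hY
      rw [Finset.mem_inter] at ht
      exact Finset.disjoint_left.1 (hP.disjoint Y hY X hX hYX) ht.1
        (Finset.mem_of_mem_erase (hSX ht.2))
    rw [smul_eq_mul, mul_comm] at h2
    omega

end Rooted

section Attaching

variable [DecidableEq V] [DecidableEq E]

lemma exists_coloring_onto (C : Finset ℕ) (J : Finset E) (k : ℕ) (hCJ : C.card ≤ J.card) :
    ∃ g : E → ℕ, (∀ c ∈ C, ∃ e ∈ J, g e = c) ∧ (J.filter fun e => g e < k).card ≤ C.card := by
  obtain ⟨J', hJ', hc⟩ := Finset.exists_subset_card_eq hCJ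
  let f := Finset.equivOfCardEq hc
  refine ⟨fun e => if he : e ∈ J' then f ⟨e, he⟩ else k, ?_, ?_⟩
  · intro c hcC
    refine ⟨f.symm ⟨c, hcC⟩, hJ' (f.symm ⟨c, hcC⟩).2, ?_⟩
    simp
  · rw [← hc]
    refine Finset.card_le_card fun e he => ?_
    by_contra h
    simp [h] at he

lemma exists_attaching_coloring (C : V → Finset ℕ) (S : Finset V) (J : Finset E) (hd : E → V)
    (k : ℕ) (hCJ : ∀ u ∉ S, (C u).card ≤ (J.filter fun e => hd e = u).card) :
    ∃ g : E → ℕ, (∀ u ∉ S, ∀ c ∈ C u, ∃ e ∈ J, hd e = u ∧ g e = c) ∧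
      ∀ u ∉ S, (J.filter fun e => hd e = u ∧ g e < k).card ≤ (C u).card := by
  have : ∀ u, ∃ g : E → ℕ, u ∉ S → (∀ c ∈ C u, ∃ e ∈ J.filter fun e => hd e = u, g e = c) ∧
      ((J.filter fun e => hd e = u).filter fun e => g e < k).card ≤ (C u).card := by
    intro u
    by_cases hu : u ∈ S
    · exact ⟨fun _ => 0, fun h => absurd hu h⟩
    · obtain ⟨g, hg⟩ := exists_coloring_onto (C u) (J.filter fun e => hd e = u) k (hCJ u hu)
      exact ⟨g, fun _ => hg⟩
  choose g hg using this
  refine ⟨fun e => g (hd e) e, ?_, ?_⟩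
  · intro u hu c hc
    obtain ⟨e, he, hec⟩ := (hg u hu).1 c hc
    rw [Finset.mem_filter] at he
    exact ⟨e, he.1, he.2, by beta_reduce; rw [he.2]; exact hec⟩
  · intro u hu
    refine le_trans (Finset.card_le_card fun e he => ?_) (hg u hu).2
    simp only [Finset.mem_filter] at he ⊢
    obtain ⟨h1, h2, h3⟩ := he
    rw [h2] at h3
    exact ⟨⟨h1, h2⟩, h3⟩

variable [Fintype V]

/-- A packing of the edges avoiding the root becomes an extension of the root coloring, when
suitable unused edges `J` are available. -/
lemma exists_extension_of_packing {x y : E → V} {A : Finset E} {v : V} {S R : Finset V}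
    {p : V → ℕ} {col : E → ℕ} {k : ℕ} (hI : IsRootedInstance x y A v S R p col k)
    (hind : ∀ e ∈ away x y A v, x e ∈ S ∨ y e ∈ S) (h0 : E → ℕ)
    (h0mem : ∀ e, h0 e < k → e ∈ away x y A v)
    (h0link : ∀ i < k, ∀ s ∈ S, ∀ s' ∈ S, Linked x y (fun e => h0 e = i) s s')
    (J : Finset E) (hJA : J ⊆ away x y A v) (hJ0 : ∀ e ∈ J, k ≤ h0 e) (hd : E → V)
    (hdends : ∀ e, hd e = x e ∨ hd e = y e) (hJS : ∀ e ∈ J, hd e ∉ S)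
    (hJC : ∀ u ∉ S, (rootColors x y A col k u v).card ≤ (J.filter fun e => hd e = u).card)
    (hJR : ∀ r ∈ R, 2 * k + (rootColors x y A col k r v).card
      ≤ (J.filter fun e => hd e = r).card + p r)
    (hU : ∀ s ∈ S, (∃ U ⊆ incident x y (away x y A v) s, Disjoint U J ∧ (∀ e ∈ U, k ≤ h0 e) ∧
      3 * k ≤ U.card) ∨ (36 * k ≤ (incident x y A s).card ∧ ∀ e, k ≤ h0 e)) :
    ∃ h, IsExtension x y A v S R p col k h := by
  obtain ⟨g, hg1, hg2⟩ := exists_attaching_coloring (fun u => rootColors x y A col k u v) S J hd k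
    hJC
  have hAA : ∀ e ∈ away x y A v, e ∈ A ∧ x e ≠ v ∧ y e ≠ v := fun e he => Finset.mem_filter.1 he
  have hAi : ∀ e ∈ away x y A v, e ∉ incident x y A v := by
    intro e he hi
    obtain ⟨-, h1, h2⟩ := hAA e he
    rcases (mem_incident.1 hi).2 with h | h <;> contradiction
  let h : E → ℕ := fun e => if e ∈ incident x y A v then col e else if e ∈ J then g e else h0 e
  have hroot : ∀ e ∈ incident x y A v, h e = col e := fun e he => if_pos he
  have hJ : ∀ e ∈ J, h e = g e := by
    intro e he
    simp only [h, if_neg (hAi e (hJA he)), if_pos he]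
  have hother : ∀ e, e ∉ incident x y A v → e ∉ J → h e = h0 e := by
    intro e h1 h2
    simp only [h, if_neg h1, if_neg h2]
  refine ⟨h, ?_, hroot, ?_, ?_, ?_, ?_⟩
  · intro e he
    by_cases h1 : e ∈ incident x y A v
    · exact (mem_incident.1 h1).1
    by_cases h2 : e ∈ J
    · exact (hAA e (hJA h2)).1
    rw [hother e h1 h2] at he
    exact (hAA e (h0mem e he)).1
  · intro i hi s hs s' hs'
    refine (h0link i hi s hs s' hs').mono fun e he => ?_
    have h1 := h0mem e (by omega)
    have h2 : e ∉ J := fun h => by have := hJ0 e h; omega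
    exact ⟨(hother e (hAi e h1) h2).trans he, (hAA e h1).2⟩
  · intro e heA hek u hu
    have hei : e ∈ incident x y A v := mem_incident.2 ⟨heA, by tauto⟩
    rw [hroot e hei] at hek ⊢
    by_cases huS : u ∈ S
    · exact ⟨u, huS, Relation.ReflTransGen.refl⟩
    obtain ⟨f, hfJ, hfu, hfc⟩ := hg1 u huS (col e) (by
      refine Finset.mem_image_of_mem _ ?_
      simp only [between, Finset.mem_filter]
      exact ⟨⟨heA, by tauto⟩, hek⟩)
    have hf := hJA hfJ
    have hB : h f = col e ∧ x f ≠ v ∧ y f ≠ v := ⟨(hJ f hfJ).trans hfc, (hAA f hf).2⟩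
    rcases hdends f with h1 | h1
    · have hxu : x f = u := h1.symm.trans hfu
      refine ⟨y f, (hind f hf).resolve_left (by rwa [hxu]), ?_⟩
      rw [← hxu]
      exact Linked.of_edge (B := fun f => h f = col e ∧ x f ≠ v ∧ y f ≠ v) hB
    · have hyu : y f = u := h1.symm.trans hfu
      refine ⟨x f, (hind f hf).resolve_right (by rwa [hyu]), ?_⟩
      rw [← hyu]
      exact (Linked.of_edge (B := fun f => h f = col e ∧ x f ≠ v ∧ y f ≠ v) hB).symm
  · intro s hs
    rcases hU s hs with ⟨U, hUs, hUJ, hU0, hUc⟩ | ⟨hds, hall⟩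
    · refine hUc.trans (Finset.card_le_card fun e he => ?_)
      have h1 := mem_incident.1 (hUs he)
      rw [Finset.mem_filter, hother e (hAi e h1.1) (Finset.disjoint_left.1 hUJ he)]
      exact ⟨mem_incident.2 ⟨(hAA e h1.1).1, h1.2⟩, hU0 e he⟩
    · have hsplit := Finset.card_filter_add_card_filter_not (s := incident x y A s)
        (fun e => h e < k)
      simp only [not_lt] at hsplit
      have hbound : ((incident x y A s).filter fun e => h e < k).card ≤ 33 * k := by
        refine le_trans ?_ hI.colored
        refine le_trans ?_ (sum_card_between_filter_le x y A col k v Finset.univ)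
        rw [← Finset.sum_add_sum_compl S]
        have h1 : ((incident x y A s).filter fun e => h e < k)
            ⊆ ((between x y A s v).filter fun e => col e < k)
              ∪ Sᶜ.biUnion fun u => J.filter fun e => hd e = u ∧ g e < k := by
          intro e he
          rw [Finset.mem_filter, mem_incident] at he
          obtain ⟨⟨heA, hes⟩, hek⟩ := he
          rw [Finset.mem_union]
          by_cases hi : e ∈ incident x y A v
          · left
            rw [hroot e hi] at hek
            have hsv : s ≠ v := fun h => hI.root_notMem (h ▸ hs)
            have h2 := (mem_incident.1 hi).2
            simp only [between, Finset.mem_filter]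
            refine ⟨⟨heA, ?_⟩, hek⟩
            rcases hes with h | h <;> rcases h2 with h' | h'
            · exact absurd (h.symm.trans h') hsv
            · exact Or.inl ⟨h, h'⟩
            · exact Or.inr ⟨h', h⟩
            · exact absurd (h.symm.trans h') hsv
          · right
            by_cases hj : e ∈ J
            · rw [hJ e hj] at hek
              exact Finset.mem_biUnion.2 ⟨hd e, Finset.mem_compl.2 (hJS e hj),
                Finset.mem_filter.2 ⟨hj, rfl, hek⟩⟩
            · rw [hother e hi hj] at hek
              have := hall e
              omega
        refine (Finset.card_le_card h1).trans ((Finset.card_union_le _ _).trans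
          (Nat.add_le_add ?_ ?_))
        · exact Finset.single_le_sum
            (f := fun u => ((between x y A u v).filter fun e => col e < k).card)
            (fun _ _ => Nat.zero_le _) hs
        · refine Finset.card_biUnion_le.trans (Finset.sum_le_sum fun u hu => ?_)
          exact (hg2 u (Finset.mem_compl.1 hu)).trans Finset.card_image_le
      omega
  · intro r hr
    have hrS := (hI.reserve r hr).1
    have h1 := hJR r hr
    have h2 := hg2 r hrS
    have hsplit := Finset.card_filter_add_card_filter_not (s := J.filter fun e => hd e = r)
      (fun e => g e < k)
    simp only [Finset.filter_filter, not_lt] at hsplit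
    have h3 : (J.filter fun e => hd e = r ∧ k ≤ g e).card
        ≤ ((incident x y A r).filter fun e => k ≤ h e).card := by
      refine Finset.card_le_card fun e he => ?_
      rw [Finset.mem_filter] at he ⊢
      obtain ⟨he, her, hek⟩ := he
      rw [hJ e he, mem_incident]
      refine ⟨⟨(hAA e (hJA he)).1, ?_⟩, hek⟩
      rw [← her]
      rcases hdends e with h | h <;> simp [h]
    omega

end Attaching

section Independent

variable [DecidableEq V] [DecidableEq E] [Fintype V]

omit [DecidableEq E] [Fintype V] in
lemma crossing_singleton (x y : E → V) (A : Finset E) (hl : ∀ e ∈ A, x e ≠ y e) (s : V) :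
    crossing x y A {s} = incident x y A s := by
  refine Finset.filter_congr fun e he => ?_
  have := hl e he
  simp only [Finset.mem_singleton]
  grind

lemma exists_extension_of_card_le_one {x y : E → V} {A : Finset E} {v : V} {S R : Finset V}
    {p : V → ℕ} {col : E → ℕ} {k : ℕ} (hI : IsRootedInstance x y A v S R p col k)
    (hind : ∀ e ∈ away x y A v, x e ∈ S ∨ y e ∈ S) (hS : S.card ≤ 1) :
    ∃ h, IsExtension x y A v S R p col k h := by
  have hd36 : (incident x y A v).card = 36 * k := by
    rcases hI.root_degree with h | h <;> omega
  have hJu : ∀ u ∉ S, ((away x y A v).filter fun e => (if x e ∈ S then y e else x e) = u)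
      = incident x y (away x y A v) u := by
    intro u hu
    refine Finset.filter_congr fun e he => ?_
    have h1 := hind e he
    have h2 : x e ∈ S → y e ∈ S → False := fun h h' =>
      hI.loopless e (Finset.mem_filter.1 he).1 (Finset.card_le_one.1 hS _ h _ h')
    grind
  refine exists_extension_of_packing hI hind (fun _ => k) (fun _ h => absurd h (lt_irrefl _)) ?_
    (away x y A v) subset_rfl (fun _ _ => le_rfl) (fun e => if x e ∈ S then y e else x e) ?_ ?_ ?_
    ?_ ?_
  · intro i _ s hs s' hs'
    rw [Finset.card_le_one.1 hS s hs s' hs']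
    exact Relation.ReflTransGen.refl
  · intro e
    split_ifs <;> simp
  · intro e he
    split_ifs with h
    · exact fun h' => hI.loopless e (Finset.mem_filter.1 he).1 (Finset.card_le_one.1 hS _ h _ h')
    · exact h
  · intro u hu
    rw [hJu u hu]
    exact (card_rootColors_le ..).trans (hI.between_le hu)
  · intro r hr
    obtain ⟨h1, h2, h3⟩ := hI.reserve r hr
    rw [hJu r h1]
    have h4 := hI.between_le h1
    have h5 := card_rootColors_le' x y A col k r v
    rw [card_incident_eq_add x y A h2] at h3
    omega
  · intro s hs
    right
    refine ⟨?_, fun _ => le_rfl⟩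
    rw [← crossing_singleton x y A hI.loopless]
    exact hI.cut _ (by simpa using fun h : v = s => hI.root_notMem (h ▸ hs))
      ⟨s, by simpa using hs⟩ (Or.inr hd36)

/-- The extension theorem when every edge avoiding the root meets the terminals. -/
lemma exists_extension_of_independent {x y : E → V} {A : Finset E} {v : V} {S R : Finset V}
    {p : V → ℕ} {col : E → ℕ} {k : ℕ} (hI : IsRootedInstance x y A v S R p col k)
    (hind : ∀ e ∈ away x y A v, x e ∈ S ∨ y e ∈ S)
    (hdeg : ∀ u ∉ S, u ≠ v → (incident x y A u).card ≠ 1) :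
    ∃ h, IsExtension x y A v S R p col k h := by
  rcases Nat.lt_or_ge 1 S.card with hS2 | hS1
  swap
  · exact exists_extension_of_card_le_one hI hind hS1
  obtain ⟨r, hr⟩ := hI.nonempty
  have hk := hI.pos
  have : Nonempty E := by
    have h1 := hI.cut {r} (by simpa using fun h : v = r => hI.root_notMem (h ▸ hr))
      ⟨r, by simpa using hr⟩ (Or.inl fun h => by
        have := Finset.card_le_card h
        rw [Finset.card_singleton] at this
        omega)
    obtain ⟨e, -⟩ := Finset.card_pos.1 (by omega : 0 < (crossing x y A {r}).card)
    exact ⟨e⟩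
  have hl : ∀ e ∈ away x y A v, x e ≠ y e := fun e he =>
    hI.loopless e (Finset.mem_filter.1 he).1
  obtain ⟨a', ha'⟩ : ∃ a' : V → ℕ, ∀ u, a' u = (rootColors x y A col k u v).card :=
    ⟨_, fun _ => rfl⟩
  obtain ⟨base, hbase⟩ : ∃ base : V → ℕ, ∀ u, base u = a' u + if u ∈ R ∧ p u < 2 * k then 2 * k
      else 0 := ⟨_, fun _ => rfl⟩
  obtain ⟨b, hb⟩ : ∃ b : V → ℕ, ∀ u, (incident x y (away x y A v) u).card = b u :=
    ⟨_, fun _ => rfl⟩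
  obtain ⟨ex, hexd⟩ : ∃ ex : V → ℕ, ∀ u, ex u = base u + (b u + base u) % 2 :=
    ⟨_, fun _ => rfl⟩
  obtain ⟨N, hN⟩ : ∃ N : Finset V, ∀ u, u ∈ N ↔
      u ∉ S ∧ ¬ (u ∈ R ∧ p u < 2 * k) ∧ b u = a' u + 1 ∧ 1 ≤ a' u :=
    ⟨Finset.univ.filter fun u => u ∉ S ∧ ¬ (u ∈ R ∧ p u < 2 * k) ∧ b u = a' u + 1 ∧ 1 ≤ a' u,
      fun u => by simp only [Finset.mem_filter, Finset.mem_univ, true_and]⟩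
  have hNex : ∀ u ∈ N, ex u = b u ∧ base u + 1 = b u := by
    intro u hu
    obtain ⟨-, h2, h3, h4⟩ := (hN u).1 hu
    have h5 := hbase u
    rw [if_neg h2] at h5
    have h6 := hexd u
    omega
  have hNS : ∀ u ∈ N, u ∉ S := fun u hu => ((hN u).1 hu).1
  have hab : ∀ u ∉ S, (between x y A u v).card ≤ b u := fun u hu => hb u ▸ hI.between_le hu
  have haa : ∀ u, a' u ≤ (between x y A u v).card := fun u => ha' u ▸ card_rootColors_le ..
  have hak : ∀ u, a' u ≤ k := fun u => ha' u ▸ card_rootColors_le' ..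
  have hR16 : ∀ u ∈ R, p u < 2 * k → 32 * k < b u + (between x y A u v).card := by
    intro u hu hp
    obtain ⟨-, h2, h3⟩ := hI.reserve u hu
    rw [card_incident_eq_add x y A h2, hb] at h3
    omega
  have hex : ∀ u ∉ S, ex u ≤ b u := by
    intro u hu
    have h1 := hab u hu
    have h2 := haa u
    have h3 := hak u
    have h4 := hexd u
    have h5 := hbase u
    split_ifs at h5 with h6
    · have := hR16 u h6.1 h6.2
      omega
    · omega
  have hex3 : ∀ u ∉ S, 3 * ex u ≤ 2 * (between x y A u v).card + b u
      + 2 * (if u ∈ N then 1 else 0) := by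
    intro u hu
    have h1 := hab u hu
    have h2 := haa u
    have h3 := hak u
    have h4 := hexd u
    have h5 := hbase u
    by_cases h6 : u ∈ R ∧ p u < 2 * k
    · rw [if_pos h6] at h5
      have := hR16 u h6.1 h6.2
      omega
    · rw [if_neg h6] at h5
      by_cases h7 : u ∈ N
      · rw [if_pos h7]
        have := hNex u h7
        omega
      · rw [if_neg h7]
        have h8 : ¬ (b u = a' u + 1 ∧ 1 ≤ a' u) := fun h => h7 ((hN u).2 ⟨hu, h6, h⟩)
        have h9 : b u + (between x y A u v).card ≠ 1 := by
          by_cases huv : u = v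
          · subst huv
            have : b u = 0 := by
              rw [← hb, Finset.card_eq_zero]
              refine Finset.filter_eq_empty_iff.2 fun e he h => ?_
              have := (Finset.mem_filter.1 he).2
              tauto
            omega
          · rw [← hb, ← card_incident_eq_add x y A huv]
            exact hdeg u hu huv
        omega
  obtain ⟨c, hc, hT⟩ := exists_reserved_edges x y (away x y A v) S hind N hNS (fun u hu => by
    have := (hN u).1 hu
    rw [hb]; omega)
  obtain ⟨D, hD⟩ : ∃ D : Finset V, ∀ s, s ∈ D ↔ s ∈ S ∧
      (N.filter fun u => c u ∈ incident x y (away x y A v) s).card < 3 * k :=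
    ⟨S.filter fun s => (N.filter fun u => c u ∈ incident x y (away x y A v) s).card < 3 * k,
      fun s => Finset.mem_filter⟩
  have hcond := partition_condition x y (away x y A v) hl S hind hS2 k
    (fun u => (between x y A u v).card) a' ex N (fun u hu => hb u ▸ hex u hu)
    (fun u hu => hb u ▸ hex3 u hu) hNS (fun u hu => hb u ▸ (hNex u hu).1)
    (fun u hu => hb u ▸ ((hN u).1 hu).2.2.1) (fun u hu => ((hN u).1 hu).2.2.2)
    (by
      simp only [ha']
      exact (sum_card_rootColors_le x y A col k v N).trans hI.colored)
    (fun P hP => hI.family_condition hP) D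
    (fun s hs => by
      obtain ⟨T, hTN, hTc, hTs⟩ := hT s
      have := ((hD s).1 hs).2
      exact ⟨T, hTN, by omega, hTs⟩)
  obtain ⟨hd, h0, hdends, h0mem, h0link, hext, hexF⟩ := exists_packing_with_reserve x y
    (away x y A v) hl S hind r hr k (fun s => if s ∈ D then 3 * k else 0) ex
    (fun u _ => by
      rw [hb, hexd, Nat.even_iff]; omega)
    (fun P h1 h2 h3 => hcond P ⟨h1, h2, h3⟩)
  have hends : ∀ e ∈ away x y A v, ∀ u u', u ∉ S → u' ∉ S → (x e = u ∨ y e = u) →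
      (x e = u' ∨ y e = u') → u = u' := by
    intro e he u u' hu hu' h1 h2
    have := hind e he
    grind
  have hFN : ∀ u ∈ N, ((away x y A v).filter fun e => hd e = u ∧ k ≤ h0 e)
      = incident x y (away x y A v) u := by
    intro u hu
    refine Finset.eq_of_subset_of_card_le (fun e he => ?_) ?_
    · rw [Finset.mem_filter] at he
      rw [mem_incident, ← he.2.1]
      exact ⟨he.1, by rcases hdends e with h | h <;> simp [h]⟩
    · rw [hb, ← (hNex u hu).1]
      exact hexF u (hNS u hu)
  let J : Finset E := (away x y A v).filter fun e => hd e ∉ S ∧ k ≤ h0 e ∧ ¬ ∃ u ∈ N, c u = e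
  have hJ : ∀ e, e ∈ J ↔ e ∈ away x y A v ∧ hd e ∉ S ∧ k ≤ h0 e ∧ ¬ ∃ u ∈ N, c u = e :=
    fun e => Finset.mem_filter
  have hJbase : ∀ u ∉ S, base u ≤ (J.filter fun e => hd e = u).card := by
    intro u hu
    have hsub : ∀ e ∈ (away x y A v).filter fun e => hd e = u ∧ k ≤ h0 e,
        (u ∈ N → e ≠ c u) → e ∈ J.filter fun e => hd e = u := by
      intro e he hne
      rw [Finset.mem_filter] at he
      obtain ⟨he, h1, h2⟩ := he
      rw [Finset.mem_filter, hJ]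
      refine ⟨⟨he, h1 ▸ hu, h2, ?_⟩, h1⟩
      rintro ⟨u', hu', rfl⟩
      have h3 : x (c u') = u ∨ y (c u') = u := by
        rw [← h1]; rcases hdends (c u') with h | h <;> simp [h]
      have h4 := hends _ he u u' hu (hNS u' hu') h3 (mem_incident.1 (hc u' hu')).2
      subst h4
      exact hne hu' rfl
    have hF := hexF u hu
    by_cases huN : u ∈ N
    · have h1 := hNex u huN
      have h2 : ((away x y A v).filter fun e => hd e = u ∧ k ≤ h0 e).erase (c u)
          ⊆ J.filter fun e => hd e = u := fun e he =>
        hsub e (Finset.mem_of_mem_erase he) fun _ => Finset.ne_of_mem_erase he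
      have h3 := Finset.card_le_card h2
      have h4 := Finset.pred_card_le_card_erase (a := c u)
        (s := (away x y A v).filter fun e => hd e = u ∧ k ≤ h0 e)
      omega
    · have h1 := Finset.card_le_card fun e he => hsub e he fun h => absurd h huN
      have h2 := hexd u
      omega
  refine exists_extension_of_packing hI hind h0 h0mem
    (fun i hi s hs s' hs' => (h0link i hi s hs).symm.trans (h0link i hi s' hs')) J
    (Finset.filter_subset _ _) (fun e he => ((hJ e).1 he).2.2.1) hd hdends
    (fun e he => ((hJ e).1 he).2.1) ?_ ?_ ?_
  · intro u hu
    have h1 := hJbase u hu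
    have h2 := hbase u
    rw [← ha']
    omega
  · intro u hu
    have h1 := hJbase u (hI.reserve u hu).1
    have h2 := hbase u
    rw [← ha']
    split_ifs at h2 with h3
    · omega
    · have : ¬ p u < 2 * k := fun h => h3 ⟨hu, h⟩
      omega
  · intro s hs
    left
    by_cases hsD : s ∈ D
    · refine ⟨(away x y A v).filter fun e => hd e = s ∧ k ≤ h0 e, ?_, ?_, ?_, ?_⟩
      · intro e he
        rw [Finset.mem_filter] at he
        rw [mem_incident, ← he.2.1]
        exact ⟨he.1, by rcases hdends e with h | h <;> simp [h]⟩
      · refine Finset.disjoint_left.2 fun e he he' => ((hJ e).1 he').2.1 ?_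
        rw [(Finset.mem_filter.1 he).2.1]; exact hs
      · intro e he
        exact (Finset.mem_filter.1 he).2.2
      · have := hext s hs
        rwa [if_pos hsD] at this
    · refine ⟨(N.filter fun u => c u ∈ incident x y (away x y A v) s).image c, ?_, ?_, ?_, ?_⟩
      · intro e he
        obtain ⟨u, hu, rfl⟩ := Finset.mem_image.1 he
        exact (Finset.mem_filter.1 hu).2
      · refine Finset.disjoint_left.2 fun e he he' => ((hJ e).1 he').2.2.2 ?_
        obtain ⟨u, hu, rfl⟩ := Finset.mem_image.1 he
        exact ⟨u, (Finset.mem_filter.1 hu).1, rfl⟩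
      · intro e he
        obtain ⟨u, hu, rfl⟩ := Finset.mem_image.1 he
        have huN := (Finset.mem_filter.1 hu).1
        have := hc u huN
        rw [← hFN u huN] at this
        exact (Finset.mem_filter.1 this).2.2
      · rw [Finset.card_image_of_injOn]
        · by_contra h
          exact hsD ((hD s).2 ⟨hs, by omega⟩)
        · intro u hu u' hu' h
          have hu := (Finset.mem_filter.1 hu).1
          have hu' := (Finset.mem_filter.1 hu').1
          have h1 := mem_incident.1 (hc u hu)
          have h2 := mem_incident.1 (hc u' hu')
          rw [← h] at h2
          exact hends _ h1.1 u u' (hNS u hu) (hNS u' hu') h1.2 h2.2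

end Independent

section Tight

variable [DecidableEq V]

/-- A vertex set whose cut attains the bound required of a rooted instance. -/
structure IsTight (x y : E → V) (A : Finset E) (v : V) (S : Finset V) (k : ℕ) (X : Finset V) :
    Prop where
  root_notMem : v ∉ X
  meets : (X ∩ S).Nonempty
  proper : ¬ S ⊆ X ∨ (incident x y A v).card = 36 * k
  card_eq : (crossing x y A X).card = 36 * k

lemma mem_crossing {x y : E → V} {A : Finset E} {X : Finset V} {e : E} :
    e ∈ crossing x y A X ↔ e ∈ A ∧ ¬ (x e ∈ X ↔ y e ∈ X) := by
  simp [crossing]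

variable {x y : E → V} {A : Finset E} {v : V} {S R : Finset V} {p : V → ℕ} {col : E → ℕ} {k : ℕ}

lemma IsRootedInstance.le_card_incident (hI : IsRootedInstance x y A v S R p col k) {s : V}
    (hs : s ∈ S) : 36 * k ≤ (incident x y A s).card := by
  rw [← crossing_singleton x y A hI.loopless]
  refine hI.cut _ (by simpa using fun h : v = s => hI.root_notMem (h ▸ hs))
    ⟨s, by simpa using hs⟩ ?_
  rcases hI.root_degree with h | h
  · exact Or.inr h
  · refine Or.inl fun hS => ?_
    have := Finset.card_le_card hS
    rw [Finset.card_singleton] at this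
    omega

lemma IsRootedInstance.mem_or_mem (hI : IsRootedInstance x y A v S R p col k) {X : Finset V}
    (hX : IsTight x y A v S k X)
    (hsplit : (∀ e ∈ A, x e ∈ X → y e ∉ X) ∨ (∀ e ∈ A, x e ∉ X → y e ∈ X)) {e : E}
    (he : e ∈ away x y A v) (heX : e ∈ crossing x y A X) : x e ∈ S ∨ y e ∈ S := by
  by_contra hcon
  push Not at hcon
  obtain ⟨heA, hev⟩ := Finset.mem_filter.1 he
  have key : ∀ z, 36 * k ≤ (incident x y A z).card →
      (∀ f ∈ incident x y A z, f ∈ crossing x y A X) → e ∉ incident x y A z → False := by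
    intro z hz hsub hez
    have h1 : (incident x y A z).card < (crossing x y A X).card :=
      Finset.card_lt_card ⟨hsub, fun h => hez (h heX)⟩
    rw [hX.card_eq] at h1
    omega
  have hnot : ∀ s ∈ S, e ∉ incident x y A s := by
    intro s hs h
    rcases (mem_incident.1 h).2 with h | h
    · exact hcon.1 (h ▸ hs)
    · exact hcon.2 (h ▸ hs)
  rcases hsplit with hin | hout
  · obtain ⟨s, hs⟩ := hX.meets
    rw [Finset.mem_inter] at hs
    refine key s (hI.le_card_incident hs.2) (fun f hf => ?_) (hnot s hs.2)
    obtain ⟨hfA, hfs⟩ := mem_incident.1 hf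
    have := hin f hfA
    rw [mem_crossing]
    refine ⟨hfA, ?_⟩
    rcases hfs with h | h <;> rw [← h] at hs <;> tauto
  · have hsub : ∀ z ∉ X, ∀ f ∈ incident x y A z, f ∈ crossing x y A X := by
      intro z hz f hf
      obtain ⟨hfA, hfs⟩ := mem_incident.1 hf
      have := hout f hfA
      rw [mem_crossing]
      refine ⟨hfA, ?_⟩
      rcases hfs with h | h <;> rw [← h] at hz <;> tauto
    rcases hX.proper with h | h
    · obtain ⟨s, hs, hsX⟩ := Finset.not_subset.1 h
      exact key s (hI.le_card_incident hs) (hsub s hsX) (hnot s hs)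
    · refine key v h.ge (hsub v hX.root_notMem) fun hev' => ?_
      have := (mem_incident.1 hev').2
      tauto

lemma IsRootedInstance.card_incident_ne_one (hI : IsRootedInstance x y A v S R p col k)
    (htight : ∀ e ∈ A, ∃ X, IsTight x y A v S k X ∧ e ∈ crossing x y A X) {u : V} (hu : u ∉ S)
    (huv : u ≠ v) : (incident x y A u).card ≠ 1 := by
  intro hc
  obtain ⟨e, he⟩ := Finset.card_eq_one.1 hc
  have heu : e ∈ incident x y A u := by simp [he]
  have huniq : ∀ f ∈ A, x f = u ∨ y f = u → f = e := by
    intro f hf h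
    have : f ∈ incident x y A u := mem_incident.2 ⟨hf, h⟩
    simpa [he] using this
  obtain ⟨heA, hends⟩ := mem_incident.1 heu
  have hne := hI.loopless e heA
  obtain ⟨X, hX, heX⟩ := htight e heA
  have heX' := (mem_crossing.1 heX).2
  obtain ⟨s, hs⟩ := hX.meets
  rw [Finset.mem_inter] at hs
  have hsu : s ≠ u := fun h => hu (h ▸ hs.2)
  have key : ∀ Y : Finset V, (∀ w, w ≠ u → (w ∈ Y ↔ w ∈ X)) → (u ∈ Y ↔ u ∉ X) → False := by
    intro Y hY huY
    have h1 := hI.cut Y (fun h => hX.root_notMem ((hY v huv.symm).1 h))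
      ⟨s, Finset.mem_inter.2 ⟨(hY s hsu).2 hs.1, hs.2⟩⟩ (by
        refine hX.proper.imp_left fun h h' => h fun t ht => ?_
        exact (hY t fun h'' => hu (h'' ▸ ht)).1 (h' ht))
    have h2 : (crossing x y A Y).card < (crossing x y A X).card := by
      refine Finset.card_lt_card ⟨fun f hf => ?_, fun h => ?_⟩
      · rw [mem_crossing] at hf ⊢
        refine ⟨hf.1, ?_⟩
        by_cases hfe : f = e
        · rw [hfe]; exact heX'
        · have h3 : ¬ (x f = u ∨ y f = u) := fun h => hfe (huniq f hf.1 h)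
          push Not at h3
          rw [← hY _ h3.1, ← hY _ h3.2]
          exact hf.2
      · have h3 := (mem_crossing.1 (h heX)).2
        rcases hends with h4 | h4
        · rw [h4, huY, hY _ (fun h => hne (h4.trans h.symm))] at h3
          rw [h4] at heX'
          tauto
        · rw [h4, huY, hY _ (fun h => hne (h.trans h4.symm))] at h3
          rw [h4] at heX'
          tauto
    rw [hX.card_eq] at h2
    omega
  by_cases huX : u ∈ X
  · exact key (X.erase u) (fun w hw => by simp [hw]) (by simp [huX])
  · exact key (insert u X) (fun w hw => by simp [hw]) (by simp [huX])

variable [DecidableEq E]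

/-- An edge in no tight cut can be deleted and recorded as unused. -/
lemma IsRootedInstance.erase [Fintype V] (hI : IsRootedInstance x y A v S R p col k) {e : E}
    (hnot : ∀ X, IsTight x y A v S k X → e ∉ crossing x y A X) :
    e ∉ incident x y A v ∧ IsRootedInstance x y (A.erase e) v S R
      (fun u => p u + if e ∈ incident x y A u then 1 else 0) col k := by
  have hev : e ∉ incident x y A v := by
    intro h
    rcases hI.root_degree with hd | hd
    · have hc : crossing x y A (Finset.univ.erase v) = incident x y A v := by
        refine Finset.filter_congr fun f hf => ?_
        have := hI.loopless f hf
        simp only [Finset.mem_erase, Finset.mem_univ, and_true]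
        grind
      refine hnot (Finset.univ.erase v) ⟨by simp, ?_, Or.inr hd, by rw [hc, hd]⟩ (by rwa [hc])
      obtain ⟨s, hs⟩ := hI.nonempty
      exact ⟨s, by simpa [hs] using fun h : s = v => hI.root_notMem (h ▸ hs)⟩
    · rw [Finset.card_eq_zero] at hd
      rw [hd.1] at h
      simp at h
  have hinc : ∀ u, (incident x y (A.erase e) u) = (incident x y A u).erase e := fun u =>
    Finset.filter_erase _ _ _
  have hincv : incident x y (A.erase e) v = incident x y A v := by
    rw [hinc, Finset.erase_eq_of_notMem hev]
  refine ⟨hev, ⟨fun f hf => hI.loopless f (Finset.mem_of_mem_erase hf), hI.root_notMem,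
    hI.nonempty, hI.pos, ?_, ?_, ?_, ?_⟩⟩
  · rw [hincv]; exact hI.root_degree
  · intro X h1 h2 h3
    rw [hincv] at h3
    have h4 := hI.cut X h1 h2 h3
    have h5 : crossing x y (A.erase e) X = (crossing x y A X).erase e := Finset.filter_erase _ _ _
    rw [h5]
    by_cases h6 : e ∈ crossing x y A X
    · rw [Finset.card_erase_of_mem h6]
      have : (crossing x y A X).card ≠ 36 * k := fun h => hnot X ⟨h1, h2, h3, h⟩ h6
      omega
    · rwa [Finset.erase_eq_of_notMem h6]
  · rw [hincv]; exact hI.colored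
  · intro r hr
    obtain ⟨h1, h2, h3⟩ := hI.reserve r hr
    refine ⟨h1, h2, ?_⟩
    rw [hinc]
    split_ifs with h
    · rw [Finset.card_erase_of_mem h]
      omega
    · rw [Finset.erase_eq_of_notMem h]
      omega

lemma IsExtension.of_erase {h : E → ℕ} {e : E} (hev : e ∉ incident x y A v)
    (hh : IsExtension x y (A.erase e) v S R
      (fun u => p u + if e ∈ incident x y A u then 1 else 0) col k h) :
    IsExtension x y A v S R p col k h := by
  have hinc : ∀ u, (incident x y (A.erase e) u) = (incident x y A u).erase e := fun u =>
    Finset.filter_erase _ _ _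
  have hek : k ≤ h e := by
    by_contra hlt
    have := hh.mem e (by omega)
    simp at this
  refine ⟨fun f hf => Finset.mem_of_mem_erase (hh.mem f hf), ?_, hh.linked, ?_, ?_, ?_⟩
  · intro f hf
    refine hh.root f ?_
    rw [hinc]
    exact Finset.mem_erase.2 ⟨fun h => hev (h ▸ hf), hf⟩
  · intro f hf hfk
    exact hh.attached f (hh.mem f hfk) hfk
  · intro s hs
    refine (hh.unused s hs).trans (Finset.card_le_card (Finset.filter_subset_filter _ ?_))
    rw [hinc]
    exact Finset.erase_subset _ _
  · intro r hr
    have h1 := hh.reserved r hr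
    rw [hinc, Finset.filter_erase] at h1
    split_ifs at h1 with h2
    · have h3 : e ∈ (incident x y A r).filter fun e => k ≤ h e := Finset.mem_filter.2 ⟨h2, hek⟩
      rw [Finset.card_erase_of_mem h3] at h1
      have := Finset.card_pos.2 ⟨e, h3⟩
      omega
    · rw [Finset.erase_eq_of_notMem fun h3 => h2 (Finset.mem_filter.1 h3).1] at h1
      omega

end Tight

section Contraction

variable [DecidableEq V]

/-- The map contracting `X` to the vertex `a`. -/
def contract (X : Finset V) (a : V) (u : V) : V := if u ∈ X then a else u

/-- The map contracting the complement of `X` to the vertex `v`. -/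
def contractCompl (X : Finset V) (v : V) (u : V) : V := if u ∈ X then u else v

variable {x y : E → V} {A : Finset E} {v : V} {S R : Finset V} {p : V → ℕ} {col : E → ℕ} {k : ℕ}
  {X : Finset V} {a : V}

lemma incident_contract (ha : a ∈ X) {u : V} (hu : u ∉ X) :
    incident (contract X a ∘ x) (contract X a ∘ y) (A.filter fun e => ¬ (x e ∈ X ∧ y e ∈ X)) u
      = incident x y A u := by
  ext e
  simp only [mem_incident, Finset.mem_filter, Function.comp, contract]
  grind

lemma incident_contract_self (ha : a ∈ X) :
    incident (contract X a ∘ x) (contract X a ∘ y) (A.filter fun e => ¬ (x e ∈ X ∧ y e ∈ X)) a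
      = crossing x y A X := by
  ext e
  simp only [mem_incident, mem_crossing, Finset.mem_filter, Function.comp, contract]
  grind

lemma incident_contractCompl (hv : v ∉ X) {u : V} (hu : u ∈ X) :
    incident (contractCompl X v ∘ x) (contractCompl X v ∘ y)
      (A.filter fun e => x e ∈ X ∨ y e ∈ X) u = incident x y A u := by
  ext e
  simp only [mem_incident, Finset.mem_filter, Function.comp, contractCompl]
  grind

lemma incident_contractCompl_self (hv : v ∉ X) :
    incident (contractCompl X v ∘ x) (contractCompl X v ∘ y)
      (A.filter fun e => x e ∈ X ∨ y e ∈ X) v = crossing x y A X := by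
  ext e
  simp only [mem_incident, mem_crossing, Finset.mem_filter, Function.comp, contractCompl]
  grind

lemma IsRootedInstance.contract [Fintype V] (hI : IsRootedInstance x y A v S R p col k)
    (hX : IsTight x y A v S k X) (ha : a ∈ X) (haS : a ∈ S) :
    IsRootedInstance (contract X a ∘ x) (contract X a ∘ y)
      (A.filter fun e => ¬ (x e ∈ X ∧ y e ∈ X)) v (insert a (S \ X)) (R \ X) p col k := by
  have hv := hX.root_notMem
  have hva : v ≠ a := fun h => hv (h ▸ ha)
  refine ⟨?_, ?_, Finset.insert_nonempty _ _, hI.pos, ?_, ?_, ?_, ?_⟩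
  · intro e he
    obtain ⟨h1, h2⟩ := Finset.mem_filter.1 he
    have := hI.loopless e h1
    simp only [Function.comp, SteinerPacking.contract]
    grind
  · simp [hva, hI.root_notMem]
  · rw [incident_contract ha hv]
    rcases hX.proper with h | h
    · refine hI.root_degree.imp_right fun h' => ⟨h'.1, ?_⟩
      obtain ⟨s, hs, hsX⟩ := Finset.not_subset.1 h
      rw [Finset.card_insert_of_notMem (by simp [ha])]
      have := Finset.card_pos.2 ⟨s, Finset.mem_sdiff.2 ⟨hs, hsX⟩⟩
      omega
    · exact Or.inl h
  · intro Y hvY hYS hproper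
    rw [incident_contract ha hv] at hproper
    have hq : ∀ t ∈ insert a (S \ X), t ∈ S ∧ SteinerPacking.contract X a t = t := by
      intro t ht
      rcases Finset.mem_insert.1 ht with rfl | ht
      · exact ⟨haS, if_pos ha⟩
      · rw [Finset.mem_sdiff] at ht
        exact ⟨ht.1, if_neg ht.2⟩
    have hmem : ∀ u, u ∈ (Finset.univ.filter fun u => SteinerPacking.contract X a u ∈ Y) ↔
        SteinerPacking.contract X a u ∈ Y := by simp
    have h1 := hI.cut (Finset.univ.filter fun u => SteinerPacking.contract X a u ∈ Y) (by
      rw [hmem, SteinerPacking.contract, if_neg hv]; exact hvY) (by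
      obtain ⟨t, ht⟩ := hYS
      rw [Finset.mem_inter] at ht
      obtain ⟨h1, h2⟩ := hq t ht.2
      exact ⟨t, Finset.mem_inter.2 ⟨(hmem t).2 (h2.symm ▸ ht.1), h1⟩⟩) (by
      refine hproper.imp_left fun h h' => h fun t ht => ?_
      obtain ⟨h1, h2⟩ := hq t ht
      have := (hmem t).1 (h' h1)
      rwa [h2] at this)
    refine h1.trans (Finset.card_le_card fun e he => ?_)
    rw [mem_crossing, hmem, hmem] at he
    rw [mem_crossing, Finset.mem_filter]
    refine ⟨⟨he.1, fun h => he.2 ?_⟩, he.2⟩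
    simp only [SteinerPacking.contract, if_pos h.1, if_pos h.2]
  · rw [incident_contract ha hv]; exact hI.colored
  · intro r hr
    rw [Finset.mem_sdiff] at hr
    obtain ⟨h1, h2, h3⟩ := hI.reserve r hr.1
    rw [incident_contract ha hr.2]
    refine ⟨?_, h2, h3⟩
    rw [Finset.mem_insert, Finset.mem_sdiff]
    rintro (rfl | h)
    · exact h1 haS
    · exact h1 h.1

lemma IsRootedInstance.contractCompl (hI : IsRootedInstance x y A v S R p col k)
    (hX : IsTight x y A v S k X) {h : E → ℕ}
    (hunused : 3 * k ≤ ((crossing x y A X).filter fun e => k ≤ h e).card) :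
    IsRootedInstance (contractCompl X v ∘ x) (contractCompl X v ∘ y)
      (A.filter fun e => x e ∈ X ∨ y e ∈ X) v (S ∩ X) (R ∩ X) p h k := by
  have hv := hX.root_notMem
  refine ⟨?_, ?_, ?_, hI.pos, ?_, ?_, ?_, ?_⟩
  · intro e he
    obtain ⟨h1, h2⟩ := Finset.mem_filter.1 he
    have := hI.loopless e h1
    simp only [Function.comp, SteinerPacking.contractCompl]
    grind
  · simp [hv]
  · rw [Finset.inter_comm]; exact hX.meets
  · rw [incident_contractCompl_self hv]
    exact Or.inl hX.card_eq
  · intro Y hvY hYS _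
    have h1 := hI.cut (Y ∩ X) (by simp [hv]) (by
      rwa [Finset.inter_assoc, Finset.inter_comm X]) (by
      exact hX.proper.imp_left fun h h' => h (h'.trans Finset.inter_subset_right))
    refine h1.trans (Finset.card_le_card fun e he => ?_)
    simp only [mem_crossing, Finset.mem_filter, Function.comp, SteinerPacking.contractCompl,
      Finset.mem_inter] at he ⊢
    grind
  · rw [incident_contractCompl_self hv]
    have h1 := Finset.card_filter_add_card_filter_not (s := crossing x y A X) (fun e => h e < k)
    simp only [not_lt] at h1
    have := hX.card_eq
    omega
  · intro r hr
    rw [Finset.mem_inter] at hr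
    obtain ⟨h1, h2, h3⟩ := hI.reserve r hr.1
    rw [incident_contractCompl hv hr.2]
    exact ⟨fun h => h1 (Finset.mem_inter.1 h).1, h2, h3⟩

/-- Extensions of the two contractions of a tight set that agree on its cut can be glued. -/
lemma IsExtension.glue (hv : v ∉ X) (ha : a ∈ X) (haS : a ∈ S) {h1 h2 : E → ℕ}
    (hh1 : IsExtension (contract X a ∘ x) (contract X a ∘ y)
      (A.filter fun e => ¬ (x e ∈ X ∧ y e ∈ X)) v (insert a (S \ X)) (R \ X) p col k h1)
    (hh2 : IsExtension (contractCompl X v ∘ x) (contractCompl X v ∘ y)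
      (A.filter fun e => x e ∈ X ∨ y e ∈ X) v (S ∩ X) (R ∩ X) p h1 k h2) :
    IsExtension x y A v S R p col k (fun e => if x e ∈ X ∧ y e ∈ X then h2 e else h1 e) := by
  obtain ⟨h, hh⟩ : ∃ h : E → ℕ, ∀ e, h e = if x e ∈ X ∧ y e ∈ X then h2 e else h1 e :=
    ⟨_, fun _ => rfl⟩
  rw [← funext hh]
  have hva : v ≠ a := fun h => hv (h ▸ ha)
  have hc : ∀ u ∈ X, contract X a u = a := fun u hu => if_pos hu
  have hc' : ∀ u ∉ X, contract X a u = u := fun u hu => if_neg hu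
  have hcc : ∀ u ∈ X, contractCompl X v u = u := fun u hu => if_pos hu
  have hcc' : ∀ u ∉ X, contractCompl X v u = v := fun u hu => if_neg hu
  have e1 : ∀ e, ¬ (x e ∈ X ∧ y e ∈ X) → h e = h1 e := fun e he => by rw [hh, if_neg he]
  have e2 : ∀ e ∈ A, (x e ∈ X ∨ y e ∈ X) → h e = h2 e := by
    intro e heA he
    rw [hh]
    split_ifs with hin
    · rfl
    · refine (hh2.root e ?_).symm
      rw [incident_contractCompl_self hv, mem_crossing]
      exact ⟨heA, by tauto⟩
  have hmem : ∀ e, h e < k → e ∈ A := by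
    intro e he
    rw [hh] at he
    split_ifs at he
    · exact (Finset.mem_filter.1 (hh2.mem e he)).1
    · exact (Finset.mem_filter.1 (hh1.mem e he)).1
  have lift2 : ∀ i < k, ∀ s t, Linked (contractCompl X v ∘ x) (contractCompl X v ∘ y)
      (fun e => h2 e = i ∧ (contractCompl X v ∘ x) e ≠ v ∧ (contractCompl X v ∘ y) e ≠ v) s t →
      Linked x y (fun e => h e = i ∧ x e ≠ v ∧ y e ≠ v) s t := by
    intro i hi s t hst
    refine Linked.lift id (fun e he => ?_) hst
    obtain ⟨he, hx, hy⟩ := he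
    simp only [Function.comp] at hx hy
    have hx' : x e ∈ X := by by_contra h; exact hx (hcc' _ h)
    have hy' : y e ∈ X := by by_contra h; exact hy (hcc' _ h)
    simp only [Function.comp, hcc _ hx', hcc _ hy', id]
    rw [hcc _ hx'] at hx
    rw [hcc _ hy'] at hy
    have heA := (Finset.mem_filter.1 (hh2.mem e (by omega))).1
    exact Linked.of_edge (B := fun e => h e = i ∧ x e ≠ v ∧ y e ≠ v)
      ⟨(e2 e heA (Or.inl hx')).trans he, hx, hy⟩
  have link2 : ∀ i < k, ∀ s ∈ S ∩ X, Linked x y (fun e => h e = i ∧ x e ≠ v ∧ y e ≠ v) a s :=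
    fun i hi s hs => lift2 i hi a s
      (hh2.linked i hi a (Finset.mem_inter.2 ⟨haS, ha⟩) s hs)
  have att : ∀ e ∈ A, h1 e < k → ∀ u ∈ X, (x e ∉ X ∧ y e = u) ∨ (x e = u ∧ y e ∉ X) →
      Linked x y (fun f => h f = h1 e ∧ x f ≠ v ∧ y f ≠ v) a u := by
    intro e heA hek u hu hxy
    have hin : ¬ (x e ∈ X ∧ y e ∈ X) := by tauto
    have hor : x e ∈ X ∨ y e ∈ X := by
      rcases hxy with h | h
      · exact Or.inr (h.2 ▸ hu)
      · exact Or.inl (h.1 ▸ hu)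
    have h12 : h2 e = h1 e := (e2 e heA hor).symm.trans (e1 e hin)
    obtain ⟨s, hs, hus⟩ := hh2.attached e (Finset.mem_filter.2 ⟨heA, hor⟩) (by omega) u (by
      rcases hxy with h | h
      · left; exact ⟨hcc' _ h.1, by simp only [Function.comp, h.2]; exact hcc u hu⟩
      · right; exact ⟨by simp only [Function.comp, h.1]; exact hcc u hu, hcc' _ h.2⟩)
    rw [h12] at hus
    exact (link2 _ hek s hs).trans (lift2 _ hek u s hus).symm
  have lift1 : ∀ i < k, ∀ s t, Linked (contract X a ∘ x) (contract X a ∘ y)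
      (fun e => h1 e = i ∧ (contract X a ∘ x) e ≠ v ∧ (contract X a ∘ y) e ≠ v) s t →
      Linked x y (fun e => h e = i ∧ x e ≠ v ∧ y e ≠ v) s t := by
    intro i hi s t hst
    refine Linked.lift id (fun e he => ?_) hst
    obtain ⟨he, hx, hy⟩ := he
    obtain ⟨heA, hin⟩ := Finset.mem_filter.1 (hh1.mem e (by omega))
    simp only [Function.comp, id] at hx hy ⊢
    have hxv : x e ≠ v := fun h => hx (by rw [h, hc' _ hv])
    have hyv : y e ≠ v := fun h => hy (by rw [h, hc' _ hv])
    have hB := Linked.of_edge (x := x) (y := y) (B := fun e => h e = i ∧ x e ≠ v ∧ y e ≠ v)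
      (e := e) ⟨(e1 e hin).trans he, hxv, hyv⟩
    by_cases hxX : x e ∈ X
    · have hyX : y e ∉ X := fun h => hin ⟨hxX, h⟩
      rw [hc _ hxX, hc' _ hyX]
      have := att e heA (by omega) (x e) hxX (Or.inr ⟨rfl, hyX⟩)
      rw [he] at this
      exact this.trans hB
    · rw [hc' _ hxX]
      by_cases hyX : y e ∈ X
      · rw [hc _ hyX]
        have := att e heA (by omega) (y e) hyX (Or.inl ⟨hxX, rfl⟩)
        rw [he] at this
        exact hB.trans this.symm
      · rwa [hc' _ hyX]
  refine ⟨hmem, ?_, ?_, ?_, ?_, ?_⟩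
  · intro e he
    rw [← incident_contract ha hv] at he
    rw [e1 e (Finset.mem_filter.1 (mem_incident.1 he).1).2]
    exact hh1.root e he
  · intro i hi s hs s' hs'
    have key : ∀ t ∈ S, ∃ t' ∈ insert a (S \ X),
        Linked x y (fun e => h e = i ∧ x e ≠ v ∧ y e ≠ v) t t' := by
      intro t ht
      by_cases htX : t ∈ X
      · exact ⟨a, Finset.mem_insert_self _ _,
          (link2 i hi t (Finset.mem_inter.2 ⟨ht, htX⟩)).symm⟩
      · exact ⟨t, Finset.mem_insert_of_mem (Finset.mem_sdiff.2 ⟨ht, htX⟩),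
          Relation.ReflTransGen.refl⟩
    obtain ⟨t, ht, hst⟩ := key s hs
    obtain ⟨t', ht', hst'⟩ := key s' hs'
    exact hst.trans ((lift1 i hi t t' (hh1.linked i hi t ht t' ht')).trans hst'.symm)
  · intro e heA hek u hu
    have hin : ¬ (x e ∈ X ∧ y e ∈ X) := by
      rintro ⟨h, h'⟩
      rcases hu with hu | hu
      · exact hv (hu.1 ▸ h)
      · exact hv (hu.2 ▸ h')
    rw [e1 e hin] at hek ⊢
    obtain ⟨s, hs, hus⟩ := hh1.attached e (Finset.mem_filter.2 ⟨heA, hin⟩) hek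
      (contract X a u) (by
        rcases hu with hu | hu
        · left; simp only [Function.comp, hu, hc' _ hv, and_self]
        · right; simp only [Function.comp, hu, hc' _ hv, and_self])
    have hsS : s ∈ S := by
      rcases Finset.mem_insert.1 hs with rfl | hs
      · exact haS
      · exact (Finset.mem_sdiff.1 hs).1
    refine ⟨s, hsS, ?_⟩
    have h3 := lift1 _ hek _ _ hus
    by_cases huX : u ∈ X
    · rw [hc _ huX] at h3
      refine (att e heA hek u huX ?_).symm.trans h3
      rcases hu with hu | hu
      · exact Or.inl ⟨hu.1 ▸ hv, hu.2⟩
      · exact Or.inr ⟨hu.1, hu.2 ▸ hv⟩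
    · rwa [hc' _ huX] at h3
  · intro s hs
    by_cases hsX : s ∈ X
    · have h3 := hh2.unused s (Finset.mem_inter.2 ⟨hs, hsX⟩)
      rw [incident_contractCompl hv hsX] at h3
      refine h3.trans (Finset.card_le_card fun e he => ?_)
      rw [Finset.mem_filter] at he ⊢
      obtain ⟨heA, hes⟩ := mem_incident.1 he.1
      rw [e2 e heA (by rcases hes with h | h <;> simp [h, hsX])]
      exact he
    · have h3 := hh1.unused s (Finset.mem_insert_of_mem (Finset.mem_sdiff.2 ⟨hs, hsX⟩))
      rw [incident_contract ha hsX] at h3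
      refine h3.trans (Finset.card_le_card fun e he => ?_)
      rw [Finset.mem_filter] at he ⊢
      obtain ⟨heA, hes⟩ := mem_incident.1 he.1
      rw [e1 e (by rcases hes with h | h <;> simp [h, hsX])]
      exact he
  · intro s hs
    by_cases hsX : s ∈ X
    · have h3 := hh2.reserved s (Finset.mem_inter.2 ⟨hs, hsX⟩)
      rw [incident_contractCompl hv hsX] at h3
      refine h3.trans (Nat.add_le_add_right (Finset.card_le_card fun e he => ?_) _)
      rw [Finset.mem_filter] at he ⊢
      obtain ⟨heA, hes⟩ := mem_incident.1 he.1
      rw [e2 e heA (by rcases hes with h | h <;> simp [h, hsX])]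
      exact he
    · have h3 := hh1.reserved s (Finset.mem_sdiff.2 ⟨hs, hsX⟩)
      rw [incident_contract ha hsX] at h3
      refine h3.trans (Nat.add_le_add_right (Finset.card_le_card fun e he => ?_) _)
      rw [Finset.mem_filter] at he ⊢
      obtain ⟨heA, hes⟩ := mem_incident.1 he.1
      rw [e1 e (by rcases hes with h | h <;> simp [h, hsX])]
      exact he

variable [DecidableEq E] [Fintype V]

/-- Every rooted instance has an extension of its root coloring. -/
theorem exists_extension (n : ℕ) : ∀ (x y : E → V) (A : Finset E) (v : V) (S R : Finset V)
    (p : V → ℕ) (col : E → ℕ), A.card = n → IsRootedInstance x y A v S R p col k →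
    ∃ h, IsExtension x y A v S R p col k h := by
  induction n using Nat.strong_induction_on with
  | _ n ih =>
  intro x y A v S R p col hn hI
  by_cases hdel : ∃ e ∈ A, ∀ X, IsTight x y A v S k X → e ∉ crossing x y A X
  · obtain ⟨e, he, hnot⟩ := hdel
    obtain ⟨hev, hI'⟩ := hI.erase hnot
    obtain ⟨h, hh⟩ := ih _ (by
      rw [← hn]; exact Finset.card_erase_lt_of_mem he) _ _ _ _ _ _ _ _ rfl hI'
    exact ⟨h, hh.of_erase hev⟩
  push Not at hdel
  by_cases hcon : ∃ X, IsTight x y A v S k X ∧ (∃ e ∈ A, x e ∈ X ∧ y e ∈ X) ∧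
      ∃ e ∈ A, x e ∉ X ∧ y e ∉ X
  · obtain ⟨X, hX, ⟨e1, he1, hin⟩, e2, he2, hout⟩ := hcon
    obtain ⟨a, ha⟩ := hX.meets
    obtain ⟨haX, haS⟩ := Finset.mem_inter.1 ha
    obtain ⟨h1, hh1⟩ := ih _ (by
      rw [← hn]
      exact Finset.card_lt_card (Finset.filter_ssubset.2 ⟨e1, he1, not_not.2 hin⟩)) _ _ _ _ _ _ _ _
      rfl (hI.contract hX haX haS)
    have hun := hh1.unused a (Finset.mem_insert_self _ _)
    rw [incident_contract_self haX] at hun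
    obtain ⟨h2, hh2⟩ := ih _ (by
      rw [← hn]
      exact Finset.card_lt_card (Finset.filter_ssubset.2 ⟨e2, he2, by tauto⟩)) _ _ _ _ _ _ _ _
      rfl (hI.contractCompl hX hun)
    exact ⟨_, hh1.glue hX.root_notMem haX haS hh2⟩
  push Not at hcon
  refine exists_extension_of_independent hI ?_ fun u hu huv => hI.card_incident_ne_one hdel hu huv
  intro e he
  obtain ⟨X, hX, heX⟩ := hdel e (Finset.mem_filter.1 he).1
  refine hI.mem_or_mem hX ?_ he heX
  by_cases hin : ∃ e ∈ A, x e ∈ X ∧ y e ∈ X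
  · right
    intro f hf hfx
    by_contra hfy
    exact hfy (hcon X hX hin f hf hfx)
  · push Not at hin
    exact Or.inl hin

end Contraction

section Balance

lemma IsWalk.exists_crossing {ends : E → Sym2 V} {a b : V} {l : List E} (h : IsWalk ends a b l)
    (X : Set V) (ha : a ∈ X) (hb : b ∉ X) : ∃ e ∈ l, ∃ c ∈ X, ∃ d ∉ X, ends e = s(c, d) := by
  induction h with
  | nil v => exact absurd ha hb
  | @cons u v w e l he _ ih =>
    by_cases hv : v ∈ X
    · obtain ⟨f, hf, h⟩ := ih hv hb
      exact ⟨f, List.mem_cons_of_mem _ hf, h⟩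
    · exact ⟨e, List.mem_cons_self, u, ha, v, hv, he⟩

/-- The easy direction of Menger's theorem. -/
lemma EdgeDisjointPathsIn.le_card [DecidableEq E] {ends : E → Sym2 V} {F : Set E} {n : ℕ} {a b : V}
    (h : EdgeDisjointPathsIn ends F n a b) (X : Set V) (ha : a ∈ X) (hb : b ∉ X) (C : Finset E)
    (hC : ∀ e, ∀ c ∈ X, ∀ d ∉ X, ends e = s(c, d) → e ∈ C) : n ≤ C.card := by
  obtain ⟨P, hP, hdisj⟩ := h
  have : ∀ i, ∃ e ∈ P i, e ∈ C := by
    intro i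
    obtain ⟨e, he, c, hc, d, hd, hcd⟩ := (hP i).1.exists_crossing X ha hb
    exact ⟨e, he, hC e c hc d hd hcd⟩
  choose f hf hfC using this
  have hinj : Function.Injective f := by
    intro i j hij
    by_contra hne
    exact hdisj i j hne (f i) (hf i) (hij ▸ hf j)
  calc n = (Finset.univ.image f).card := by
        rw [Finset.card_image_of_injective _ hinj, Finset.card_univ, Fintype.card_fin]
    _ ≤ C.card := Finset.card_le_card fun e he => by
        obtain ⟨i, -, rfl⟩ := Finset.mem_image.1 he
        exact hfC i

/-- Disjoint subgraphs balance a vertex incident to sufficiently many unused edges. -/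
lemma balanceVertex_of_unused [Fintype E] {ends : E → Sym2 V} {k : ℕ} (hk : 0 < k)
    {H : Fin k → Set E} (hH : PairwiseEdgeDisjoint H) {u : V} {U : Finset E}
    (hU : ∀ e ∈ U, e ∈ incEdges ends u ∧ ∀ i, e ∉ H i) (hc : 2 * k ≤ U.card) :
    BalanceVertex ends H u := by
  classical
  obtain ⟨f⟩ : Nonempty (Fin k × Fin 2 ↪ U) := Function.Embedding.nonempty_of_card_le (by
    simp only [Fintype.card_prod, Fintype.card_fin, Fintype.card_coe]; omega)
  have hinj : ∀ a b, (f a : E) = f b → a = b := fun a b h => f.injective (Subtype.ext h)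
  obtain ⟨g, hg⟩ : ∃ g : E → Fin k, ∀ a, g (f a) = a.1 := by
    refine ⟨fun e => if h : ∃ a, (f a : E) = e then h.choose.1 else ⟨0, hk⟩, fun a => ?_⟩
    have h : ∃ b, (f b : E) = f a := ⟨a, rfl⟩
    beta_reduce
    rw [dif_pos h, hinj _ _ h.choose_spec]
  refine ⟨⟨fun i => Set.inter_subset_left, fun i j hij => ?_⟩,
    fun i => (incEdges ends u ∩ H i) ∪ {e | e ∈ incEdges ends u ∧ (∀ j, e ∉ H j) ∧ g e = i},
    ⟨⟨fun i => ?_, fun i j hij => ?_⟩, ?_, fun i => ?_⟩, fun i => Set.subset_union_left⟩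
  · exact (hH i j hij).mono Set.inter_subset_right Set.inter_subset_right
  · rintro e (he | he)
    · exact he.1
    · exact he.1
  · refine Set.disjoint_left.2 ?_
    rintro e (he | he) (he' | he')
    · exact Set.disjoint_left.1 (hH i j hij) he.2 he'.2
    · exact he'.2.1 i he.2
    · exact he.2.1 j he'.2
    · exact hij (he.2.2.symm.trans he'.2.2)
  · ext e
    rw [Set.mem_iUnion]
    constructor
    · rintro ⟨i, he | he⟩
      · exact he.1
      · exact he.1
    · intro he
      by_cases h : ∃ i, e ∈ H i
      · obtain ⟨i, hi⟩ := h
        exact ⟨i, Or.inl ⟨he, hi⟩⟩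
      · push Not at h
        exact ⟨g e, Or.inr ⟨he, h, rfl⟩⟩
  · have hsub : ({(f (i, 0) : E), (f (i, 1) : E)} : Set E) ⊆
        (incEdges ends u ∩ H i) ∪ {e | e ∈ incEdges ends u ∧ (∀ j, e ∉ H j) ∧ g e = i} := by
      intro e he
      rcases he with rfl | rfl
      · exact Or.inr ⟨(hU _ (f (i, 0)).2).1, (hU _ (f (i, 0)).2).2, hg _⟩
      · exact Or.inr ⟨(hU _ (f (i, 1)).2).1, (hU _ (f (i, 1)).2).2, hg _⟩
    refine le_trans (le_of_eq ?_) (Set.ncard_le_ncard hsub (Set.toFinite _))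
    rw [Set.ncard_pair]
    intro h
    simpa using hinj _ _ h

end Balance

/-- Let `G` be a multigraph that may admit self-loops,
`S, R ⊆ V(G)` with `S ∩ R = ∅`, `|S| ≥ 2`, `S` being `36k`-edge-connected and
every vertex of `R` incident to at least `34k` edges.  Then there exist `k`
pairwise edge-disjoint `S`-subgraphs of `G` that balance `S ∪ R`. -/
theorem base_case_packing {V E : Type} [Fintype V] [Fintype E]
    (ends : E → Sym2 V) (k : ℕ) (hk : 0 < k)
    (S R : Set V) (hSR : Disjoint S R) (hS : 2 ≤ S.ncard)
    (hconn : EdgeConnectedIn ends Set.univ S (36 * k))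
    (hR : ∀ r ∈ R, 34 * k ≤ deg ends r) :
    ∃ H : Fin k → Set E, PairwiseEdgeDisjoint H ∧
      (∀ i, ConnectsSet ends (H i) S) ∧
      BalanceSet ends H (S ∪ R) := by
  classical
  have hrep : ∀ e, ∃ a b, ends e = s(a, b) := fun e =>
    Sym2.ind (f := fun z => ∃ a b, z = s(a, b)) (fun a b => ⟨a, b, rfl⟩) (ends e)
  choose x y hxy using hrep
  have hinc : ∀ e u, e ∈ incEdges ends u ↔ x e = u ∨ y e = u := by
    intro e u
    change u ∈ ends e ↔ _
    rw [hxy, Sym2.mem_iff, eq_comm, @eq_comm _ u]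
  let x' : E → Option V := fun e => some (x e)
  let y' : E → Option V := fun e => some (y e)
  let A : Finset E := Finset.univ.filter fun e => x e ≠ y e
  let loops : V → Finset E := fun u => Finset.univ.filter fun e => x e = u ∧ y e = u
  let p : Option V → ℕ := fun w => w.elim 0 fun u => (loops u).card
  let S' : Finset (Option V) := S.toFinset.image some
  let R' : Finset (Option V) := R.toFinset.image some
  have hS' : ∀ w, w ∈ S' ↔ ∃ s ∈ S, some s = w := fun w => by simp [S']
  have hR' : ∀ w, w ∈ R' ↔ ∃ s ∈ R, some s = w := fun w => by simp [R']
  have hA : ∀ e, e ∈ A ↔ x e ≠ y e := fun e => by simp [A]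
  have hiA : ∀ e u, e ∈ incident x' y' A (some u) ↔ x e ≠ y e ∧ (x e = u ∨ y e = u) := by
    intro e u
    rw [mem_incident, hA]
    simp only [x', y', Option.some_inj]
  have hnone : incident x' y' A none = ∅ :=
    Finset.filter_eq_empty_iff.2 fun e _ h => by simp [x', y'] at h
  have hScard : 2 ≤ S'.card := by
    rw [Finset.card_image_of_injective _ (Option.some_injective V), ← Set.ncard_eq_toFinset_card']
    exact hS
  have hI : IsRootedInstance x' y' A none S' R' p (fun _ => k) k := by
    refine ⟨?_, ?_, Finset.card_pos.1 (by omega), hk, Or.inr ⟨by rw [hnone]; rfl, hScard⟩, ?_, ?_,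
      ?_⟩
    · intro e he h
      exact (hA e).1 he (Option.some_injective V h)
    · rw [hS']; simp
    · intro X hX hXS hproper
      rw [hnone, Finset.card_empty] at hproper
      obtain ⟨w, hw, hwX⟩ := Finset.not_subset.1 (hproper.resolve_right (by omega))
      obtain ⟨z, hz⟩ := hXS
      rw [Finset.mem_inter, hS'] at hz
      obtain ⟨hzX, s, hs, rfl⟩ := hz
      obtain ⟨t, ht, rfl⟩ := (hS' w).1 hw
      refine (hconn s hs t ht fun h => hwX (h ▸ hzX)).le_card {u | some u ∈ X} hzX hwX _ ?_
      intro e c hc d hd hcd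
      rw [hxy, Sym2.eq_iff] at hcd
      rw [mem_crossing, hA]
      change some c ∈ X at hc
      change some d ∉ X at hd
      have hne : c ≠ d := fun h => hd (h ▸ hc)
      rcases hcd with ⟨h1, h2⟩ | ⟨h1, h2⟩
      · simp only [x', y', h1, h2]
        exact ⟨hne, by tauto⟩
      · simp only [x', y', h1, h2]
        exact ⟨hne.symm, by tauto⟩
    · rw [hnone]; simp
    · intro w hw
      obtain ⟨r, hr, rfl⟩ := (hR' w).1 hw
      refine ⟨?_, by simp, ?_⟩
      · rw [hS']
        rintro ⟨s, hs, h⟩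
        rw [Option.some_inj] at h
        exact Set.disjoint_left.1 hSR (h ▸ hs) hr
      · refine (hR r hr).trans ?_
        have hsub : incEdges ends r ⊆ ↑(incident x' y' A (some r) ∪ loops r) := by
          intro e he
          rw [hinc] at he
          rw [Finset.mem_coe, Finset.mem_union, hiA]
          by_cases h : x e = y e
          · right
            rw [h, or_self] at he
            simp [loops, h, he]
          · exact Or.inl ⟨h, he⟩
        refine (Set.ncard_le_ncard hsub (Finset.finite_toSet _)).trans ?_
        rw [Set.ncard_coe_finset]
        exact Finset.card_union_le _ _
  obtain ⟨h, hh⟩ := exists_extension A.card x' y' A none S' R' p (fun _ => k) rfl hI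
  have hdisj : PairwiseEdgeDisjoint fun i : Fin k => {e | h e = i} := by
    intro i j hij
    refine Set.disjoint_left.2 fun e he he' => hij (Fin.ext ?_)
    exact Eq.trans (Eq.symm he) he'
  refine ⟨fun i => {e | h e = i}, hdisj, ?_, ?_⟩
  · intro i s hs s' hs'
    have h1 := hh.linked i i.2 (some s) ((hS' _).2 ⟨s, hs, rfl⟩) (some s') ((hS' _).2 ⟨s', hs', rfl⟩)
    have h2 : Linked x y (fun e => h e = i) s s' := by
      refine Linked.lift (V := Option V) (fun w => w.getD s) (fun e he => ?_) h1
      exact Linked.of_edge (B := fun e => h e = i) he.1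
    refine Relation.ReflTransGen.mono (fun a b hab => ?_) _ _ h2
    obtain ⟨e, he, hab⟩ := hab
    refine ⟨e, he, ?_⟩
    rw [hxy, Sym2.eq_iff]
    tauto
  · intro u hu
    have hcard : 2 * k ≤ ((incident x' y' A (some u)).filter fun e => k ≤ h e).card
        + (loops u).card := by
      rcases hu with hu | hu
      · have := hh.unused (some u) ((hS' _).2 ⟨u, hu, rfl⟩)
        omega
      · exact hh.reserved (some u) ((hR' _).2 ⟨u, hu, rfl⟩)
    refine balanceVertex_of_unused hk hdisj
      (U := ((incident x' y' A (some u)).filter fun e => k ≤ h e) ∪ loops u) ?_ ?_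
    · intro e he
      rw [hinc]
      rw [Finset.mem_union, Finset.mem_filter, hiA] at he
      rcases he with ⟨⟨-, he⟩, hek⟩ | he
      · refine ⟨he, fun i (hi : h e = i) => ?_⟩
        have := i.2
        omega
      · have he : x e = u ∧ y e = u := by simpa [loops] using he
        refine ⟨Or.inl he.1, fun i (hi : h e = i) => ?_⟩
        have := (hA e).1 (hh.mem e (by have := i.2; omega))
        exact this (he.1.trans he.2.symm)
    · rw [Finset.card_union_of_disjoint]
      · exact hcard
      · refine Finset.disjoint_left.2 fun e he he' => ?_
        rw [Finset.mem_filter, hiA] at he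
        have he' : x e = u ∧ y e = u := by simpa [loops] using he'
        exact he.1.1 (he'.1.trans he'.2.symm)

end SteinerPacking
end

section
/- Let G be a multigraph and let an edge cut split G into components C_1 and C_2. Let G_1 be obtained from G by contracting C_2 into a single vertex v_2, and G_2 be obtained from G by contracting C_1 into a single vertex v_1 (so E(v_1) = E(v_2) is the set of cut edges). Let S ⊆ V(G), S_1 = S ∩ C_1, and S_2 = S ∩ C_2. Suppose H_1, H_2, …, H_k are k pairwise edge-disjoint (S_2 ∪ {v_1})-subgraphs of G_2, and let the subpartition of E(v_2) in G_1 be given by P_i = E(H_i) ∩ E(v_1) for each i. If H_1', H_2', …, H_k' are k pairwise edge-disjoint (S_1 ∪ {v_2})-subgraphs of G_1 that extend v_2 with this subpartition, then H_1 ⊎ H_1', H_2 ⊎ H_2', …, H_k ⊎ H_k' are k pairwise edge-disjoint S-subgraphs of G. -/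
/-!
Multigraphs are modelled by a vertex type `V`, an edge type `E`, and an
incidence map `ends : E → Sym2 V` giving the (unordered) pair of endpoints
of each edge.  Subgraphs are identified with their edge sets (`Set E`).
-/

namespace SteinerPacking

variable {V E : Type}

/-- All endpoints of `e` lie in the set `A`. -/
def BothIn (ends : E → Sym2 V) (A : Set V) (e : E) : Prop := ∀ x ∈ ends e, x ∈ A

/-- The incidence map of the graph obtained from `G` by keeping the vertices
of `A` and contracting all remaining vertices into the single new vertex
`Sum.inr ()`. -/
noncomputable def contractEnds (ends : E → Sym2 V) (A : Set V) (e : E) :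
    Sym2 (↥A ⊕ Unit) :=
  (ends e).map fun x =>
    letI : Decidable (x ∈ A) := Classical.dec _
    if h : x ∈ A then Sum.inl ⟨x, h⟩ else Sum.inr ()

/-- The copy of `S ∩ A` inside the contracted graph on `↥A ⊕ Unit`. -/
def liftSet (A S : Set V) : Set (↥A ⊕ Unit) :=
  {x | ∃ a : ↥A, x = Sum.inl a ∧ (a : V) ∈ S}

lemma Step.symm {ends : E → Sym2 V} {F : Set E} {a b : V} (h : Step ends F a b) :
    Step ends F b a := by
  obtain ⟨e, he, hab⟩ := h
  exact ⟨e, he, hab.trans Sym2.eq_swap⟩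

lemma Reaches.symm {ends : E → Sym2 V} {F : Set E} {a b : V} (h : Reaches ends F a b) :
    Reaches ends F b a :=
  have : Std.Symm (Step ends F) := ⟨fun _ _ => Step.symm⟩
  Relation.ReflTransGen.stdSymm.symm _ _ h

lemma Reaches.mono {ends : E → Sym2 V} {F F' : Set E} (hF : F ⊆ F') {a b : V}
    (h : Reaches ends F a b) : Reaches ends F' a b :=
  Relation.ReflTransGen.mono (fun _ _ ⟨e, he, hab⟩ => ⟨e, hF he, hab⟩) _ _ h

/-- An edge of the contracted graph comes from an edge of the original graph; its endpoints
are the images of the original endpoints. -/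
lemma exists_ends_of_contractEnds_eq {ends : E → Sym2 V} {A : Set V} {e : E}
    {x y : ↥A ⊕ Unit} (h : contractEnds ends A e = s(x, y)) :
    ∃ a b : V, ends e = s(a, b) ∧
      (∀ a' : ↥A, x = Sum.inl a' → a = a') ∧ (x = Sum.inr () → a ∉ A) ∧
      (∀ b' : ↥A, y = Sum.inl b' → b = b') ∧ (y = Sum.inr () → b ∉ A) := by
  unfold contractEnds at h
  generalize ends e = z at h
  induction z using Sym2.ind with
  | _ a b =>
    rw [Sym2.map_mk, Sym2.eq_iff] at h
    rcases h with ⟨rfl, rfl⟩ | ⟨rfl, rfl⟩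
    · refine ⟨a, b, rfl, ?_⟩
      by_cases ha : a ∈ A <;> by_cases hb : b ∈ A <;> simp [ha, hb, Subtype.ext_iff]
    · refine ⟨b, a, Sym2.eq_swap, ?_⟩
      by_cases ha : a ∈ A <;> by_cases hb : b ∈ A <;> simp [ha, hb, Subtype.ext_iff]

lemma contractEnds_eq_of_mem_of_notMem {ends : E → Sym2 V} {A : Set V} {e : E} {a b : V}
    (h : ends e = s(a, b)) (ha : a ∈ A) (hb : b ∉ A) :
    contractEnds ends A e = s(Sum.inl ⟨a, ha⟩, Sum.inr ()) := by
  simp [contractEnds, h, ha, hb]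

/-- A walk of the contracted graph between uncontracted vertices lifts to the original graph
when the contracted vertex is not a cut vertex. -/
lemma Reaches.of_contractEnds {ends : E → Sym2 V} {A : Set V} {F : Set E}
    (hcut : ¬ IsCutVertexOf (contractEnds ends A) F (Sum.inr ())) {a b : ↥A}
    (h : Reaches (contractEnds ends A) F (Sum.inl a) (Sum.inl b)) :
    Reaches ends F a b := by
  have havoid : Reaches (contractEnds ends A)
      {e ∈ F | Sum.inr () ∉ contractEnds ends A e} (Sum.inl a) (Sum.inl b) := by
    by_contra hn
    exact hcut ⟨_, _, Sum.inl_ne_inr, Sum.inl_ne_inr, h, hn⟩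
  refine Relation.ReflTransGen.lift' (Sum.elim Subtype.val fun _ => (a : V)) ?_ _ _ havoid
  rintro x y ⟨e, ⟨he, hinr⟩, hxy⟩
  obtain ⟨u, v, huv, hx, -, hy, -⟩ := exists_ends_of_contractEnds_eq hxy
  rcases x with x | ⟨⟩
  · rcases y with y | ⟨⟩
    · obtain rfl := hx x rfl
      obtain rfl := hy y rfl
      exact .single ⟨e, he, huv⟩
    · exact absurd (hxy ▸ Sym2.mem_mk_right _ _) hinr
  · exact absurd (hxy ▸ Sym2.mem_mk_left _ _) hinr

/-- A walk of the contracted graph lifts to the original graph, with the contracted vertex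
replaced by `c`, when `c` reaches the outer end of every edge leaving `A`. -/
lemma Reaches.of_contractEnds_of_forall {ends : E → Sym2 V} {A : Set V} {F F' : Set E}
    (hF : F ⊆ F') {c : V}
    (hc : ∀ e ∈ F, ∀ a ∈ A, ∀ d ∉ A, ends e = s(a, d) → Reaches ends F' c d)
    {x y : ↥A ⊕ Unit} (h : Reaches (contractEnds ends A) F x y) :
    Reaches ends F' (Sum.elim Subtype.val (fun _ => c) x)
      (Sum.elim Subtype.val (fun _ => c) y) := by
  refine Relation.ReflTransGen.lift' _ ?_ _ _ h
  have hout : ∀ (a : ↥A) (y : ↥A ⊕ Unit), Step (contractEnds ends A) F (Sum.inl a) y →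
      Reaches ends F' a (Sum.elim Subtype.val (fun _ => c) y) := by
    rintro a y ⟨e, he, hay⟩
    obtain ⟨u, v, huv, hx, -, hy, hy'⟩ := exists_ends_of_contractEnds_eq hay
    obtain rfl := hx a rfl
    have hstep : Reaches ends F' a v := .single ⟨e, hF he, huv⟩
    rcases y with y | ⟨⟩
    · obtain rfl := hy y rfl
      exact hstep
    · exact hstep.trans (hc e he a a.2 v (hy' rfl) huv).symm
  rintro (x | ⟨⟩) y hxy
  · exact hout x y hxy
  · rcases y with y | ⟨⟩
    · exact (hout y _ hxy.symm).symm
    · exact .refl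

/-- Let an edge cut split `G` into components `C1` and `C2`,
let `G1` be `G` with `C2` contracted to `v2` and `G2` be `G` with `C1`
contracted to `v1`.  If `H 1, …, H k` are pairwise edge-disjoint
`(S ∩ C2 ∪ {v1})`-subgraphs of `G2`, and `H' 1, …, H' k` are pairwise
edge-disjoint `(S ∩ C1 ∪ {v2})`-subgraphs of `G1` extending at `v2` the
subpartition `P i = E(H i) ∩ E(v1)` (the cut edges used by `H i`), then the
edge-unions `H i ⊎ H' i` are `k` pairwise edge-disjoint `S`-subgraphs of `G`. -/
theorem edge_union_extension {V E : Type} [Fintype V] [Fintype E]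
    (ends : E → Sym2 V) (C1 C2 : Set V)
    (hdisj : Disjoint C1 C2) (hunion : C1 ∪ C2 = Set.univ)
    (hne1 : C1.Nonempty) (hne2 : C2.Nonempty)
    (hcomp1 : ConnectsSet ends {e : E | BothIn ends C1 e} C1)
    (hcomp2 : ConnectsSet ends {e : E | BothIn ends C2 e} C2)
    (S : Set V) (k : ℕ) (H H' : Fin k → Set E)
    (hHsub : ∀ i, H i ⊆ {e : E | ¬ BothIn ends C1 e})
    (hH'sub : ∀ i, H' i ⊆ {e : E | ¬ BothIn ends C2 e})
    (hHdisj : PairwiseEdgeDisjoint H) (hH'disj : PairwiseEdgeDisjoint H')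
    (hHconn : ∀ i, ConnectsSet (contractEnds ends C2) (H i)
        (liftSet C2 S ∪ {(Sum.inr () : ↥C2 ⊕ Unit)}))
    (hH'conn : ∀ i, ConnectsSet (contractEnds ends C1) (H' i)
        (liftSet C1 S ∪ {(Sum.inr () : ↥C1 ⊕ Unit)}))
    (hext : Extend (contractEnds ends C1) (Sum.inr ())
        (fun i => H i ∩ {e : E | ¬ BothIn ends C1 e ∧ ¬ BothIn ends C2 e}) H') :
    PairwiseEdgeDisjoint (fun i => H i ∪ H' i) ∧
      ∀ i, ConnectsSet ends (H i ∪ H' i) S := by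
  have hcompl : ∀ x, x ∉ C2 ↔ x ∈ C1 := fun x =>
    ⟨fun h => ((hunion ▸ Set.mem_univ x : x ∈ C1 ∪ C2)).resolve_right h,
      fun h => Set.disjoint_left.1 hdisj h⟩
  have hshared : ∀ i j, i ≠ j → Disjoint (H i) (H' j) := by
    intro i j hij
    refine Set.disjoint_left.2 fun e hi hj => ?_
    exact Set.disjoint_left.1 (hH'disj i j hij)
      ((hext i).1 ⟨hi, hHsub i hi, hH'sub j hj⟩) hj
  refine ⟨fun i j hij => ?_, fun i => ?_⟩
  · simp only [Set.disjoint_union_left, Set.disjoint_union_right]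
    exact ⟨⟨hHdisj i j hij, (hshared j i hij.symm).symm⟩, hshared i j hij, hH'disj i j hij⟩
  obtain ⟨hP, hcut⟩ := hext i
  obtain ⟨c, hc⟩ : ∃ c : V, ∀ d : ↥C1,
      Reaches (contractEnds ends C1) (H' i) (Sum.inl d) (Sum.inr ()) →
        Reaches ends (H i ∪ H' i) c d := by
    by_cases hex : ∃ c : ↥C1,
        Reaches (contractEnds ends C1) (H' i) (Sum.inl c) (Sum.inr ())
    · obtain ⟨c, hc⟩ := hex
      exact ⟨c, fun d hd =>
        (Reaches.of_contractEnds hcut (hc.trans hd.symm)).mono Set.subset_union_right⟩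
    · exact ⟨hne1.some, fun d hd => absurd ⟨d, hd⟩ hex⟩
  have hcross : ∀ e ∈ H i, ∀ a ∈ C2, ∀ d ∉ C2, ends e = s(a, d) →
      Reaches ends (H i ∪ H' i) c d := by
    intro e he a ha d hd hade
    have ha1 : a ∉ C1 := fun h => (hcompl a).2 h ha
    refine hc ⟨d, (hcompl d).1 hd⟩ (.single ⟨e, hP ⟨he, hHsub i he, fun h => ?_⟩, ?_⟩)
    · exact hd (h d (hade ▸ Sym2.mem_mk_right a d))
    · exact contractEnds_eq_of_mem_of_notMem (hade.trans Sym2.eq_swap) _ ha1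
  have hroot : ∀ s ∈ S, Reaches ends (H i ∪ H' i) c s := by
    intro s hs
    by_cases hs2 : s ∈ C2
    · exact Reaches.of_contractEnds_of_forall Set.subset_union_left hcross
        (hHconn i (Sum.inr ()) (Or.inr rfl) (Sum.inl ⟨s, hs2⟩) (Or.inl ⟨_, rfl, hs⟩))
    · exact hc ⟨s, (hcompl s).1 hs2⟩
        (hH'conn i _ (Or.inl ⟨_, rfl, hs⟩) _ (Or.inr rfl))
  exact fun a ha b hb => (hroot a ha).symm.trans (hroot b hb)

end SteinerPacking
end

section
/- For every integer Q ≥ 30 and every integer k ≥ 3, there exists a loopless multigraph G together with disjoint sets S, R ⊆ V(G) such that S is Qk-edge-connected in G, every vertex in R has degree at least Qk, and there is a vertex v ∉ S ∪ R with a subpartition P_k(v) of E(v) into k parts satisfying: N(v) ⊆ S ∪ R, d(v) ≤ Qk, and there is no edge cut of size at most Qk that breaks G into components C_1, C_2 with S ⊆ C_2, v ∈ C_1, and R ∩ C_1 ≠ ∅; and yet there do not exist k pairwise edge-disjoint S-subgraphs of G that extend P_k(v). (This is a counterexample to the second case of Lau's Extension Theorem.) -/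
/-!
Multigraphs are modelled by a vertex type `V`, an edge type `E`, and an
incidence map `ends : E → Sym2 V` giving the (unordered) pair of endpoints
of each edge.  Subgraphs are identified with their edge sets (`Set E`).
-/

namespace SteinerPacking

variable {V E : Type}

/-- Vertices of the counterexample: the hub, two terminals, and `n` spokes, each with a pendant
leaf. -/
inductive WheelVertex (n : ℕ) : Type
  | hub
  | terminal (b : Bool)
  | spoke (i : Fin n)
  | leaf (i : Fin n)

/-- Edges of the counterexample: every spoke is joined to the hub and to both terminals by one edge,
and to its leaf by `n` parallel edges. -/
inductive WheelEdge (n : ℕ) : Type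
  | toHub (i : Fin n)
  | toTerminal (b : Bool) (i : Fin n)
  | toLeaf (i j : Fin n)

open WheelVertex WheelEdge

noncomputable instance (n : ℕ) : Fintype (WheelVertex n) :=
  let f : WheelVertex n → Unit ⊕ Bool ⊕ Fin n ⊕ Fin n
    | hub => .inl ()
    | terminal b => .inr (.inl b)
    | spoke i => .inr (.inr (.inl i))
    | leaf i => .inr (.inr (.inr i))
  Fintype.ofInjective f (by rintro (_ | _ | _ | _) (_ | _ | _ | _) h <;> simp_all [f])

noncomputable instance (n : ℕ) : Fintype (WheelEdge n) :=
  let f : WheelEdge n → Fin n ⊕ (Bool × Fin n) ⊕ (Fin n × Fin n)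
    | toHub i => .inl i
    | toTerminal b i => .inr (.inl (b, i))
    | toLeaf i j => .inr (.inr (i, j))
  Fintype.ofInjective f (by rintro (_ | _ | _) (_ | _ | _) h <;> simp_all [f])

/-- The incidence map of the counterexample. -/
def wheelEnds (n : ℕ) : WheelEdge n → Sym2 (WheelVertex n)
  | toHub i => s(hub, spoke i)
  | toTerminal b i => s(terminal b, spoke i)
  | toLeaf i _ => s(spoke i, leaf i)

/-- A set closed under steps along `F` is closed under reachability in `F`. -/
lemma Reaches.mem_of_closed {V E : Type} {ends : E → Sym2 V} {F : Set E} {X : Set V} {a b : V}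
    (h : Reaches ends F a b) (ha : a ∈ X)
    (hX : ∀ x ∈ X, ∀ y, Step ends F x y → y ∈ X) : b ∈ X := by
  induction h with
  | refl => exact ha
  | tail _ hs ih => exact hX _ ih _ hs

lemma wheel_loopless (n : ℕ) : Loopless (wheelEnds n) := by
  rintro (i | ⟨b, i⟩ | ⟨i, j⟩) <;> simp [wheelEnds]

lemma incEdges_hub (n : ℕ) : incEdges (wheelEnds n) hub = Set.range toHub := by
  ext e
  rcases e with i | ⟨b, i⟩ | ⟨i, j⟩ <;> simp [incEdges, wheelEnds]

lemma deg_hub (n : ℕ) : deg (wheelEnds n) hub = n := by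
  rw [deg, incEdges_hub, Set.ncard_range_of_injective (fun i j h => by simpa using h)]
  simp

lemma le_deg_spoke (n : ℕ) (i : Fin n) : n ≤ deg (wheelEnds n) (spoke i) := by
  have hsub : Set.range (toLeaf i) ⊆ incEdges (wheelEnds n) (spoke i) := by
    rintro _ ⟨j, rfl⟩
    simp [incEdges, wheelEnds]
  have hcard : (Set.range (toLeaf i)).ncard = n := by
    rw [Set.ncard_range_of_injective (fun i j h => by simpa using h)]
    simp
  exact hcard.symm.le.trans (Set.ncard_le_ncard hsub (Set.toFinite _))

lemma edgeConnectedIn_terminals (n : ℕ) :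
    EdgeConnectedIn (wheelEnds n) Set.univ (Set.range terminal) n := by
  rintro _ ⟨b, rfl⟩ _ ⟨c, rfl⟩ hbc
  have hne : b ≠ c := fun h => hbc (h ▸ rfl)
  refine ⟨fun i => [toTerminal b i, toTerminal c i], fun i => ⟨?_, ?_, ?_⟩, ?_⟩
  · exact .cons (v := spoke i) rfl (.cons Sym2.eq_swap (.nil _))
  · simpa using hne
  · simp
  · intro i j hij e he he'
    simp only [List.mem_cons, List.not_mem_nil, or_false] at he he'
    rcases he with rfl | rfl <;> simp_all

/-- A cut separating the hub and some spoke from the terminals has more than `n` edges. -/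
lemma lt_ncard_cut {n : ℕ} {C D : Set (WheelVertex n)} (hCD : Disjoint C D)
    (hD : Set.range terminal ⊆ D) (hhub : hub ∈ C) {r : Fin n} (hr : spoke r ∈ C) :
    n < {e | ¬ BothIn (wheelEnds n) C e ∧ ¬ BothIn (wheelEnds n) D e}.ncard := by
  classical
  have hD' : ∀ {x}, x ∈ C → x ∉ D := fun hx hx' => Set.disjoint_left.1 hCD hx hx'
  have ht : ∀ b, terminal b ∉ C := fun b hb => hD' hb (hD ⟨b, rfl⟩)
  let f : Option (Fin n) → WheelEdge n
    | none => toTerminal true r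
    | some i => if spoke i ∈ C then toTerminal false i else toHub i
  have hf : Function.Injective f := by
    rintro (_ | i) (_ | j) h <;> simp only [f] at h
    · rfl
    · split_ifs at h; simp at h
    · split_ifs at h; simp at h
    · split_ifs at h <;> simp_all
  have hsub : Set.range f ⊆
      {e | ¬ BothIn (wheelEnds n) C e ∧ ¬ BothIn (wheelEnds n) D e} := by
    rintro _ ⟨_ | i, rfl⟩
    · simp [f, BothIn, wheelEnds, ht, hD' hr]
    · by_cases hi : spoke i ∈ C
      · simp [f, BothIn, wheelEnds, ht, hi, hD' hi]
      · simp [f, BothIn, wheelEnds, hi, hD' hhub]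
  have hcard : (Set.range f).ncard = n + 1 := by
    rw [Set.ncard_range_of_injective hf]
    simp
  have := Set.ncard_le_ncard hsub (Set.toFinite _)
  omega

/-- If the two terminals are connected in `F` and the hub is not a cut vertex of `F`, then `F` holds
both terminal edges of some spoke. -/
lemma exists_spoke_of_reaches {n : ℕ} {F : Set (WheelEdge n)}
    (hF : Reaches (wheelEnds n) F (terminal false) (terminal true))
    (hcut : ¬ IsCutVertexOf (wheelEnds n) F hub) :
    ∃ i, ∀ b, toTerminal b i ∈ F := by
  by_contra! hno
  have hF' : Reaches (wheelEnds n) {e ∈ F | hub ∉ wheelEnds n e}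
      (terminal false) (terminal true) := by
    by_contra h
    exact hcut ⟨_, _, by simp, by simp, hF, h⟩
  let X : Set (WheelVertex n) := {x | match x with
    | hub => False
    | terminal b => b = false
    | spoke i => toTerminal false i ∈ F
    | leaf i => toTerminal false i ∈ F}
  have hmem : terminal true ∈ X := by
    refine hF'.mem_of_closed (X := X) rfl ?_
    rintro x hx y ⟨e, ⟨he, hne⟩, hxy⟩
    rcases e with i | ⟨b, i⟩ | ⟨i, j⟩
    · simp [wheelEnds] at hne
    · have hi := hno i
      simp only [wheelEnds, Sym2.eq_iff] at hxy
      rcases hxy with ⟨rfl, rfl⟩ | ⟨rfl, rfl⟩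
      · have hb : b = false := hx
        subst hb
        exact he
      · have hf : toTerminal false i ∈ F := hx
        obtain ⟨c, hc⟩ := hi
        change b = false
        cases b <;> cases c <;> simp_all
    · simp only [wheelEnds, Sym2.eq_iff] at hxy
      rcases hxy with ⟨rfl, rfl⟩ | ⟨rfl, rfl⟩ <;> exact hx
  exact Bool.noConfusion (show true = false from hmem)

/-- If `F` holds all edges at the hub but neither terminal edge of some spoke, then the hub is a cut
vertex of `F`. -/
lemma isCutVertexOf_hub {n : ℕ} {F : Set (WheelEdge n)} (hF : Set.range toHub ⊆ F)
    {i j : Fin n} (hij : i ≠ j) (hi : ∀ b, toTerminal b i ∉ F) :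
    IsCutVertexOf (wheelEnds n) F hub := by
  refine ⟨spoke i, spoke j, by simp, by simp, ?_, fun h => ?_⟩
  · exact (Relation.ReflTransGen.single ⟨toHub i, hF ⟨i, rfl⟩, Sym2.eq_swap⟩).tail
      ⟨toHub j, hF ⟨j, rfl⟩, rfl⟩
  · have hmem : spoke j ∈ ({spoke i, leaf i} : Set (WheelVertex n)) := by
      refine h.mem_of_closed (by simp) ?_
      rintro x hx y ⟨e, ⟨he, hne⟩, hxy⟩
      rcases e with l | ⟨b, l⟩ | ⟨l, m⟩
      · simp [wheelEnds] at hne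
      · simp only [wheelEnds, Sym2.eq_iff] at hxy
        rcases hxy with ⟨rfl, rfl⟩ | ⟨rfl, rfl⟩
        · simp at hx
        · have hl : l = i := by simpa using hx
          exact absurd (hl ▸ he) (hi b)
      · simp only [wheelEnds, Sym2.eq_iff] at hxy
        rcases hxy with ⟨rfl, rfl⟩ | ⟨rfl, rfl⟩ <;> simpa using hx
    have hji : j = i := by simpa using hmem
    exact hij hji.symm

/-- (Counterexample to the second case of Lau's Extension
Theorem.)  For every integer `Q ≥ 30` and every `k ≥ 3` there is a loopless
multigraph `G` with disjoint `S, R ⊆ V(G)`, `S` being `Qk`-edge-connected,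
every vertex of `R` of degree ≥ `Qk`, and a vertex `v ∉ S ∪ R` carrying a
subpartition `P` of `E(v)` into `k` parts with `N(v) ⊆ S ∪ R`, `d(v) ≤ Qk`,
and no edge cut of size ≤ `Qk` separating a part containing `v` and a vertex
of `R` from `S`; and yet no `k` pairwise edge-disjoint `S`-subgraphs of `G`
extend `P` at `v`. -/
theorem lau_extension_counterexample (Q k : ℕ) (hQ : 30 ≤ Q) (hk : 3 ≤ k) :
    ∃ (V E : Type) (_ : Fintype V) (_ : Fintype E) (ends : E → Sym2 V)
      (S R : Set V) (v : V) (P : Fin k → Set E),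
      Loopless ends ∧ Disjoint S R ∧
      EdgeConnectedIn ends Set.univ S (Q * k) ∧
      (∀ r ∈ R, Q * k ≤ deg ends r) ∧
      v ∉ S ∪ R ∧
      IsSubpartitionAt ends v P ∧
      neighbors ends v ⊆ S ∪ R ∧
      deg ends v ≤ Q * k ∧
      ¬ (∃ C1 C2 : Set V, Disjoint C1 C2 ∧ C1 ∪ C2 = Set.univ ∧
          {e : E | ¬ BothIn ends C1 e ∧ ¬ BothIn ends C2 e}.ncard ≤ Q * k ∧
          S ⊆ C2 ∧ v ∈ C1 ∧ (R ∩ C1).Nonempty) ∧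
      ¬ (∃ H : Fin k → Set E, PairwiseEdgeDisjoint H ∧
          (∀ i, ConnectsSet ends (H i) S) ∧ Extend ends v P H) := by
  have hn : 2 ≤ Q * k := by nlinarith
  let i₀ : Fin k := ⟨0, by omega⟩
  let i₁ : Fin k := ⟨1, by omega⟩
  have h01 : i₀ ≠ i₁ := by simp [i₀, i₁]
  refine ⟨WheelVertex (Q * k), WheelEdge (Q * k), inferInstance, inferInstance, wheelEnds _,
    Set.range terminal, Set.range spoke, hub, fun i => if i = i₁ then Set.range toHub else ∅,
    wheel_loopless _, ?_, edgeConnectedIn_terminals _, ?_, by simp, ⟨?_, ?_⟩, ?_,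
    (deg_hub _).le, ?_, ?_⟩
  · rw [Set.disjoint_left]
    rintro _ ⟨b, rfl⟩ ⟨i, h⟩
    simp at h
  · rintro _ ⟨i, rfl⟩
    exact le_deg_spoke _ i
  · intro i
    rw [incEdges_hub]
    dsimp only
    split_ifs <;> simp
  · intro i j hij
    dsimp only
    split_ifs <;> simp_all
  · rintro x ⟨e, he⟩
    rcases e with i | ⟨b, i⟩ | ⟨i, j⟩ <;> simp [wheelEnds] at he
    exact Or.inr ⟨i, he⟩
  · rintro ⟨C, D, hCD, -, hcard, hD, hhub, _, ⟨r, rfl⟩, hr⟩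
    exact (lt_ncard_cut hCD hD hhub hr).not_ge hcard
  · rintro ⟨H, hdisj, hconn, hext⟩
    obtain ⟨i, hi⟩ := exists_spoke_of_reaches
      (hconn i₀ _ ⟨false, rfl⟩ _ ⟨true, rfl⟩) (hext i₀).2
    have : Nontrivial (Fin (Q * k)) := Fin.nontrivial_iff_two_le.2 hn
    obtain ⟨j, hij⟩ := exists_ne i
    refine (hext i₁).2 (isCutVertexOf_hub ?_ hij.symm
      fun b => Set.disjoint_left.1 (hdisj _ _ h01) (hi b))
    simpa using (hext i₁).1

end SteinerPacking
end
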